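/- Let T > 0, σ > 0, μ₁ > μ₂, let η : [0,1] → ℝ be either η ≡ 0 or η(p) = −(q₁ + q₂)p + q₂ for some constants q₁, q₂ > 0, and define β(p) := ((μ₁ − μ₂)/σ) p(1 − p). Let R : [0,T] × (0,1) → ℝ be bounded and locally Hölder continuous. Then the degenerate Cauchy problem ∂_t C + η(p) ∂_p C + (β(p)²/2) ∂_{pp} C + R(t,p) = 0 on [0,T) × (0,1), with terminal condition C(T, p) = 0 for p ∈ (0,1), admits a solution C that is C^{1,2} on [0,T) × (0,1), continuous up to the boundary {T} × (0,1), and bounded on [0,T] × (0,1); it is the unique solution in this class. -/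

import Mathlib

open Filter Set

/-- The filter volatility `β(p) = ((μ₁ - μ₂)/σ) p (1 - p)`. -/
noncomputable def filterBeta (μ₁ μ₂ σ : ℝ) (p : ℝ) : ℝ := (μ₁ - μ₂) / σ * (p * (1 - p))

/-- `η` is either identically `0` (unknown constant drift) or of the mean-reverting
form `η(p) = -(q₁ + q₂) p + q₂` with `q₁, q₂ > 0` (regime-switching drift). -/
def AdmissibleFilterDrift (η : ℝ → ℝ) : Prop :=
  (∀ p, η p = 0) ∨ ∃ q₁ q₂ : ℝ, 0 < q₁ ∧ 0 < q₂ ∧ ∀ p, η p = -(q₁ + q₂) * p + q₂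

/-- `C` is a solution, `C^{1,2}` on `[0,T) × (0,1)` and continuous up to the boundary
`{T} × (0,1)`, of the degenerate Cauchy problem
`∂_t C + η(p) ∂_p C + (β(p)²/2) ∂_{pp} C + R(t,p) = 0` with terminal condition
`C(T, ·) = 0`.  The functions `Ct, Cp, Cpp` witness the (continuous) partial
derivatives `∂_t C`, `∂_p C`, `∂_{pp} C`. -/
def SolvesSecondCauchy (T σ μ₁ μ₂ : ℝ) (η : ℝ → ℝ) (R : ℝ → ℝ → ℝ)
    (C : ℝ → ℝ → ℝ) : Prop :=
  ∃ Ct Cp Cpp : ℝ → ℝ → ℝ,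
    (∀ t ∈ Ico (0 : ℝ) T, ∀ p ∈ Ioo (0 : ℝ) 1,
      HasDerivWithinAt (fun s => C s p) (Ct t p) (Ico (0 : ℝ) T) t ∧
      HasDerivAt (fun q => C t q) (Cp t p) p ∧
      HasDerivAt (fun q => Cp t q) (Cpp t p) p) ∧
    ContinuousOn (fun z : ℝ × ℝ => Ct z.1 z.2) (Ico (0 : ℝ) T ×ˢ Ioo (0 : ℝ) 1) ∧
    ContinuousOn (fun z : ℝ × ℝ => Cp z.1 z.2) (Ico (0 : ℝ) T ×ˢ Ioo (0 : ℝ) 1) ∧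
    ContinuousOn (fun z : ℝ × ℝ => Cpp z.1 z.2) (Ico (0 : ℝ) T ×ˢ Ioo (0 : ℝ) 1) ∧
    ContinuousOn (fun z : ℝ × ℝ => C z.1 z.2) (Icc (0 : ℝ) T ×ˢ Ioo (0 : ℝ) 1) ∧
    (∀ t ∈ Ico (0 : ℝ) T, ∀ p ∈ Ioo (0 : ℝ) 1,
      Ct t p + η p * Cp t p + filterBeta μ₁ μ₂ σ p ^ 2 / 2 * Cpp t p + R t p = 0) ∧
    (∀ p ∈ Ioo (0 : ℝ) 1, C T p = 0)


namespace SCP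

/-- second derivative test -/
lemma second_deriv_nonpos_of_max {f f' : ℝ → ℝ} {c x : ℝ} (hf : ∀ᶠ y in nhds x, HasDerivAt f (f' y) y)
    (hf' : HasDerivAt f' c x) (hmax : IsLocalMax f x) : f' x = 0 ∧ c ≤ 0 := by
  have h0 : f' x = 0 := hmax.hasDerivAt_eq_zero hf.self_of_nhds
  refine ⟨h0, ?_⟩
  by_contra hc
  push Not at hc
  have hd : ∀ᶠ y in nhds x, deriv f y = f' y := hf.mono fun y hy => hy.deriv
  have e1 : deriv (deriv f) x = c := by
    rw [Filter.EventuallyEq.deriv_eq hd, hf'.deriv]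
  have hmin : ∀ᶠ y in nhdsWithin x {x}ᶜ, 0 < f' y * (y - x) := by
    have := hasDerivAt_iff_tendsto_slope.1 hf'
    have h2 := this.eventually (lt_mem_nhds hc)
    filter_upwards [h2, self_mem_nhdsWithin] with y hy hyx
    have : y - x ≠ 0 := sub_ne_zero.2 hyx
    rw [slope_def_field, h0, sub_zero] at hy
    have h3 : f' y * (y - x) = f' y / (y - x) * (y - x)^2 := by field_simp
    rw [h3]; positivity
  -- on the right, f strictly increasing
  have h4 : ∀ᶠ y in nhds x, x < y → 0 < f' y := by
    rw [eventually_nhdsWithin_iff] at hmin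
    filter_upwards [hmin] with y hy hxy
    have := hy (ne_of_gt hxy)
    exact pos_of_mul_pos_left this (sub_nonneg.2 hxy.le)
  obtain ⟨ε, hε, hball⟩ := Metric.eventually_nhds_iff_ball.1 ((h4.and hf).and hmax)
  have hin : ∀ y ∈ Icc x (x + ε/2), y ∈ Metric.ball x ε := by
    intro y hy
    rw [Metric.mem_ball, Real.dist_eq, abs_of_nonneg (by linarith [hy.1])]
    linarith [hy.2]
  have hs : StrictMonoOn f (Icc x (x+ε/2)) := by
    apply strictMonoOn_of_deriv_pos (convex_Icc _ _)
    · intro y hy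
      exact ((hball y (hin y hy)).1.2).continuousAt.continuousWithinAt
    · intro y hy
      rw [interior_Icc] at hy
      have hb := (hball y (hin y ⟨hy.1.le, hy.2.le⟩)).1
      rw [hb.2.deriv]
      exact hb.1 hy.1
  have := hs (left_mem_Icc.2 (by linarith)) (right_mem_Icc.2 (by linarith)) (by linarith : x < x + ε/2)
  have h5 := (hball (x+ε/2) (hin _ (right_mem_Icc.2 (by linarith)))).2
  linarith

/-- Weak maximum principle on a rectangle, strict version. -/
lemma max_principle {T A B : ℝ} (a b : ℝ → ℝ) (ha : ∀ x ∈ Ioo A B, 0 ≤ a x)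
    (D Dt Dx Dxx : ℝ → ℝ → ℝ)
    (hc : ContinuousOn (fun z : ℝ × ℝ => D z.1 z.2) (Icc 0 T ×ˢ Icc A B))
    (ht : ∀ t ∈ Ioc 0 T, ∀ x ∈ Ioo A B, HasDerivWithinAt (fun s => D s x) (Dt t x) (Ioc 0 T) t)
    (hx : ∀ t ∈ Ioc 0 T, ∀ x ∈ Ioo A B, HasDerivAt (fun y => D t y) (Dx t x) x)
    (hxx : ∀ t ∈ Ioc 0 T, ∀ x ∈ Ioo A B, HasDerivAt (fun y => Dx t y) (Dxx t x) x)
    (hlt : ∀ t ∈ Ioc 0 T, ∀ x ∈ Ioo A B, Dt t x < a x * Dxx t x + b x * Dx t x)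
    (h0 : ∀ x ∈ Icc A B, D 0 x ≤ 0) (hA : ∀ t ∈ Icc 0 T, D t A ≤ 0) (hB : ∀ t ∈ Icc 0 T, D t B ≤ 0) :
    ∀ t ∈ Icc 0 T, ∀ x ∈ Icc A B, D t x ≤ 0 := by
  intro t0 ht0 x0 hx0
  have hK : IsCompact (Icc (0:ℝ) T ×ˢ Icc A B) := isCompact_Icc.prod isCompact_Icc
  obtain ⟨⟨t, x⟩, ⟨ht', hx'⟩, hm⟩ := hK.exists_isMaxOn ⟨(t0, x0), ht0, hx0⟩ hc
  have hmax : ∀ s ∈ Icc 0 T, ∀ y ∈ Icc A B, D s y ≤ D t x := fun s hs y hy => hm (a := (s, y)) ⟨hs, hy⟩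
  refine (hmax t0 ht0 x0 hx0).trans ?_
  simp only at ht' hx'
  by_contra hpos
  push Not at hpos
  have htpos : 0 < t := by
    rcases ht'.1.eq_or_lt with h | h
    · subst h; exact absurd (h0 x hx') (not_le.2 hpos)
    · exact h
  have hxA : A < x := by
    rcases hx'.1.eq_or_lt with h | h
    · subst h; exact absurd (hA t ht') (not_le.2 hpos)
    · exact h
  have hxB : x < B := by
    rcases hx'.2.eq_or_lt with h | h
    · subst h; exact absurd (hB t ht') (not_le.2 hpos)
    · exact h
  have htI : t ∈ Ioc 0 T := ⟨htpos, ht'.2⟩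
  have hxI : x ∈ Ioo A B := ⟨hxA, hxB⟩
  have hnb : Ioo A B ∈ nhds x := isOpen_Ioo.mem_nhds hxI
  obtain ⟨e1, e2⟩ := second_deriv_nonpos_of_max (f := D t) (f' := Dx t)
    (by filter_upwards [hnb] with y hy using hx t htI y hy) (hxx t htI x hxI)
    (by filter_upwards [hnb] with y hy using hmax t ht' y (Ioo_subset_Icc_self hy))
  have e3 : 0 ≤ Dt t x := by
    have h1 : HasDerivWithinAt (fun s => D s x) (Dt t x) (Ioo 0 t) t :=
      (ht t htI x hxI).mono (fun s hs => ⟨hs.1, hs.2.le.trans ht'.2⟩)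
    have h2 := hasDerivWithinAt_iff_tendsto_slope.1 h1
    have h3 : Ioo 0 t \ {t} = Ioo 0 t := by
      ext s; simp only [Set.mem_sdiff, mem_singleton_iff, and_iff_left_iff_imp]; exact fun h => h.2.ne
    rw [h3] at h2
    have : (nhdsWithin t (Ioo 0 t)).NeBot := by
      rw [nhdsWithin_Ioo_eq_nhdsLT htpos]; infer_instance
    refine ge_of_tendsto h2 ?_
    filter_upwards [self_mem_nhdsWithin] with s hs
    rw [slope_def_field]
    have := hmax s ⟨hs.1.le, hs.2.le.trans ht'.2⟩ x hx'
    exact div_nonneg_of_nonpos (by linarith) (by linarith [hs.2])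
  have := hlt t htI x hxI
  rw [e1] at this
  nlinarith [mul_nonneg (ha x hxI) (neg_nonneg.2 e2)]

/-- Maximum principle with a Lyapunov function. -/
lemma max_principle_lyap {T A B : ℝ} (a b : ℝ → ℝ) (ha : ∀ x ∈ Ioo A B, 0 ≤ a x)
    (w w' w'' : ℝ → ℝ) (K N M : ℝ) (hN : 0 < N) (hM : 0 < M) (hK : 0 ≤ K)
    (hwc : ContinuousOn w (Icc A B))
    (hw : ∀ x ∈ Ioo A B, HasDerivAt w (w' x) x) (hw' : ∀ x ∈ Ioo A B, HasDerivAt w' (w'' x) x)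
    (hLw : ∀ x ∈ Ioo A B, a x * w'' x + b x * w' x ≤ K)
    (hw0 : ∀ x ∈ Icc A B, 0 ≤ w x) (hwA : N ≤ w A) (hwB : N ≤ w B)
    (D Dt Dx Dxx : ℝ → ℝ → ℝ)
    (hc : ContinuousOn (fun z : ℝ × ℝ => D z.1 z.2) (Icc 0 T ×ˢ Icc A B))
    (ht : ∀ t ∈ Ioc 0 T, ∀ x ∈ Ioo A B, HasDerivWithinAt (fun s => D s x) (Dt t x) (Ioc 0 T) t)
    (hx : ∀ t ∈ Ioc 0 T, ∀ x ∈ Ioo A B, HasDerivAt (fun y => D t y) (Dx t x) x)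
    (hxx : ∀ t ∈ Ioc 0 T, ∀ x ∈ Ioo A B, HasDerivAt (fun y => Dx t y) (Dxx t x) x)
    (hle : ∀ t ∈ Ioc 0 T, ∀ x ∈ Ioo A B, Dt t x ≤ a x * Dxx t x + b x * Dx t x)
    (h0 : ∀ x ∈ Icc A B, D 0 x ≤ 0) (hA : ∀ t ∈ Icc 0 T, D t A ≤ M) (hB : ∀ t ∈ Icc 0 T, D t B ≤ M) :
    ∀ t ∈ Icc 0 T, ∀ x ∈ Icc A B, D t x ≤ M / N * (w x + (K + 1) * t) := by
  intro t htt x hxx'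
  have hMN : 0 < M / N := by positivity
  have key := max_principle (T := T) (A := A) (B := B) a b ha
    (fun t x => D t x - M / N * (w x + (K + 1) * t))
    (fun t x => Dt t x - M / N * (K + 1)) (fun t x => Dx t x - M / N * w' x)
    (fun t x => Dxx t x - M / N * w'' x) ?_ ?_ ?_ ?_ ?_ ?_ ?_ ?_ t htt x hxx'
  · linarith
  · refine hc.sub (continuousOn_const.mul ((hwc.comp continuousOn_snd fun z hz => hz.2).add ?_))
    fun_prop
  · intro t ht1 x hx1
    have h2 : HasDerivAt (fun s : ℝ => M / N * (w x + (K + 1) * s)) (M / N * (K + 1)) t := by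
      have := (((hasDerivAt_id t).const_mul (K+1)).const_add (w x)).const_mul (M / N)
      simpa using this
    exact (ht t ht1 x hx1).sub h2.hasDerivWithinAt
  · intro t ht1 x hx1
    have h2 := ((hw x hx1).add_const ((K + 1) * t)).const_mul (M / N)
    exact (hx t ht1 x hx1).sub h2
  · intro t ht1 x hx1
    exact (hxx t ht1 x hx1).sub ((hw' x hx1).const_mul (M / N))
  · intro t ht1 x hx1
    have h1 := hle t ht1 x hx1
    have h2 := hLw x hx1
    have h3 := mul_le_mul_of_nonneg_left h2 hMN.le
    nlinarith
  · intro x hx1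
    have := mul_nonneg hMN.le (hw0 x hx1)
    have h1 := h0 x hx1
    simp only [mul_zero, add_zero]; linarith
  · intro t ht1
    have h1 := hA t ht1
    have h2 : M ≤ M / N * (w A + (K + 1) * t) := by
      calc M = M / N * N := by field_simp
        _ ≤ _ := by
          apply mul_le_mul_of_nonneg_left _ hMN.le
          nlinarith [mul_nonneg (by linarith : 0 ≤ K + 1) ht1.1]
    linarith
  · intro t ht1
    have h1 := hB t ht1
    have h2 : M ≤ M / N * (w B + (K + 1) * t) := by
      calc M = M / N * N := by field_simp
        _ ≤ _ := by
          apply mul_le_mul_of_nonneg_left _ hMN.le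
          nlinarith [mul_nonneg (by linarith : 0 ≤ K + 1) ht1.1]
    linarith

end SCP


namespace SCP
open MeasureTheory

/-- rapidly decaying continuous kernels -/
def Ker (k : ℝ → ℝ) : Prop := Continuous k ∧ ∃ C : ℝ, 0 ≤ C ∧ ∀ z, |k z| ≤ C * Real.exp (-(1/4) * z ^ 2)

lemma Ker.integrable_rpow {k : ℝ → ℝ} (hk : Ker k) {β : ℝ} (hβ : 0 ≤ β) :
    Integrable (fun z => |z| ^ β * |k z|) := by
  obtain ⟨hc, C, hC, hb⟩ := hk
  have h1 := (integrable_rpow_mul_exp_neg_mul_sq (b := 1/4) (by norm_num) (s := β) (by linarith)).norm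
  have h2 : Integrable (fun x : ℝ => |x| ^ β * Real.exp (-(1/4) * x ^ 2)) := by
    have h3 := integrable_rpow_mul_exp_neg_mul_sq (b := 1/4) (by norm_num) (s := β) (by linarith)
    have h4 := h3.indicator (measurableSet_Ici (a := (0:ℝ)))
    refine (h4.add h4.comp_neg).mono' ?_ (ae_of_all _ fun x => ?_)
    · exact ((continuous_abs.rpow_const (fun _ => Or.inr hβ)).mul (by fun_prop)).aestronglyMeasurable
    have hnn : ∀ y : ℝ, 0 ≤ (Ici (0:ℝ)).indicator (fun x => x ^ β * Real.exp (-(1/4) * x ^ 2)) y :=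
      fun y => indicator_nonneg (fun z hz => mul_nonneg (Real.rpow_nonneg hz _) (Real.exp_pos _).le) y
    rw [Real.norm_eq_abs, abs_of_nonneg (by positivity)]
    simp only [Pi.add_apply]
    rcases le_total 0 x with hx | hx
    · have := hnn (-x)
      rw [indicator_of_mem (show x ∈ Ici 0 from hx), abs_of_nonneg hx]; linarith
    · have := hnn x
      rw [indicator_of_mem (show -x ∈ Ici 0 from neg_nonneg.2 hx), abs_of_nonpos hx, neg_sq]; linarith
  refine (h2.const_mul C).mono' ?_ ?_
  · exact ((continuous_abs.rpow_const (fun _ => Or.inr hβ)).mul hc.abs).aestronglyMeasurable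
  · refine ae_of_all _ fun z => ?_
    rw [Real.norm_eq_abs, abs_of_nonneg (by positivity)]
    calc |z| ^ β * |k z| ≤ |z| ^ β * (C * Real.exp (-(1/4) * z ^ 2)) := by gcongr; exact hb z
      _ = _ := by ring

lemma Ker.integrable {k : ℝ → ℝ} (hk : Ker k) : Integrable k := by
  obtain ⟨hc, C, hC, hb⟩ := hk
  have h3 := integrable_exp_neg_mul_sq (b := 1/4) (by norm_num)
  exact (h3.const_mul C).mono' hc.aestronglyMeasurable (ae_of_all _ hb)

lemma Ker.integrable_abs {k : ℝ → ℝ} (hk : Ker k) : Integrable (fun z => |k z|) := hk.integrable.abs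

/-- `∫ φ(x + λ z) k(z) dz` -/
noncomputable def WL (k φ : ℝ → ℝ) (l x : ℝ) : ℝ := ∫ z, φ (x + l * z) * k z

lemma integrable_WL {k φ : ℝ → ℝ} (hk : Ker k) (hφ : Continuous φ) {M : ℝ} (hM : ∀ x, |φ x| ≤ M) (l x : ℝ) :
    Integrable (fun z => φ (x + l * z) * k z) := by
  refine hk.integrable.bdd_mul (c := M) (hφ.comp (by fun_prop)).aestronglyMeasurable (ae_of_all _ fun z => hM _)

lemma WL_bound {k φ : ℝ → ℝ} (hk : Ker k) {M : ℝ} (hM : ∀ x, |φ x| ≤ M) (l x : ℝ) :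
    |WL k φ l x| ≤ M * ∫ z, |k z| := by
  rw [← integral_const_mul]
  rw [← Real.norm_eq_abs]
  refine norm_integral_le_of_norm_le (hk.integrable_abs.const_mul M) (ae_of_all _ fun z => ?_)
  rw [Real.norm_eq_abs, abs_mul]
  exact mul_le_mul_of_nonneg_right (hM _) (abs_nonneg _)

lemma WL_vanish {k φ : ℝ → ℝ} (hk : Ker k) (hφ : Continuous φ) {M : ℝ} (hM : ∀ x, |φ x| ≤ M)
    {l x a K β : ℝ} (hl : 0 ≤ l) (hβ : 0 ≤ β) (h0 : a * ∫ z, k z = 0)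
    (h : ∀ y, |φ (x + y) - a| ≤ K * |y| ^ β) :
    |WL k φ l x| ≤ K * l ^ β * ∫ z, |z| ^ β * |k z| := by
  have e : WL k φ l x = ∫ z, (φ (x + l * z) - a) * k z := by
    simp only [sub_mul]
    rw [integral_sub (integrable_WL hk hφ hM l x) (hk.integrable.const_mul a), integral_const_mul, h0, sub_zero]
    rfl
  rw [e, ← integral_const_mul]
  rw [← Real.norm_eq_abs]
  refine norm_integral_le_of_norm_le ((hk.integrable_rpow hβ).const_mul _) (ae_of_all _ fun z => ?_)
  rw [Real.norm_eq_abs, abs_mul]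
  calc _ ≤ (K * |l * z| ^ β) * |k z| := by gcongr; exact h _
    _ = _ := by rw [abs_mul, abs_of_nonneg hl, Real.mul_rpow hl (abs_nonneg _)]; ring

lemma WL_continuous {k : ℝ → ℝ} (hk : Ker k) {φ : ℝ → ℝ → ℝ} (hφ : Continuous (fun z : ℝ × ℝ => φ z.1 z.2))
    {M : ℝ} (hM : ∀ s x, |φ s x| ≤ M) :
    Continuous (fun q : ℝ × ℝ × ℝ => WL k (φ q.2.1) q.1 q.2.2) := by
  unfold WL
  refine continuous_of_dominated (bound := fun z => M * |k z|) ?_ ?_ (hk.integrable_abs.const_mul M) ?_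
  · intro q
    have : Continuous (fun z => φ q.2.1 (q.2.2 + q.1 * z) * k z) :=
      (hφ.comp (by fun_prop : Continuous fun z : ℝ => (q.2.1, q.2.2 + q.1 * z))).mul hk.1
    exact this.aestronglyMeasurable
  · intro q
    refine ae_of_all _ fun z => ?_
    rw [Real.norm_eq_abs, abs_mul]
    exact mul_le_mul_of_nonneg_right (hM _ _) (abs_nonneg _)
  · refine ae_of_all _ fun z => ?_
    exact (hφ.comp (by fun_prop : Continuous fun q : ℝ × ℝ × ℝ => (q.2.1, q.2.2 + q.1 * z))).mul continuous_const

lemma WL_eq {k φ : ℝ → ℝ} {l : ℝ} (hl : 0 < l) (x : ℝ) :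
    WL k φ l x = l⁻¹ * ∫ y, φ y * k ((y - x) / l) := by
  have h1 := Measure.integral_comp_mul_left (fun u => φ (x + u) * k (u / l)) l
  have h2 := integral_add_left_eq_self (μ := (volume : Measure ℝ)) (fun y => φ y * k ((y - x) / l)) x
  rw [← h2]
  simp only [add_sub_cancel_left]
  rw [smul_eq_mul, abs_of_pos (inv_pos.2 hl)] at h1
  rw [← h1]
  unfold WL
  congr 1; ext z
  rw [mul_div_cancel_left₀ _ hl.ne']

lemma integrable_gauss_shift {b : ℝ} (hb : 0 < b) (x : ℝ) : Integrable (fun y : ℝ => Real.exp (-b * (y - x) ^ 2)) :=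
  (integrable_exp_neg_mul_sq hb).comp_sub_right x

lemma integrable_kerform {k φ : ℝ → ℝ} (hk : Ker k) (hφ : Continuous φ) {M : ℝ} (hM : ∀ x, |φ x| ≤ M)
    {l : ℝ} (hl : 0 < l) (x : ℝ) : Integrable (fun y => φ y * k ((y - x) / l)) := by
  have h1 : Integrable (fun y => k ((y - x) / l)) := (hk.integrable.comp_div hl.ne').comp_sub_right x
  exact h1.bdd_mul (c := M) hφ.aestronglyMeasurable (ae_of_all _ hM)

lemma WL_deriv_x {k k' φ : ℝ → ℝ} (hk : Ker k) (hk' : Ker k') (hd : ∀ z, HasDerivAt k (k' z) z)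
    (hφ : Continuous φ) {M : ℝ} (hM : ∀ x, |φ x| ≤ M) {l : ℝ} (hl : 0 < l) (x : ℝ) :
    HasDerivAt (fun x => WL k φ l x) (-l⁻¹ * WL k' φ l x) x := by
  have hM0 : 0 ≤ M := (abs_nonneg _).trans (hM 0)
  obtain ⟨hc', C, hC, hb⟩ := id hk'
  have key := hasDerivAt_integral_of_dominated_loc_of_deriv_le (μ := (volume : Measure ℝ))
    (F := fun x y => φ y * k ((y - x) / l)) (F' := fun x y => φ y * (k' ((y - x) / l) * (-1 / l)))
    (x₀ := x) (s := Metric.ball x l)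
    (bound := fun y => M * C * l⁻¹ * Real.exp (1/4) * Real.exp (-(1 / (8 * l ^ 2)) * (y - x) ^ 2))
    (Metric.ball_mem_nhds x hl) ?_ (integrable_kerform hk hφ hM hl x) ?_ ?_ ?_ ?_
  · have h2 := key.2.const_mul l⁻¹
    have e : (fun x => WL k φ l x) = fun x => l⁻¹ * ∫ y, φ y * k ((y - x) / l) := by
      ext x; exact WL_eq hl x
    rw [e, WL_eq hl]
    refine h2.congr_deriv ?_
    have e3 : ∫ y, φ y * (k' ((y - x) / l) * (-1 / l)) = (-1 / l) * ∫ y, φ y * k' ((y - x) / l) := by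
      rw [← integral_const_mul]; congr 1; ext y; ring
    rw [e3]; ring
  · refine Eventually.of_forall fun x => ?_
    exact (hφ.mul (hk.1.comp (by fun_prop))).aestronglyMeasurable
  · exact (hφ.mul ((hc'.comp (by fun_prop)).mul continuous_const)).aestronglyMeasurable
  · refine ae_of_all _ fun y x' hx' => ?_
    rw [Metric.mem_ball, Real.dist_eq] at hx'
    have h1 : (x' - x)^2 ≤ l^2 := by rw [← sq_abs (x' - x)]; gcongr
    have h2 : Real.exp (-(1/4) * ((y - x')/l)^2) ≤ Real.exp (1/4) * Real.exp (-(1 / (8 * l ^ 2)) * (y - x) ^ 2) := by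
      rw [← Real.exp_add]
      apply Real.exp_le_exp.2
      have : -(1/4) * ((y - x')/l)^2 = -(1/(8*l^2)) * (2 * (y-x')^2) := by field_simp; ring
      rw [this]
      have h3 : (1/4 : ℝ) = (1/(8*l^2)) * (2 * l^2) := by field_simp; ring
      rw [h3]
      have h4 : (y-x)^2 ≤ 2*(y-x')^2 + 2 * l^2 := by nlinarith [sq_nonneg ((y-x') - (x'-x))]
      have h5 : 0 < 1/(8*l^2) := by positivity
      nlinarith
    rw [Real.norm_eq_abs, abs_mul, abs_mul]
    have h6 : |(-1/l)| = l⁻¹ := by rw [abs_div, abs_neg, abs_one, abs_of_pos hl, one_div]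
    rw [h6]
    calc |φ y| * (|k' ((y - x') / l)| * l⁻¹) ≤ M * ((C * (Real.exp (1/4) * Real.exp (-(1 / (8 * l ^ 2)) * (y - x) ^ 2))) * l⁻¹) := by
          gcongr
          · exact hM y
          · exact (hb _).trans (by gcongr)
      _ = _ := by ring
  · exact (integrable_gauss_shift (by positivity) x).const_mul _
  · refine ae_of_all _ fun y x' _ => ?_
    have h1 : HasDerivAt (fun x : ℝ => (y - x) / l) (-1 / l) x' := by
      simpa using ((hasDerivAt_id x').const_sub y).div_const l
    exact ((hd _).comp x' h1).const_mul (φ y)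

lemma WL_deriv_l {k k' φ : ℝ → ℝ} (hk : Ker k) (hk' : Ker (fun z => z * k' z))
    (hd : ∀ z, HasDerivAt k (k' z) z)
    (hφ : Continuous φ) {M : ℝ} (hM : ∀ x, |φ x| ≤ M) {l : ℝ} (hl : 0 < l) (x : ℝ) :
    HasDerivAt (fun l => WL k φ l x) (-l⁻¹ * WL (fun z => k z + z * k' z) φ l x) l := by
  have hM0 : 0 ≤ M := (abs_nonneg _).trans (hM 0)
  obtain ⟨hc', C, hC, hb⟩ := id hk'
  have key := hasDerivAt_integral_of_dominated_loc_of_deriv_le (μ := (volume : Measure ℝ))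
    (F := fun l y => φ y * k ((y - x) / l)) (F' := fun l y => φ y * ((((y - x) / l) * k' ((y - x) / l)) * (-1 / l)))
    (x₀ := l) (s := Metric.ball l (l/2))
    (bound := fun y => M * C * (2 / l) * Real.exp (-(1 / (9 * l ^ 2)) * (y - x) ^ 2))
    (Metric.ball_mem_nhds l (by positivity)) ?_ (integrable_kerform hk hφ hM hl x) ?_ ?_ ?_ ?_
  · have h2 := (hasDerivAt_inv hl.ne').mul key.2
    have e : (fun l => WL k φ l x) =ᶠ[nhds l] fun l => l⁻¹ * ∫ y, φ y * k ((y - x) / l) := by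
      filter_upwards [lt_mem_nhds hl] with l' hl'
      exact WL_eq hl' x
    refine HasDerivAt.congr_of_eventuallyEq ?_ e
    refine h2.congr_deriv ?_
    have e2 : WL (fun z => k z + z * k' z) φ l x = WL k φ l x + WL (fun z => z * k' z) φ l x := by
      unfold WL
      rw [← integral_add (integrable_WL hk hφ hM l x) (integrable_WL hk' hφ hM l x)]
      congr 1; ext z; ring
    rw [e2, WL_eq hl, WL_eq hl]
    have e3 : ∫ y, φ y * ((((y - x) / l) * k' ((y - x) / l)) * (-1 / l)) =
        (-1 / l) * ∫ y, φ y * (((y - x) / l) * k' ((y - x) / l)) := by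
      rw [← integral_const_mul]; congr 1; ext y; ring
    rw [e3]
    field_simp
    ring
  · filter_upwards with l'
    have hm : Measurable (fun y => φ y * k ((y - x) / l')) :=
      hφ.measurable.mul (hk.1.measurable.comp (by fun_prop))
    exact hm.aestronglyMeasurable
  · have : Continuous (fun y => φ y * ((((y - x) / l) * k' ((y - x) / l)) * (-1 / l))) :=
      hφ.mul ((hc'.comp (by fun_prop : Continuous fun y : ℝ => (y - x)/l)).mul continuous_const)
    exact this.aestronglyMeasurable
  · refine ae_of_all _ fun y l' hl' => ?_
    rw [Metric.mem_ball, Real.dist_eq, abs_lt] at hl'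
    have hl1 : 0 < l' := by linarith
    have h2 : Real.exp (-(1/4) * ((y - x)/l')^2) ≤ Real.exp (-(1 / (9 * l ^ 2)) * (y - x) ^ 2) := by
      apply Real.exp_le_exp.2
      have h3 : (1/4) * ((y - x)/l')^2 = 1/(4*l'^2) * (y-x)^2 := by field_simp
      have h4 : 1/(9*l^2) ≤ 1/(4*l'^2) := by
        apply one_div_le_one_div_of_le (by positivity)
        nlinarith
      have := mul_le_mul_of_nonneg_right h4 (sq_nonneg (y-x))
      linarith
    rw [Real.norm_eq_abs, abs_mul, abs_mul]
    have h6 : |(-1/l')| ≤ 2 / l := by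
      rw [abs_div, abs_neg, abs_one, abs_of_pos hl1, div_le_div_iff₀ hl1 hl]; linarith
    calc |φ y| * (|(y - x) / l' * k' ((y - x) / l')| * |-1/l'|) ≤ M * ((C * (Real.exp (-(1 / (9 * l ^ 2)) * (y - x) ^ 2))) * (2 / l)) := by
          gcongr
          · exact hM y
          · exact (hb _).trans (by gcongr)
      _ = _ := by ring
  · exact (integrable_gauss_shift (by positivity) x).const_mul _
  · refine ae_of_all _ fun y l' hl' => ?_
    rw [Metric.mem_ball, Real.dist_eq, abs_lt] at hl'
    have hl1 : l' ≠ 0 := by linarith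
    have h1 : HasDerivAt (fun l : ℝ => (y - x) / l) (((y - x) / l') * (-1 / l')) l' := by
      have := (hasDerivAt_inv hl1).const_mul (y - x)
      refine (this.congr_deriv ?_)
      field_simp
    have := ((hd _).comp l' h1).const_mul (φ y)
    refine this.congr_deriv ?_
    ring

/-! Hermite kernels -/

noncomputable def gs (z : ℝ) : ℝ := (√(2 * Real.pi))⁻¹ * Real.exp (-(1/2) * z ^ 2)

lemma ker_of_poly {p : ℝ → ℝ} (hp : Continuous p) {C : ℝ} (h : ∀ z, |p z| ≤ C * (1 + z ^ 4)) :
    Ker (fun z => p z * gs z) := by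
  have hC : 0 ≤ C := by have := (abs_nonneg _).trans (h 0); simpa using this
  refine ⟨by unfold gs; fun_prop, C * 32 * (√(2 * Real.pi))⁻¹, by positivity, fun z => ?_⟩
  have h1 : 1 + z^4 ≤ 32 * Real.exp ((1/4) * z^2) := by
    have := Real.quadratic_le_exp_of_nonneg (x := (1/4) * z^2) (by positivity)
    nlinarith [sq_nonneg z]
  have h2 : Real.exp (-(1/2) * z^2) = Real.exp (-(1/4)*z^2) * Real.exp (-(1/4)*z^2) := by
    rw [← Real.exp_add]; congr 1; ring
  have h3 : Real.exp ((1/4) * z^2) * Real.exp (-(1/4)*z^2) = 1 := by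
    rw [← Real.exp_add]; simp
  rw [abs_mul]
  have hg : |gs z| = gs z := abs_of_nonneg (by unfold gs; positivity)
  rw [hg]
  unfold gs
  calc |p z| * ((√(2 * Real.pi))⁻¹ * Real.exp (-(1/2) * z ^ 2)) ≤ (C * (32 * Real.exp ((1/4) * z^2))) * ((√(2 * Real.pi))⁻¹ * Real.exp (-(1/2) * z ^ 2)) := by
        gcongr
        exact (h z).trans (by gcongr)
    _ = C * 32 * (√(2 * Real.pi))⁻¹ * Real.exp (-(1/4)*z^2) * (Real.exp ((1/4) * z^2) * Real.exp (-(1/4)*z^2)) := by rw [h2]; ring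
    _ = _ := by rw [h3, mul_one]

lemma pow_bd (z : ℝ) : |z| ≤ 1 + z^4 ∧ z^2 ≤ 1 + z^4 ∧ |z|^3 ≤ 1 + z^4 := by
  have h : z^4 = |z|^4 := by rw [← abs_pow, abs_of_nonneg (by positivity)]
  have h2 : z^2 = |z|^2 := by rw [sq_abs]
  rw [h, h2]
  have := abs_nonneg z
  set u := |z|
  refine ⟨?_, ?_, ?_⟩
  · nlinarith [sq_nonneg (u^2 - 1), sq_nonneg (u - 1), sq_nonneg (u^2-1/2)]
  · nlinarith [sq_nonneg (u^2 - 1)]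
  · nlinarith [sq_nonneg (u^2 - u), sq_nonneg (u^2 - 1), sq_nonneg u]

/-- Hermite polynomials times Gaussian -/
noncomputable def hk (j : ℕ) (z : ℝ) : ℝ :=
  (match j with | 0 => 1 | 1 => z | 2 => z^2 - 1 | _ => z^3 - 3*z) * gs z

lemma ker_hk (j : ℕ) : Ker (hk j) := by
  unfold hk
  match j with
  | 0 => exact ker_of_poly (p := fun _ => 1) (C := 1) continuous_const (fun z => by simp; positivity)
  | 1 => exact ker_of_poly (p := fun z => z) (C := 1) continuous_id (fun z => by linarith [(pow_bd z).1])
  | 2 => 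
    refine ker_of_poly (p := fun z => z^2-1) (C := 2) (by fun_prop) (fun z => ?_)
    rw [abs_le]; constructor <;> nlinarith [(pow_bd z).2.1, sq_nonneg z, sq_nonneg (z^2)]
  | (n+3) => 
    refine ker_of_poly (p := fun z => z^3-3*z) (C := 4) (by fun_prop) (fun z => ?_)
    have h1 : |z^3| = |z|^3 := abs_pow z 3
    have := abs_sub (z^3) (3*z)
    rw [abs_mul, h1, abs_of_pos (by norm_num : (0:ℝ) < 3)] at this
    linarith [(pow_bd z).1, (pow_bd z).2.2]

lemma ker_zhk (j : ℕ) (hj : j ≤ 2) : Ker (fun z => z * hk j z) := by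
  match j with
  | 0 =>
    have : (fun z => z * hk 0 z) = fun z => z * gs z := by funext z; simp only [hk]; ring
    rw [this]
    exact ker_of_poly (p := fun z => z) (C := 1) continuous_id (fun z => by linarith [(pow_bd z).1])
  | 1 =>
    have : (fun z => z * hk 1 z) = fun z => z ^ 2 * gs z := by funext z; simp only [hk]; ring
    rw [this]
    exact ker_of_poly (p := fun z => z^2) (C := 1) (by fun_prop) (fun z => by rw [abs_of_nonneg (sq_nonneg z)]; linarith [(pow_bd z).2.1])
  | 2 =>
    have : (fun z => z * hk 2 z) = fun z => (z ^ 3 - z) * gs z := by funext z; simp only [hk]; ring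
    rw [this]
    refine ker_of_poly (p := fun z => z^3-z) (C := 2) (by fun_prop) (fun z => ?_)
    have h1 : |z^3| = |z|^3 := abs_pow z 3
    have := abs_sub (z^3) (z)
    rw [h1] at this
    linarith [(pow_bd z).1, (pow_bd z).2.2]

lemma gs_deriv (z : ℝ) : HasDerivAt gs (- z * gs z) z := by
  have h : HasDerivAt (fun z : ℝ => -(1/2) * z^2) (-z) z := by
    refine ((hasDerivAt_pow 2 z).const_mul (-(1/2:ℝ))).congr_deriv ?_
    simp
  refine (h.exp.const_mul _).congr_deriv ?_
  unfold gs; ring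

lemma hk_deriv (j : ℕ) (hj : j ≤ 2) (z : ℝ) : HasDerivAt (hk j) (- hk (j+1) z) z := by
  unfold hk
  match j with
  | 0 => refine ((hasDerivAt_const z (1:ℝ)).mul (gs_deriv z)).congr_deriv ?_; ring
  | 1 => refine ((hasDerivAt_id z).mul (gs_deriv z)).congr_deriv ?_; simp; ring
  | 2 => refine (((hasDerivAt_pow 2 z).sub_const 1).mul (gs_deriv z)).congr_deriv ?_; simp; ring

lemma integral_hk0 : ∫ z, hk 0 z = 1 := by
  unfold hk gs
  simp only [one_mul]
  rw [integral_const_mul, integral_gaussian]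
  have : Real.pi / (1/2) = 2 * Real.pi := by ring
  rw [this]
  have : √(2 * Real.pi) ≠ 0 := by positivity
  field_simp

lemma integral_hk2 : ∫ z, hk 2 z = 0 := by
  have := integral_eq_zero_of_hasDerivAt_of_integrable (f := hk 1) (f' := fun z => - hk 2 z) (hk_deriv 1 (by norm_num))
    (ker_hk 2).integrable.neg (ker_hk 1).integrable
  rw [integral_neg] at this
  linarith

end SCP


namespace SCP
open MeasureTheory

/-- Duhamel integral (rescaled) -/
noncomputable def Duh (F : ℝ → ℝ → ℝ → ℝ) (τ x : ℝ) : ℝ := ∫ ρ in (0:ℝ)..1, τ * F (τ * ρ) (τ * (1 - ρ)) x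

/-- integrands with integrable singularity at `r = 0` -/
structure Sing (F : ℝ → ℝ → ℝ → ℝ) (I : Set ℝ) (B θ : ℝ) : Prop where
  cont : ContinuousOn (fun q : ℝ × ℝ × ℝ => F q.1 q.2.1 q.2.2) {q | 0 < q.1 ∧ q.2.2 ∈ I}
  bound : ∀ r, 0 < r → ∀ s, ∀ x ∈ I, |F r s x| ≤ B * r ^ (-θ)
  B0 : 0 ≤ B
  θ0 : 0 ≤ θ
  θ1 : θ < 1

variable {F F' : ℝ → ℝ → ℝ → ℝ} {I : Set ℝ} {B B' θ θ' : ℝ}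

lemma Sing.dom (h : Sing F I B θ) {τ ρ x : ℝ} (hτ : 0 < τ) (hρ : 0 < ρ) (hx : x ∈ I) (s : ℝ) :
    |τ * F (τ * ρ) s x| ≤ B * τ ^ (1 - θ) * ρ ^ (-θ) := by
  rw [abs_mul, abs_of_pos hτ]
  calc τ * |F (τ * ρ) s x| ≤ τ * (B * (τ * ρ) ^ (-θ)) := by
        gcongr; exact h.bound _ (by positivity) _ _ hx
    _ = _ := by
        rw [Real.mul_rpow hτ.le hρ.le, sub_eq_add_neg, Real.rpow_add hτ, Real.rpow_one]; ring

lemma rpow_int (hθ : θ < 1) (a b : ℝ) : IntervalIntegrable (fun ρ : ℝ => ρ ^ (-θ)) volume a b :=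
  intervalIntegral.intervalIntegrable_rpow' (by linarith)

lemma Sing.contOn_ρ (h : Sing F I B θ) {τ x : ℝ} (hτ : 0 < τ) (hx : x ∈ I) :
    ContinuousOn (fun ρ => τ * F (τ * ρ) (τ * (1 - ρ)) x) (Ioi 0) := by
  refine continuousOn_const.mul ?_
  exact h.cont.comp (f := fun ρ : ℝ => (τ * ρ, τ * (1 - ρ), x)) (by fun_prop)
    (fun ρ hρ => ⟨mul_pos hτ hρ, hx⟩)

lemma Sing.meas_ρ (h : Sing F I B θ) {τ x : ℝ} (hτ : 0 < τ) (hx : x ∈ I) :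
    AEStronglyMeasurable (fun ρ => τ * F (τ * ρ) (τ * (1 - ρ)) x) (volume.restrict (uIoc 0 1)) := by
  rw [uIoc_of_le zero_le_one]
  exact ((h.contOn_ρ hτ hx).mono (fun ρ hρ => hρ.1)).aestronglyMeasurable measurableSet_Ioc

lemma Sing.int_ρ (h : Sing F I B θ) {τ x : ℝ} (hτ : 0 < τ) (hx : x ∈ I) :
    IntervalIntegrable (fun ρ => τ * F (τ * ρ) (τ * (1 - ρ)) x) volume 0 1 := by
  refine ((rpow_int h.θ1 0 1).const_mul (B * τ ^ (1 - θ))).mono_fun' (h.meas_ρ hτ hx) ?_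
  rw [uIoc_of_le zero_le_one]
  filter_upwards [ae_restrict_mem measurableSet_Ioc] with ρ hρ
  exact h.dom hτ hρ.1 hx _

lemma Duh_zero (F : ℝ → ℝ → ℝ → ℝ) (x : ℝ) : Duh F 0 x = 0 := by simp [Duh]

lemma Duh_bound (h : Sing F I B θ) {τ x : ℝ} (hτ : 0 ≤ τ) (hx : x ∈ I) :
    |Duh F τ x| ≤ B * τ ^ (1 - θ) / (1 - θ) := by
  have h1 := h.θ1
  rcases hτ.eq_or_lt with rfl | hτ
  · rw [Duh_zero, abs_zero, Real.zero_rpow (by linarith)]; simp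
  have := intervalIntegral.norm_integral_le_of_norm_le (μ := volume) zero_le_one
    (f := fun ρ => τ * F (τ * ρ) (τ * (1 - ρ)) x) (g := fun ρ => B * τ ^ (1 - θ) * ρ ^ (-θ))
    (ae_of_all _ fun ρ hρ => h.dom hτ hρ.1 hx _) ((rpow_int h1 0 1).const_mul _)
  rw [Real.norm_eq_abs] at this
  refine this.trans (le_of_eq ?_)
  have e : ∫ ρ in (0:ℝ)..1, ρ ^ (-θ) = 1 / (1 - θ) := by
    rw [integral_rpow (Or.inl (by linarith)), Real.one_rpow, Real.zero_rpow (by linarith), sub_zero]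
    congr 1; ring
  rw [intervalIntegral.integral_const_mul, e, mul_one_div]

lemma Duh_cont (h : Sing F I B θ) (hI : IsOpen I) :
    ContinuousOn (fun z : ℝ × ℝ => Duh F z.1 z.2) (Ici 0 ×ˢ I) := by
  rintro ⟨τ, x⟩ ⟨hτ, hx⟩
  simp only [mem_Ici] at hτ hx
  have h1 := h.θ1
  rcases hτ.eq_or_lt with rfl | hτ
  · have e : Duh F 0 x = 0 := Duh_zero F x
    unfold ContinuousWithinAt
    simp only [e]
    have hlim : Tendsto (fun z : ℝ × ℝ => B * z.1 ^ (1 - θ) / (1 - θ)) (nhdsWithin (0, x) (Ici 0 ×ˢ I)) (nhds 0) := by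
      have hc : ContinuousAt (fun z : ℝ × ℝ => B * z.1 ^ (1 - θ) / (1 - θ)) (0, x) := by
        have := (Real.continuousAt_rpow_const 0 (1 - θ) (Or.inr (by linarith)))
        exact ((ContinuousAt.comp (f := Prod.fst) (x := ((0:ℝ), x)) this continuousAt_fst).const_mul B).div_const _
      have hc' := hc.tendsto
      simp only [Real.zero_rpow (show 1 - θ ≠ 0 by linarith), mul_zero, zero_div] at hc'
      exact hc'.mono_left nhdsWithin_le_nhds
    refine squeeze_zero_norm' ?_ hlim
    filter_upwards [self_mem_nhdsWithin] with z hz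
    exact Duh_bound h hz.1 hz.2
  · refine ContinuousAt.continuousWithinAt ?_
    unfold Duh
    have hnb : ∀ᶠ z : ℝ × ℝ in nhds (τ, x), (0 < z.1 ∧ z.1 < τ + 1) ∧ z.2 ∈ I := by
      have a1 : ∀ᶠ t in nhds τ, 0 < t ∧ t < τ + 1 := (lt_mem_nhds hτ).and (gt_mem_nhds (by linarith))
      have a2 : ∀ᶠ y in nhds x, y ∈ I := hI.mem_nhds hx
      rw [nhds_prod_eq]; exact a1.prod_mk a2
    refine intervalIntegral.continuousAt_of_dominated_interval
      (bound := fun ρ => B * (τ + 1) ^ (1 - θ) * ρ ^ (-θ)) ?_ ?_ ((rpow_int h1 0 1).const_mul _) ?_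
    · filter_upwards [hnb] with z hz
      exact h.meas_ρ hz.1.1 hz.2
    · filter_upwards [hnb] with z hz
      refine ae_of_all _ fun ρ hρ => ?_
      rw [uIoc_of_le zero_le_one] at hρ
      refine (h.dom hz.1.1 hρ.1 hz.2 _).trans ?_
      have := h.B0
      have h3 : z.1 ^ (1 - θ) ≤ (τ+1) ^ (1 - θ) := Real.rpow_le_rpow hz.1.1.le hz.1.2.le (by linarith)
      have h4 := Real.rpow_nonneg hρ.1.le (-θ)
      gcongr
    · refine ae_of_all _ fun ρ hρ => ?_
      rw [uIoc_of_le zero_le_one] at hρ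
      refine continuousAt_fst.mul ?_
      have hop : IsOpen {q : ℝ × ℝ × ℝ | 0 < q.1 ∧ q.2.2 ∈ I} :=
        (isOpen_lt continuous_const continuous_fst).inter (hI.preimage (by fun_prop))
      have hca := h.cont.continuousAt (x := (τ * ρ, τ * (1 - ρ), x)) (hop.mem_nhds ⟨mul_pos hτ hρ.1, hx⟩)
      exact ContinuousAt.comp (f := fun z : ℝ × ℝ => (z.1 * ρ, z.1 * (1 - ρ), z.2)) (x := (τ, x)) hca (by fun_prop)

lemma Duh_dx (h : Sing F I B θ) (h' : Sing F' I B' θ') (hI : IsOpen I)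
    (hd : ∀ r, 0 < r → ∀ s, ∀ x ∈ I, HasDerivAt (fun y => F r s y) (F' r s x) x)
    {τ x : ℝ} (hτ : 0 ≤ τ) (hx : x ∈ I) : HasDerivAt (fun y => Duh F τ y) (Duh F' τ x) x := by
  rcases hτ.eq_or_lt with rfl | hτ
  · simp only [Duh_zero]; exact hasDerivAt_const _ _
  refine (intervalIntegral.hasDerivAt_integral_of_dominated_loc_of_deriv_le (μ := volume)
    (F := fun y ρ => τ * F (τ * ρ) (τ * (1 - ρ)) y) (F' := fun y ρ => τ * F' (τ * ρ) (τ * (1 - ρ)) y)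
    (bound := fun ρ => B' * τ ^ (1 - θ') * ρ ^ (-θ'))
    (hI.mem_nhds hx) ?_ (h.int_ρ hτ hx) (h'.meas_ρ hτ hx) ?_ ((rpow_int h'.θ1 0 1).const_mul _) ?_).2
  · filter_upwards [hI.mem_nhds hx] with y hy using h.meas_ρ hτ hy
  · refine ae_of_all _ fun ρ hρ y hy => ?_
    rw [uIoc_of_le zero_le_one] at hρ
    exact h'.dom hτ hρ.1 hy _
  · refine ae_of_all _ fun ρ hρ y hy => ?_
    rw [uIoc_of_le zero_le_one] at hρ
    exact (hd _ (mul_pos hτ hρ.1) _ y hy).const_mul τ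

lemma Duh_eq (F : ℝ → ℝ → ℝ → ℝ) (τ x : ℝ) : Duh F τ x = ∫ s in (0:ℝ)..τ, F (τ - s) s x := by
  unfold Duh
  have e1 := intervalIntegral.mul_integral_comp_mul_left (a := 0) (b := 1) (f := fun r => F r (τ - r) x) τ
  have e2 := intervalIntegral.integral_comp_sub_left (a := 0) (b := τ) (fun r => F r (τ - r) x) τ
  simp only [sub_sub_cancel, sub_self, sub_zero] at e2
  rw [e2]
  simp only [mul_zero, mul_one] at e1
  rw [← e1, ← intervalIntegral.integral_const_mul]
  congr 1; ext ρ; congr 2; ring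

lemma fubini_triangle (h : Sing F I B θ) {τ x : ℝ} (hτ : 0 ≤ τ) (hx : x ∈ I) :
    ∫ s in (0:ℝ)..τ, ∫ r in (0:ℝ)..(τ - s), F r s x = ∫ σ in (0:ℝ)..τ, Duh F σ x ∧
    IntervalIntegrable (fun s => ∫ r in (0:ℝ)..(τ - s), F r s x) volume 0 τ := by
  have h1 := h.θ1
  set μ : Measure ℝ := volume.restrict (Ioc 0 τ) with hμ
  set D : Set (ℝ × ℝ) := {q | q.2 < q.1} with hD
  have hDm : MeasurableSet D := (isOpen_lt continuous_snd continuous_fst).measurableSet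
  set H : ℝ → ℝ → ℝ := fun σ s => D.indicator (fun q : ℝ × ℝ => F (q.1 - q.2) q.2 x) (σ, s) with hH
  have hHint : Integrable (Function.uncurry H) (μ.prod μ) := by
    have hmeas : AEStronglyMeasurable (Function.uncurry H) (μ.prod μ) := by
      have : Function.uncurry H = D.indicator (fun q : ℝ × ℝ => F (q.1 - q.2) q.2 x) := by
        ext ⟨a, b⟩; rfl
      rw [this, aestronglyMeasurable_indicator_iff hDm]
      refine ContinuousOn.aestronglyMeasurable ?_ hDm
      exact h.cont.comp (f := fun q : ℝ × ℝ => (q.1 - q.2, q.2, x)) (by fun_prop)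
        (fun q hq => ⟨sub_pos.2 hq, hx⟩)
    have i1 : Integrable ((Ioc (0:ℝ) τ).indicator (fun _ => (1:ℝ))) :=
      (integrable_indicator_iff measurableSet_Ioc).2 (by simp)
    have i2 : Integrable ((Ioc (0:ℝ) τ).indicator (fun u : ℝ => B * u ^ (-θ))) := by
      rw [integrable_indicator_iff measurableSet_Ioc]
      exact (intervalIntegrable_iff_integrableOn_Ioc_of_le hτ).1 ((rpow_int h1 0 τ).const_mul B)
    have i3 := Integrable.convolution_integrand (ContinuousLinearMap.mul ℝ ℝ) i1 i2
    have i4 : Integrable (fun p : ℝ × ℝ => (Ioc (0:ℝ) τ).indicator (fun _ => (1:ℝ)) p.2 *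
      (Ioc (0:ℝ) τ).indicator (fun u : ℝ => B * u ^ (-θ)) (p.1 - p.2)) (μ.prod μ) := by
      rw [hμ, Measure.prod_restrict]
      exact i3.integrableOn
    refine i4.mono' hmeas ?_
    rw [hμ, Measure.prod_restrict]
    filter_upwards [ae_restrict_mem (measurableSet_Ioc.prod measurableSet_Ioc)] with q hq
    by_cases hq' : q ∈ D
    · have hlt : q.2 < q.1 := hq'
      rw [indicator_of_mem hq.2, indicator_of_mem (show q.1 - q.2 ∈ Ioc 0 τ from ⟨sub_pos.2 hlt, by linarith [hq.1.2, hq.2.1]⟩)]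
      have : Function.uncurry H q = F (q.1 - q.2) q.2 x := by
        show D.indicator (fun q : ℝ × ℝ => F (q.1 - q.2) q.2 x) (q.1, q.2) = _
        rw [indicator_of_mem hq']
      rw [this, one_mul]
      exact h.bound _ (sub_pos.2 hlt) _ _ hx
    · have : Function.uncurry H q = 0 := by
        show D.indicator (fun q : ℝ × ℝ => F (q.1 - q.2) q.2 x) (q.1, q.2) = _
        rw [indicator_of_notMem hq']
      rw [this, norm_zero]
      refine mul_nonneg (indicator_nonneg (fun _ _ => zero_le_one) _) (indicator_nonneg (fun u hu => ?_) _)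
      exact mul_nonneg h.B0 (Real.rpow_nonneg hu.1.le _)
  have hsw := integral_integral_swap hHint
  have e1 : ∀ s ∈ Ioc 0 τ, ∫ σ, H σ s ∂μ = ∫ r in (0:ℝ)..(τ - s), F r s x := by
    intro s hs
    have : (fun σ => H σ s) = (Ioi s).indicator (fun σ => F (σ - s) s x) := by
      ext σ
      by_cases hσ : s < σ
      · rw [indicator_of_mem (show σ ∈ Ioi s from hσ)]
        exact indicator_of_mem (show (σ, s) ∈ D from hσ) _
      · rw [indicator_of_notMem (show σ ∉ Ioi s from hσ)]
        exact indicator_of_notMem (show (σ, s) ∉ D from hσ) _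
    rw [this, integral_indicator measurableSet_Ioi, hμ, Measure.restrict_restrict measurableSet_Ioi]
    have hset : Ioi s ∩ Ioc 0 τ = Ioc s τ := by
      ext y; simp only [mem_inter_iff, mem_Ioi, mem_Ioc]
      constructor
      · rintro ⟨a, b, c⟩; exact ⟨a, c⟩
      · rintro ⟨a, c⟩; exact ⟨a, hs.1.trans a, c⟩
    rw [hset, ← intervalIntegral.integral_of_le hs.2]
    have := intervalIntegral.integral_comp_sub_right (a := s) (b := τ) (fun r => F r s x) s
    rw [this, sub_self]
  have e2 : ∀ σ ∈ Ioc 0 τ, ∫ s, H σ s ∂μ = Duh F σ x := by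
    intro σ hσ
    have : (fun s => H σ s) = (Iio σ).indicator (fun s => F (σ - s) s x) := by
      ext s
      by_cases hs : s < σ
      · rw [indicator_of_mem (show s ∈ Iio σ from hs)]
        exact indicator_of_mem (show (σ, s) ∈ D from hs) _
      · rw [indicator_of_notMem (show s ∉ Iio σ from hs)]
        exact indicator_of_notMem (show (σ, s) ∉ D from hs) _
    rw [this, integral_indicator measurableSet_Iio, hμ, Measure.restrict_restrict measurableSet_Iio]
    have hset : Iio σ ∩ Ioc 0 τ = Ioo 0 σ := by
      ext y; simp only [mem_inter_iff, mem_Iio, mem_Ioc, mem_Ioo]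
      constructor
      · rintro ⟨a, b, c⟩; exact ⟨b, a⟩
      · rintro ⟨a, c⟩; exact ⟨c, a, c.le.trans hσ.2⟩
    rw [hset, ← integral_Ioc_eq_integral_Ioo, ← intervalIntegral.integral_of_le hσ.1.le, Duh_eq]
  constructor
  · rw [intervalIntegral.integral_of_le hτ, intervalIntegral.integral_of_le hτ]
    rw [← setIntegral_congr_fun measurableSet_Ioc e1, ← setIntegral_congr_fun measurableSet_Ioc e2]
    exact hsw.symm
  · rw [intervalIntegrable_iff_integrableOn_Ioc_of_le hτ]
    refine Integrable.congr hHint.integral_prod_right ?_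
    filter_upwards [ae_restrict_mem measurableSet_Ioc] with s hs using e1 s hs

lemma Duh_dt_int (h' : Sing F' I B' θ') {ℓ : ℝ → ℝ} (hℓ : Continuous ℓ) {x : ℝ} (hx : x ∈ I)
    (hd : ∀ r, 0 < r → ∀ s, HasDerivAt (fun r => F r s x) (F' r s x) r)
    (h0 : ∀ s, Tendsto (fun r => F r s x) (nhdsWithin 0 (Ioi 0)) (nhds (ℓ s)))
    {τ : ℝ} (hτ : 0 ≤ τ) : Duh F τ x = ∫ σ in (0:ℝ)..τ, (ℓ σ + Duh F' σ x) := by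
  have key : ∀ s, ∀ r, 0 < r → F r s x = ℓ s + ∫ u in (0:ℝ)..r, F' u s x := by
    intro s r hr
    have hIntg : IntervalIntegrable (fun u => F' u s x) volume 0 r := by
      refine ((rpow_int h'.θ1 0 r).const_mul B').mono_fun' ?_ ?_
      · rw [uIoc_of_le hr.le]
        refine ContinuousOn.aestronglyMeasurable ?_ measurableSet_Ioc
        exact h'.cont.comp (f := fun u : ℝ => (u, s, x)) (by fun_prop) (fun u hu => ⟨hu.1, hx⟩)
      · rw [uIoc_of_le hr.le]
        filter_upwards [ae_restrict_mem measurableSet_Ioc] with u hu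
        exact h'.bound _ hu.1 _ _ hx
    have := intervalIntegral.integral_eq_sub_of_hasDerivAt_of_tendsto hr (f := fun r => F r s x)
      (f' := fun r => F' r s x) (fun u hu => hd u hu.1 s) hIntg (h0 s)
      ((hd r hr s).continuousAt.tendsto.mono_left nhdsWithin_le_nhds)
    rw [this]; ring
  obtain ⟨f1, f2⟩ := fubini_triangle h' hτ hx
  rw [Duh_eq]
  have hcd : IntervalIntegrable (fun σ => Duh F' σ x) volume 0 τ := by
    have h2 : Sing (fun r s _ => F' r s x) univ B' θ' :=
      ⟨h'.cont.comp (f := fun q : ℝ × ℝ × ℝ => (q.1, q.2.1, x)) (by fun_prop) (fun q hq => ⟨hq.1, hx⟩),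
        fun r hr s y _ => h'.bound r hr s x hx, h'.B0, h'.θ0, h'.θ1⟩
    have hc : ContinuousOn (fun σ => Duh F' σ x) (uIcc 0 τ) := by
      rw [uIcc_of_le hτ]
      exact (Duh_cont h2 isOpen_univ).comp (f := fun σ : ℝ => (σ, x)) (by fun_prop) (fun σ hσ => ⟨hσ.1, mem_univ _⟩)
    exact hc.intervalIntegrable
  rw [intervalIntegral.integral_add (hℓ.intervalIntegrable _ _) hcd, ← f1,
    ← intervalIntegral.integral_add (hℓ.intervalIntegrable _ _) f2]
  rcases hτ.eq_or_lt with rfl | hτ'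
  · simp
  rw [intervalIntegral.integral_of_le hτ, intervalIntegral.integral_of_le hτ, integral_Ioc_eq_integral_Ioo, integral_Ioc_eq_integral_Ioo]
  refine setIntegral_congr_fun measurableSet_Ioo fun s hs => ?_
  exact key s (τ - s) (sub_pos.2 hs.2)

lemma Duh_dt (h' : Sing F' I B' θ') (hI : IsOpen I) {ℓ : ℝ → ℝ} (hℓ : Continuous ℓ) {x : ℝ} (hx : x ∈ I)
    (hd : ∀ r, 0 < r → ∀ s, HasDerivAt (fun r => F r s x) (F' r s x) r)
    (h0 : ∀ s, Tendsto (fun r => F r s x) (nhdsWithin 0 (Ioi 0)) (nhds (ℓ s)))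
    {τ : ℝ} (hτ : 0 < τ) : HasDerivAt (fun τ => Duh F τ x) (ℓ τ + Duh F' τ x) τ := by
  have hc : ContinuousOn (fun σ => ℓ σ + Duh F' σ x) (Ici 0) :=
    hℓ.continuousOn.add ((Duh_cont h' hI).comp (f := fun σ : ℝ => (σ, x)) (by fun_prop) (fun σ hσ => ⟨hσ, hx⟩))
  have := intervalIntegral.integral_hasDerivAt_right (f := fun σ => ℓ σ + Duh F' σ x) (a := 0) (b := τ)
    ((hc.mono (by rw [uIcc_of_le hτ.le]; exact fun y hy => hy.1)).intervalIntegrable)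
    ((hc.mono Ioi_subset_Ici_self).stronglyMeasurableAtFilter isOpen_Ioi τ hτ)
    (hc.continuousAt (Ici_mem_nhds hτ))
  refine this.congr_of_eventuallyEq ?_
  filter_upwards [lt_mem_nhds hτ] with t ht
  exact Duh_dt_int h' hℓ hx hd h0 ht.le

end SCP


namespace SCP
open MeasureTheory

/-- heat potentials densities -/
noncomputable def FK (j : ℕ) (φ : ℝ → ℝ → ℝ) (r s x : ℝ) : ℝ := ((√r)⁻¹) ^ j * WL (hk j) (φ s) (√r) x

/-- bounded jointly continuous functions -/
structure BC (φ : ℝ → ℝ → ℝ) (M : ℝ) : Prop where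
  cont : Continuous (fun z : ℝ × ℝ => φ z.1 z.2)
  bd : ∀ s x, |φ s x| ≤ M

variable {φ : ℝ → ℝ → ℝ} {M : ℝ}

lemma BC.cx (h : BC φ M) (s : ℝ) : Continuous (φ s) :=
  h.cont.comp (f := fun x : ℝ => (s, x)) (by fun_prop)

lemma BC.M0 (h : BC φ M) : 0 ≤ M := (abs_nonneg _).trans (h.bd 0 0)

lemma FK_cont (h : BC φ M) (j : ℕ) (I : Set ℝ) :
    ContinuousOn (fun q : ℝ × ℝ × ℝ => FK j φ q.1 q.2.1 q.2.2) {q | 0 < q.1 ∧ q.2.2 ∈ I} := by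
  unfold FK
  have h1 : Continuous (fun q : ℝ × ℝ × ℝ => WL (hk j) (φ q.2.1) (√q.1) q.2.2) :=
    (WL_continuous (ker_hk j) h.cont h.bd).comp (f := fun q : ℝ × ℝ × ℝ => (√q.1, q.2.1, q.2.2)) (by fun_prop)
  refine ContinuousOn.mul (ContinuousOn.pow (ContinuousOn.inv₀ (by fun_prop) ?_) j) h1.continuousOn
  intro q hq
  exact (Real.sqrt_pos.2 hq.1).ne'

lemma FK_dx (h : BC φ M) {j : ℕ} (hj : j ≤ 2) {r : ℝ} (hr : 0 < r) (s x : ℝ) :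
    HasDerivAt (fun y => FK j φ r s y) (FK (j+1) φ r s x) x := by
  have hl := Real.sqrt_pos.2 hr
  have hkn : Ker (fun z => - hk (j+1) z) := by
    obtain ⟨a, C, hC, b⟩ := ker_hk (j+1)
    exact ⟨a.neg, C, hC, fun z => by rw [abs_neg]; exact b z⟩
  have := (WL_deriv_x (ker_hk j) hkn (hk_deriv j hj) (h.cx s) (h.bd s) hl x).const_mul (((√r)⁻¹) ^ j)
  refine this.congr_deriv ?_
  unfold FK WL
  simp only [mul_neg, integral_neg]
  ring

lemma hasDerivAt_sqrt' {r : ℝ} (hr : 0 < r) : HasDerivAt (fun r => √r) (2⁻¹ * (√r)⁻¹) r := by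
  refine (Real.hasDerivAt_sqrt hr.ne').congr_deriv ?_
  rw [one_div, mul_inv]

lemma ker_neg_zhk (j : ℕ) (hj : j ≤ 1) : Ker (fun z => z * - hk (j+1) z) := by
  obtain ⟨a, C, hC, b⟩ := ker_zhk (j+1) (by omega)
  refine ⟨by simp only [mul_neg]; exact a.neg, C, hC, fun z => ?_⟩
  have := b z
  simp only [mul_neg, abs_neg]; exact this

lemma FK_dr0 (h : BC φ M) {r : ℝ} (hr : 0 < r) (s x : ℝ) :
    HasDerivAt (fun r => FK 0 φ r s x) (2⁻¹ * FK 2 φ r s x) r := by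
  have hl := Real.sqrt_pos.2 hr
  have h1 := WL_deriv_l (ker_hk 0) (ker_neg_zhk 0 (by norm_num)) (hk_deriv 0 (by norm_num)) (h.cx s) (h.bd s) hl x
  have h2 := HasDerivAt.comp (h := fun r => √r) r h1 (hasDerivAt_sqrt' hr)
  have e : (fun z => hk 0 z + z * - hk (0+1) z) = fun z => - hk 2 z := by
    funext z; simp only [hk]; ring
  rw [e] at h2
  unfold FK
  simp only [pow_zero, one_mul]
  refine h2.congr_deriv ?_
  unfold WL
  simp only [mul_neg, integral_neg]
  ring

lemma FK_dr1 (h : BC φ M) {r : ℝ} (hr : 0 < r) (s x : ℝ) :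
    HasDerivAt (fun r => FK 1 φ r s x) (2⁻¹ * FK 3 φ r s x) r := by
  have hl := Real.sqrt_pos.2 hr
  have h1 := WL_deriv_l (ker_hk 1) (ker_neg_zhk 1 (by norm_num)) (hk_deriv 1 (by norm_num)) (h.cx s) (h.bd s) hl x
  have h2 := HasDerivAt.comp (h := fun r => √r) r h1 (hasDerivAt_sqrt' hr)
  have h3 := (hasDerivAt_sqrt' hr).inv hl.ne'
  have h4 := h3.mul h2
  unfold FK
  simp only [pow_one]
  refine h4.congr_deriv ?_
  have e : WL (fun z => hk 1 z + z * - hk (1+1) z) (φ s) (√r) x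
      = - WL (hk 3) (φ s) (√r) x - WL (hk 1) (φ s) (√r) x := by
    unfold WL
    rw [← integral_neg]
    refine Eq.trans ?_ (integral_sub (integrable_WL (ker_hk 3) (h.cx s) (h.bd s) _ _).neg
      (integrable_WL (ker_hk 1) (h.cx s) (h.bd s) _ _))
    congr 1; funext z; simp only [hk]; ring
  simp only [Function.comp, e, Pi.inv_apply]
  field_simp
  ring

lemma hk0_abs : ∫ z, |hk 0 z| = 1 := by
  rw [← integral_hk0]; congr 1; funext z
  exact abs_of_nonneg (by simp only [hk, gs]; positivity)

lemma FK0_bound (s : ℝ) {M : ℝ} (hM : ∀ x, |φ s x| ≤ M) (r x : ℝ) : |FK 0 φ r s x| ≤ M := by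
  have := WL_bound (ker_hk 0) hM (√r) x
  rw [hk0_abs] at this
  simpa [FK] using this

lemma sing0 (h : BC φ M) : Sing (FK 0 φ) univ M 0 :=
  ⟨FK_cont h 0 _, fun r hr s x _ => by simpa using FK0_bound s (h.bd s) r x, h.M0, le_rfl, one_pos⟩

lemma sqrt_inv_rpow {r : ℝ} (hr : 0 < r) : (√r)⁻¹ = r ^ (-(1/2) : ℝ) := by
  rw [Real.sqrt_eq_rpow, Real.rpow_neg hr.le]

noncomputable def c1 : ℝ := ∫ z, |hk 1 z|

lemma c1_nonneg : 0 ≤ c1 := integral_nonneg fun _ => abs_nonneg _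

lemma sing1 (h : BC φ M) : Sing (FK 1 φ) univ (M * c1) (1/2) := by
  refine ⟨FK_cont h 1 _, fun r hr s x _ => ?_, mul_nonneg h.M0 c1_nonneg, by norm_num, by norm_num⟩
  have := WL_bound (ker_hk 1) (h.bd s) (√r) x
  unfold FK
  rw [abs_mul, pow_one, abs_of_nonneg (by positivity), ← sqrt_inv_rpow hr, mul_comm]
  gcongr
  exact this

/-- locally Hölder in `x`, uniformly in `s` -/
def LH (φ : ℝ → ℝ → ℝ) (x0 : ℝ) : Prop :=
  ∃ δ K α : ℝ, 0 < δ ∧ 0 ≤ K ∧ 0 < α ∧ α ≤ 1 ∧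
    ∀ s, ∀ x ∈ Metric.ball x0 δ, ∀ y ∈ Metric.ball x0 δ, |φ s x - φ s y| ≤ K * |x - y| ^ α

lemma sing2 (h : BC φ M) {x0 : ℝ} (hφ : LH φ x0) :
    ∃ δ > 0, ∃ B θ, Sing (FK 2 φ) (Metric.ball x0 δ) B θ := by
  obtain ⟨δ, K, α, hδ, hK, hα, hα1, H⟩ := hφ
  have hM := h.M0
  set K' := K + 2 * M / (δ/2) ^ α with hK'
  have hK'0 : 0 ≤ K' := by positivity
  set c := ∫ z, |z| ^ α * |hk 2 z| with hc
  have hc0 : 0 ≤ c := integral_nonneg fun _ => by positivity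
  refine ⟨δ/2, by positivity, K' * c, 1 - α/2, FK_cont h 2 _, fun r hr s x hx => ?_, by positivity, by linarith, by linarith⟩
  have hl := Real.sqrt_pos.2 hr
  have hx' : |x - x0| < δ/2 := by simpa [Real.dist_eq] using hx
  have hv := WL_vanish (ker_hk 2) (h.cx s) (h.bd s) (l := √r) (x := x) (a := φ s x) (K := K') (β := α) hl.le hα.le
    (by rw [integral_hk2, mul_zero]) (fun y => by
      by_cases hy : |y| < δ/2
      · have h1 : x + y ∈ Metric.ball x0 δ := by
          rw [Metric.mem_ball, Real.dist_eq]
          calc |x + y - x0| = |(x - x0) + y| := by ring_nf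
            _ ≤ |x - x0| + |y| := abs_add_le _ _
            _ < δ := by linarith
        have h2 : x ∈ Metric.ball x0 δ := by
          rw [Metric.mem_ball, Real.dist_eq]; linarith
        have := H s _ h1 _ h2
        rw [add_sub_cancel_left] at this
        refine this.trans ?_
        gcongr
        have : 0 ≤ 2 * M / (δ/2) ^ α := by positivity
        linarith
      · push Not at hy
        have h1 : (1:ℝ) ≤ |y| ^ α / (δ/2) ^ α := by
          rw [one_le_div (by positivity)]
          exact Real.rpow_le_rpow (by positivity) hy hα.le
        calc |φ s (x + y) - φ s x| ≤ |φ s (x+y)| + |φ s x| := abs_sub _ _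
          _ ≤ 2 * M * 1 := by linarith [h.bd s (x+y), h.bd s x]
          _ ≤ 2 * M * (|y| ^ α / (δ/2) ^ α) := by gcongr
          _ = 2 * M / (δ/2) ^ α * |y| ^ α := by ring
          _ ≤ _ := by gcongr; linarith)
  unfold FK
  rw [abs_mul, abs_of_nonneg (by positivity)]
  calc ((√r)⁻¹) ^ 2 * |WL (hk 2) (φ s) (√r) x| ≤ ((√r)⁻¹) ^ 2 * (K' * √r ^ α * c) := by gcongr
    _ = K' * c * (((√r)⁻¹) ^ 2 * √r ^ α) := by ring
    _ = _ := by
      congr 1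
      rw [inv_pow, Real.sq_sqrt hr.le, Real.sqrt_eq_rpow, ← Real.rpow_mul hr.le, ← Real.rpow_neg_one r,
        ← Real.rpow_add hr]
      congr 1; ring

lemma vanish_bound (h : BC φ M) {x0 δ : ℝ} (hδ : 0 < δ) (hv : ∀ s, ∀ y ∈ Metric.ball x0 δ, φ s y = 0)
    (j : ℕ) {β : ℝ} (hβ : 0 ≤ β) : ∃ A, 0 ≤ A ∧ ∀ r, 0 < r → ∀ s, ∀ x ∈ Metric.ball x0 (δ/2),
      |FK j φ r s x| ≤ A * (((√r)⁻¹) ^ j * √r ^ β) := by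
  have hM := h.M0
  set c := ∫ z, |z| ^ β * |hk j z| with hc
  have hc0 : 0 ≤ c := integral_nonneg fun _ => by positivity
  refine ⟨M / (δ/2) ^ β * c, by positivity, fun r hr s x hx => ?_⟩
  have hl := Real.sqrt_pos.2 hr
  have hx' : |x - x0| < δ/2 := by simpa [Real.dist_eq] using hx
  have hvv := WL_vanish (ker_hk j) (h.cx s) (h.bd s) (l := √r) (x := x) (a := 0) (K := M / (δ/2) ^ β) (β := β) hl.le hβ
    (by rw [zero_mul]) (fun y => by
      rw [sub_zero]
      by_cases hy : |y| < δ/2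
      · have h1 : x + y ∈ Metric.ball x0 δ := by
          rw [Metric.mem_ball, Real.dist_eq]
          calc |x + y - x0| = |(x - x0) + y| := by ring_nf
            _ ≤ |x - x0| + |y| := abs_add_le _ _
            _ < δ := by linarith
        rw [hv s _ h1, abs_zero]; positivity
      · push Not at hy
        have h1 : (1:ℝ) ≤ |y| ^ β / (δ/2) ^ β := by
          rw [one_le_div (by positivity)]
          exact Real.rpow_le_rpow (by positivity) hy hβ
        calc |φ s (x + y)| ≤ M * 1 := by linarith [h.bd s (x+y)]
          _ ≤ M * (|y| ^ β / (δ/2) ^ β) := by gcongr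
          _ = _ := by ring)
  unfold FK
  rw [abs_mul, abs_of_nonneg (by positivity)]
  calc ((√r)⁻¹) ^ j * |WL (hk j) (φ s) (√r) x| ≤ ((√r)⁻¹) ^ j * (M / (δ/2) ^ β * √r ^ β * c) := by gcongr
    _ = _ := by ring

lemma singv (h : BC φ M) {x0 δ : ℝ} (hδ : 0 < δ) (hv : ∀ s, ∀ y ∈ Metric.ball x0 δ, φ s y = 0) (j : ℕ) :
    ∃ B, Sing (FK j φ) (Metric.ball x0 (δ/2)) B 0 := by
  obtain ⟨A, hA, H⟩ := vanish_bound h hδ hv j (β := j) (by positivity)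
  refine ⟨A, FK_cont h j _, fun r hr s x hx => ?_, hA, le_rfl, one_pos⟩
  have hl := Real.sqrt_pos.2 hr
  refine (H r hr s x hx).trans (le_of_eq ?_)
  rw [Real.rpow_natCast, ← mul_pow, inv_mul_cancel₀ hl.ne', one_pow, neg_zero, Real.rpow_zero]

lemma FK1_lim (h : BC φ M) {x0 δ : ℝ} (hδ : 0 < δ) (hv : ∀ s, ∀ y ∈ Metric.ball x0 δ, φ s y = 0)
    (s : ℝ) {x : ℝ} (hx : x ∈ Metric.ball x0 (δ/2)) :
    Tendsto (fun r => FK 1 φ r s x) (nhdsWithin 0 (Ioi 0)) (nhds 0) := by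
  obtain ⟨A, hA, H⟩ := vanish_bound h hδ hv 1 (β := 2) (by positivity)
  have hlim : Tendsto (fun r : ℝ => A * √r) (nhdsWithin 0 (Ioi 0)) (nhds 0) := by
    have : Continuous (fun r : ℝ => A * √r) := by fun_prop
    have := this.tendsto 0
    simp only [Real.sqrt_zero, mul_zero] at this
    exact this.mono_left nhdsWithin_le_nhds
  refine squeeze_zero_norm' ?_ hlim
  filter_upwards [self_mem_nhdsWithin] with r hr
  have hl := Real.sqrt_pos.2 hr
  refine (H r hr s x hx).trans (le_of_eq ?_)
  rw [pow_one, Real.rpow_two]; field_simp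

lemma FK0_lim (h : BC φ M) (s x : ℝ) :
    Tendsto (fun r => FK 0 φ r s x) (nhdsWithin 0 (Ioi 0)) (nhds (φ s x)) := by
  have h1 : Continuous (fun r : ℝ => WL (hk 0) (φ s) (√r) x) :=
    (WL_continuous (ker_hk 0) h.cont h.bd).comp (f := fun r : ℝ => (√r, s, x)) (by fun_prop)
  have h2 := h1.tendsto 0
  have e : WL (hk 0) (φ s) (√0) x = φ s x := by
    unfold WL
    simp only [Real.sqrt_zero, zero_mul, add_zero]
    rw [integral_const_mul, integral_hk0, mul_one]
  rw [e] at h2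
  unfold FK
  simp only [pow_zero, one_mul]
  exact h2.mono_left nhdsWithin_le_nhds

lemma Sing.half {F I B θ} (h : Sing F I B θ) : Sing (fun r s x => 2⁻¹ * F r s x) I B θ := by
  refine ⟨continuousOn_const.mul h.cont, fun r hr s x hx => ?_, h.B0, h.θ0, h.θ1⟩
  rw [abs_mul, abs_of_pos (by norm_num : (0:ℝ) < 2⁻¹)]
  have := h.bound r hr s x hx
  have := abs_nonneg (F r s x)
  linarith

lemma Duh_half (F : ℝ → ℝ → ℝ → ℝ) (τ x : ℝ) : Duh (fun r s x => 2⁻¹ * F r s x) τ x = 2⁻¹ * Duh F τ x := by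
  unfold Duh
  rw [← intervalIntegral.integral_const_mul]
  congr 1; funext ρ; ring

/-- `v` is `C^{1,2}` near `x0` on `J` in time, with `v_τ = ½ v_xx + f`. -/
def C12At (v f : ℝ → ℝ → ℝ) (J : Set ℝ) (x0 : ℝ) : Prop :=
  ∃ δ > 0, ∃ vx vxx : ℝ → ℝ → ℝ,
    ContinuousOn (fun z : ℝ × ℝ => vx z.1 z.2) (J ×ˢ Metric.ball x0 δ) ∧
    ContinuousOn (fun z : ℝ × ℝ => vxx z.1 z.2) (J ×ˢ Metric.ball x0 δ) ∧
    ∀ τ ∈ J, ∀ x ∈ Metric.ball x0 δ,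
      HasDerivAt (fun t => v t x) (2⁻¹ * vxx τ x + f τ x) τ ∧
      HasDerivAt (fun y => v τ y) (vx τ x) x ∧ HasDerivAt (fun y => vx τ y) (vxx τ x) x

lemma S_dx (h : BC φ M) {τ : ℝ} (hτ : 0 ≤ τ) (x : ℝ) :
    HasDerivAt (fun y => Duh (FK 0 φ) τ y) (Duh (FK 1 φ) τ x) x :=
  Duh_dx (sing0 h) (sing1 h) isOpen_univ (fun r hr s x _ => FK_dx h (by norm_num) hr s x) hτ (mem_univ x)

lemma R1 (h : BC φ M) {x0 : ℝ} (hφ : LH φ x0) : C12At (Duh (FK 0 φ)) φ (Ioi 0) x0 := by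
  obtain ⟨δ, hδ, B, θ, h2⟩ := sing2 h hφ
  have hsub : Ioi (0:ℝ) ×ˢ Metric.ball x0 δ ⊆ Ici 0 ×ˢ Metric.ball x0 δ := prod_mono Ioi_subset_Ici_self le_rfl
  refine ⟨δ, hδ, Duh (FK 1 φ), Duh (FK 2 φ),
    ((Duh_cont (sing1 h) isOpen_univ).mono (prod_mono Ioi_subset_Ici_self (subset_univ _))),
    (Duh_cont h2 Metric.isOpen_ball).mono hsub, fun τ hτ x hx => ⟨?_, S_dx h (le_of_lt hτ) x, ?_⟩⟩
  · rw [← Duh_half, add_comm]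
    exact Duh_dt h2.half Metric.isOpen_ball (ℓ := fun s => φ s x)
      (h.cont.comp (f := fun s : ℝ => (s, x)) (by fun_prop)) hx (fun r hr s => FK_dr0 h hr s x) (fun s => FK0_lim h s x) hτ
  · exact Duh_dx (I := Metric.ball x0 δ) ⟨FK_cont h 1 _, fun r hr s x _ => (sing1 h).bound r hr s x (mem_univ _), (sing1 h).B0, (sing1 h).θ0, (sing1 h).θ1⟩ h2
      Metric.isOpen_ball (fun r hr s x _ => FK_dx h (by norm_num) hr s x) (le_of_lt hτ) hx

lemma R2 (h : BC φ M) {x0 δ : ℝ} (hδ : 0 < δ) (hv : ∀ s, ∀ y ∈ Metric.ball x0 δ, φ s y = 0) :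
    C12At (Duh (FK 1 φ)) (fun _ _ => 0) (Ioi 0) x0 := by
  obtain ⟨B1, h1⟩ := singv h hδ hv 1
  obtain ⟨B2, h2⟩ := singv h hδ hv 2
  obtain ⟨B3, h3⟩ := singv h hδ hv 3
  have hsub : Ioi (0:ℝ) ×ˢ Metric.ball x0 (δ/2) ⊆ Ici 0 ×ˢ Metric.ball x0 (δ/2) := prod_mono Ioi_subset_Ici_self le_rfl
  refine ⟨δ/2, by positivity, Duh (FK 2 φ), Duh (FK 3 φ),
    (Duh_cont h2 Metric.isOpen_ball).mono hsub,
    (Duh_cont h3 Metric.isOpen_ball).mono hsub, fun τ hτ x hx => ⟨?_, ?_, ?_⟩⟩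
  · rw [← Duh_half, add_comm]
    exact Duh_dt h3.half Metric.isOpen_ball (ℓ := fun s => 0)
      continuous_const hx (fun r hr s => FK_dr1 h hr s x) (fun s => FK1_lim h hδ hv s hx) hτ
  · exact Duh_dx h1 h2 Metric.isOpen_ball (fun r hr s x _ => FK_dx h (by norm_num) hr s x) (le_of_lt hτ) hx
  · exact Duh_dx h2 h3 Metric.isOpen_ball (fun r hr s x _ => FK_dx h (by norm_num) hr s x) (le_of_lt hτ) hx

end SCP


namespace SCP
open MeasureTheory

/-- drift points inward up to a constant -/
def SB (K : ℝ) (b : ℝ → ℝ) : Prop := ∀ x, b x * x ≤ K * |x|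

noncomputable def lw (x : ℝ) : ℝ := √(1 + x^2)
lemma lw_pos (x : ℝ) : 0 < lw x := Real.sqrt_pos.2 (by positivity)
lemma lw_sq (x : ℝ) : lw x ^ 2 = 1 + x^2 := Real.sq_sqrt (by positivity)
lemma lw_ge_one (x : ℝ) : 1 ≤ lw x := by
  nlinarith [lw_sq x, lw_pos x, sq_nonneg x]
lemma lw_ge_abs (x : ℝ) : |x| ≤ lw x := by
  apply abs_le_of_sq_le_sq _ (lw_pos x).le
  rw [lw_sq]; linarith
lemma lw_le (x : ℝ) : lw x ≤ 1 + |x| := by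
  have := lw_sq x; have := sq_abs x
  nlinarith [lw_pos x, abs_nonneg x]
lemma lw_deriv (x : ℝ) : HasDerivAt lw (x / lw x) x := by
  have h : HasDerivAt (fun x : ℝ => 1 + x^2) (2 * x) x := by
    simpa using (hasDerivAt_pow 2 x).const_add 1
  refine (h.sqrt (by positivity)).congr_deriv ?_
  unfold lw; rw [mul_div_mul_left _ _ (by norm_num : (2:ℝ) ≠ 0)]
lemma lw_deriv2 (x : ℝ) : HasDerivAt (fun x => x / lw x) (1 / lw x ^ 3) x := by
  refine ((hasDerivAt_id x).div (lw_deriv x) (lw_pos x).ne').congr_deriv ?_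
  have h := lw_sq x; have := (lw_pos x).ne'
  simp only [id]
  field_simp
  rw [h]; ring
lemma lw_lyap {K : ℝ} (hK : 0 ≤ K) {b : ℝ → ℝ} (hb : SB K b) (x : ℝ) : 2⁻¹ * (1 / lw x ^ 3) + b x * (x / lw x) ≤ K + 1 := by
  have h1 : 1 / lw x ^ 3 ≤ 1 := by
    rw [div_le_one (by have := lw_pos x; positivity)]
    exact one_le_pow₀ (lw_ge_one x)
  have h2 : b x * (x / lw x) ≤ K := by
    rw [← mul_div_assoc, div_le_iff₀ (lw_pos x)]
    exact (hb x).trans (by gcongr; exact lw_ge_abs x)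
  linarith

/-- pointwise `C^{1,2}` data -/
def Dat (v vt vx vxx : ℝ → ℝ → ℝ) (τ x : ℝ) : Prop :=
  HasDerivAt (fun t => v t x) (vt τ x) τ ∧ HasDerivAt (fun y => v τ y) (vx τ x) x ∧
    HasDerivAt (fun y => vx τ y) (vxx τ x) x

lemma mp_box {T K N M : ℝ} {b : ℝ → ℝ} (hT : 0 < T) (hK : 0 ≤ K) (hb : SB K b) (hN : 0 < N) (hM : 0 < M)
    (D Dt Dx Dxx : ℝ → ℝ → ℝ)
    (hc : ContinuousOn (fun z : ℝ × ℝ => D z.1 z.2) (Icc 0 T ×ˢ Icc (-N) N))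
    (hd : ∀ t ∈ Ioo 0 T, ∀ x ∈ Ioo (-N) N, Dat D Dt Dx Dxx t x)
    (hle : ∀ t ∈ Ioo 0 T, ∀ x ∈ Ioo (-N) N, Dt t x ≤ 2⁻¹ * Dxx t x + b x * Dx t x)
    (h0 : ∀ x ∈ Icc (-N) N, D 0 x ≤ 0)
    (hA : ∀ t ∈ Icc 0 T, ∀ x ∈ Icc (-N) N, D t x ≤ M) :
    ∀ t ∈ Icc 0 T, ∀ x ∈ Icc (-N) N, D t x ≤ M / N * (lw x + (K + 2) * t) := by
  have hNN : -N ≤ N := by linarith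
  have main : ∀ t ∈ Ico 0 T, ∀ x ∈ Icc (-N) N, D t x ≤ M / N * (lw x + (K + 2) * t) := by
    intro T1 hT1 x hx
    have hs : Ioc 0 T1 ⊆ Ioo 0 T := fun y hy => ⟨hy.1, hy.2.trans_lt hT1.2⟩
    have hs' : Icc 0 T1 ⊆ Icc 0 T := fun y hy => ⟨hy.1, hy.2.trans hT1.2.le⟩
    have := max_principle_lyap (T := T1) (A := -N) (B := N) (fun _ => 2⁻¹) b (fun _ _ => by norm_num)
      lw (fun x => x / lw x) (fun x => 1 / lw x ^ 3) (K+1) N M hN hM (by linarith)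
      (fun x _ => (lw_deriv x).continuousAt.continuousWithinAt)
      (fun x _ => lw_deriv x) (fun x _ => lw_deriv2 x) (fun x _ => lw_lyap hK hb x)
      (fun x _ => (lw_pos x).le) ((le_abs_self N).trans (by rw [← abs_neg]; exact lw_ge_abs _)) ((le_abs_self N).trans (lw_ge_abs _))
      D Dt Dx Dxx (hc.mono (prod_mono hs' le_rfl))
      (fun t ht x hx => (hd t (hs ht) x hx).1.hasDerivWithinAt)
      (fun t ht x hx => (hd t (hs ht) x hx).2.1)
      (fun t ht x hx => (hd t (hs ht) x hx).2.2)
      (fun t ht x hx => hle t (hs ht) x hx)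
      h0 (fun t ht => hA t (hs' ht) _ ⟨le_rfl, hNN⟩) (fun t ht => hA t (hs' ht) _ ⟨hNN, le_rfl⟩)
      T1 ⟨hT1.1, le_rfl⟩ x hx
    convert this using 3; ring
  intro t ht x hx
  rcases ht.2.lt_or_eq with h | h
  · exact main t ⟨ht.1, h⟩ x hx
  · subst h
    have c1 : ContinuousWithinAt (fun s => D s x) (Ico 0 t) t :=
      (hc.comp (f := fun s : ℝ => (s, x)) (by fun_prop) (s := Icc 0 t) (fun s hs => ⟨hs, hx⟩) t ht).mono Ico_subset_Icc_self
    have c2 : ContinuousWithinAt (fun s => M / N * (lw x + (K + 2) * s)) (Ico 0 t) t := by fun_prop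
    exact ContinuousWithinAt.closure_le (by rw [closure_Ico hT.ne]; exact ht) c1 c2 (fun s hs => main s hs x hx)

/-- maximum principle on the whole line -/
lemma mp_line {T K M : ℝ} {b : ℝ → ℝ} (hT : 0 < T) (hK : 0 ≤ K) (hb : SB K b)
    (D Dt Dx Dxx : ℝ → ℝ → ℝ)
    (hc : ContinuousOn (fun z : ℝ × ℝ => D z.1 z.2) (Icc 0 T ×ˢ univ))
    (hd : ∀ t ∈ Ioo 0 T, ∀ x, Dat D Dt Dx Dxx t x)
    (hle : ∀ t ∈ Ioo 0 T, ∀ x, Dt t x ≤ 2⁻¹ * Dxx t x + b x * Dx t x)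
    (h0 : ∀ x, D 0 x ≤ 0)
    (hA : ∀ t ∈ Icc 0 T, ∀ x, D t x ≤ M) :
    ∀ t ∈ Icc 0 T, ∀ x, D t x ≤ 0 := by
  intro t ht x
  have hM : 0 < max M 1 := lt_max_of_lt_right one_pos
  have key : ∀ᶠ N : ℝ in atTop, D t x ≤ max M 1 / N * (lw x + (K + 2) * t) := by
    filter_upwards [eventually_gt_atTop 0, eventually_ge_atTop |x|] with N hN hNx
    exact mp_box hT hK hb hN hM D Dt Dx Dxx (hc.mono (prod_mono le_rfl (subset_univ _)))
      (fun t ht x _ => hd t ht x) (fun t ht x _ => hle t ht x) (fun x _ => h0 x)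
      (fun t ht x _ => (hA t ht x).trans (le_max_left _ _)) t ht x (abs_le.1 hNx)
  have lim : Tendsto (fun N : ℝ => max M 1 / N * (lw x + (K + 2) * t)) atTop (nhds 0) := by
    simpa using (tendsto_const_nhds.div_atTop tendsto_id : Tendsto (fun N : ℝ => max M 1 / N) atTop (nhds 0)).mul_const (lw x + (K + 2) * t)
  exact ge_of_tendsto lim key

lemma Dat.sub {v vt vx vxx u ut ux uxx : ℝ → ℝ → ℝ} {τ x : ℝ} (h : Dat v vt vx vxx τ x) (g : Dat u ut ux uxx τ x) :
    Dat (fun t y => v t y - u t y) (fun t y => vt t y - ut t y) (fun t y => vx t y - ux t y) (fun t y => vxx t y - uxx t y) τ x :=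
  ⟨h.1.sub g.1, h.2.1.sub g.2.1, h.2.2.sub g.2.2⟩

lemma Dat.neg {v vt vx vxx : ℝ → ℝ → ℝ} {τ x : ℝ} (h : Dat v vt vx vxx τ x) :
    Dat (fun t y => - v t y) (fun t y => - vt t y) (fun t y => - vx t y) (fun t y => - vxx t y) τ x :=
  ⟨h.1.neg, h.2.1.neg, h.2.2.neg⟩

/-- multiplication by a function of `x`; needs the data on a neighbourhood -/
lemma Dat.mulg {v vt vx vxx : ℝ → ℝ → ℝ} {τ x : ℝ} (h : Dat v vt vx vxx τ x) {g g' g'' : ℝ → ℝ}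
    (hg : ∀ x, HasDerivAt g (g' x) x) (hg' : ∀ x, HasDerivAt g' (g'' x) x) :
    Dat (fun t y => g y * v t y) (fun t y => g y * vt t y) (fun t y => g' y * v t y + g y * vx t y)
      (fun t y => g'' y * v t y + 2 * (g' y * vx t y) + g y * vxx t y) τ x :=
  ⟨h.1.const_mul _, (hg x).mul h.2.1, (((hg' x).mul h.2.1).add ((hg x).mul h.2.2)).congr_deriv (by ring)⟩

end SCP


namespace SCP
open MeasureTheory

variable {φ ψ : ℝ → ℝ → ℝ} {M M' x0 : ℝ}

lemma LH.pair (h : LH φ x0) (g : LH ψ x0) : ∃ δ K α : ℝ, 0 < δ ∧ 0 ≤ K ∧ 0 < α ∧ α ≤ 1 ∧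
    (∀ s, ∀ x ∈ Metric.ball x0 δ, ∀ y ∈ Metric.ball x0 δ, |φ s x - φ s y| ≤ K * |x - y| ^ α) ∧
    (∀ s, ∀ x ∈ Metric.ball x0 δ, ∀ y ∈ Metric.ball x0 δ, |ψ s x - ψ s y| ≤ K * |x - y| ^ α) ∧
    (∀ x ∈ Metric.ball x0 δ, ∀ y ∈ Metric.ball x0 δ, |x - y| ^ α ≤ 1) := by
  obtain ⟨δ1, K1, α1, hδ1, hK1, hα1, hα11, H1⟩ := h
  obtain ⟨δ2, K2, α2, hδ2, hK2, hα2, hα21, H2⟩ := g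
  have hd : ∀ x ∈ Metric.ball x0 (min (min δ1 δ2) (1/2)), ∀ y ∈ Metric.ball x0 (min (min δ1 δ2) (1/2)), |x - y| ≤ 1 := by
    intro x hx y hy
    have a := (Metric.mem_ball.1 hx).trans_le (min_le_right _ _)
    have b := (Metric.mem_ball.1 hy).trans_le (min_le_right _ _)
    rw [← Real.dist_eq]
    linarith [dist_triangle_right x y x0]
  have hα : 0 < min α1 α2 := lt_min hα1 hα2
  refine ⟨min (min δ1 δ2) (1/2), max K1 K2, min α1 α2, by positivity, le_max_of_le_left hK1, hα, (min_le_left _ _).trans hα11, ?_, ?_, ?_⟩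
  · intro s x hx y hy
    refine (H1 s x (Metric.ball_subset_ball ((min_le_left _ _).trans (min_le_left _ _)) hx) y
      (Metric.ball_subset_ball ((min_le_left _ _).trans (min_le_left _ _)) hy)).trans ?_
    gcongr ?_ * ?_
    · exact le_max_left _ _
    · rcases (abs_nonneg (x-y)).eq_or_lt with h0 | h0
      · rw [← h0, Real.zero_rpow hα1.ne', Real.zero_rpow hα.ne']
      · exact Real.rpow_le_rpow_of_exponent_ge h0 (hd x hx y hy) (min_le_left _ _)
  · intro s x hx y hy
    refine (H2 s x (Metric.ball_subset_ball ((min_le_left _ _).trans (min_le_right _ _)) hx) y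
      (Metric.ball_subset_ball ((min_le_left _ _).trans (min_le_right _ _)) hy)).trans ?_
    gcongr ?_ * ?_
    · exact le_max_right _ _
    · rcases (abs_nonneg (x-y)).eq_or_lt with h0 | h0
      · rw [← h0, Real.zero_rpow hα2.ne', Real.zero_rpow hα.ne']
      · exact Real.rpow_le_rpow_of_exponent_ge h0 (hd x hx y hy) (min_le_right _ _)
  · intro x hx y hy
    exact Real.rpow_le_one (abs_nonneg _) (hd x hx y hy) hα.le

lemma LH.add (h : LH φ x0) (g : LH ψ x0) : LH (fun s x => φ s x + ψ s x) x0 := by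
  obtain ⟨δ, K, α, hδ, hK, hα, hα1, H1, H2, -⟩ := h.pair g
  refine ⟨δ, K + K, α, hδ, by positivity, hα, hα1, fun s x hx y hy => ?_⟩
  calc |φ s x + ψ s x - (φ s y + ψ s y)| = |(φ s x - φ s y) + (ψ s x - ψ s y)| := by ring_nf
    _ ≤ _ := (abs_add_le _ _).trans (by linarith [H1 s x hx y hy, H2 s x hx y hy])

lemma LH.neg (h : LH φ x0) : LH (fun s x => - φ s x) x0 := by
  obtain ⟨δ, K, α, hδ, hK, hα, hα1, H⟩ := h
  refine ⟨δ, K, α, hδ, hK, hα, hα1, fun s x hx y hy => ?_⟩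
  rw [← abs_neg]; convert H s x hx y hy using 2; ring

lemma LH.sub (h : LH φ x0) (g : LH ψ x0) : LH (fun s x => φ s x - ψ s x) x0 := by
  simpa only [sub_eq_add_neg] using h.add g.neg

lemma LH.gmul {g : ℝ → ℝ} (hg : LH (fun _ => g) x0) (h : LH φ x0) (hM : ∀ s x, |φ s x| ≤ M) :
    LH (fun s x => g x * φ s x) x0 := by
  obtain ⟨δ, K, α, hδ, hK, hα, hα1, H1, H2, H3⟩ := hg.pair h
  have hM0 : 0 ≤ M := (abs_nonneg _).trans (hM 0 0)
  refine ⟨δ, (|g x0| + K) * K + K * M, α, hδ, by positivity, hα, hα1, fun s x hx y hy => ?_⟩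
  have hgx : |g x| ≤ |g x0| + K := by
    have h1 := H1 0 x hx x0 (Metric.mem_ball_self hδ)
    have h2 := H3 x hx x0 (Metric.mem_ball_self hδ)
    have h3 : K * |x - x0| ^ α ≤ K * 1 := by gcongr
    have := abs_sub_abs_le_abs_sub (g x) (g x0)
    linarith
  have e : g x * φ s x - g y * φ s y = g x * (φ s x - φ s y) + (g x - g y) * φ s y := by ring
  rw [e]
  have hr : 0 ≤ |x - y| ^ α := Real.rpow_nonneg (abs_nonneg _) _
  calc _ ≤ |g x * (φ s x - φ s y)| + |(g x - g y) * φ s y| := abs_add_le _ _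
    _ ≤ (|g x0| + K) * (K * |x - y| ^ α) + (K * |x - y| ^ α) * M := by
      rw [abs_mul, abs_mul]
      gcongr
      · exact H2 s x hx y hy
      · exact H1 0 x hx y hy
      · exact hM s y
    _ = _ := by ring

lemma LH.of_deriv {φx : ℝ → ℝ → ℝ} {δ B : ℝ} (hδ : 0 < δ) (hB : 0 ≤ B)
    (hd : ∀ s, ∀ x ∈ Metric.ball x0 δ, HasDerivAt (fun y => φ s y) (φx s x) x)
    (hb : ∀ s, ∀ x ∈ Metric.ball x0 δ, |φx s x| ≤ B) : LH φ x0 := by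
  refine ⟨δ, B, 1, hδ, hB, one_pos, le_rfl, fun s x hx y hy => ?_⟩
  rw [Real.rpow_one]
  exact (convex_ball x0 δ).norm_image_sub_le_of_norm_hasDerivWithin_le (f := φ s) (f' := φx s)
    (fun z hz => (hd s z hz).hasDerivWithinAt) (fun z hz => hb s z hz) hy hx

lemma LH.of_g {g g' : ℝ → ℝ} (hg : ∀ x, HasDerivAt g (g' x) x) (hc : Continuous g') : LH (fun _ => g) x0 := by
  obtain ⟨C, hC⟩ := (isCompact_closedBall x0 1).exists_bound_of_continuousOn hc.continuousOn
  refine LH.of_deriv (δ := 1) (B := max C 0) (φx := fun _ => g') one_pos (le_max_right _ _) (fun s x _ => hg x) (fun s x hx => ?_)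
  exact (hC x (Metric.ball_subset_closedBall hx)).trans (le_max_left _ _)

lemma LH.congr {δ : ℝ} (h : LH φ x0) (hδ : 0 < δ) (he : ∀ s, ∀ x ∈ Metric.ball x0 δ, φ s x = ψ s x) : LH ψ x0 := by
  obtain ⟨δ1, K, α, hδ1, hK, hα, hα1, H⟩ := h
  refine ⟨min δ δ1, K, α, lt_min hδ hδ1, hK, hα, hα1, fun s x hx y hy => ?_⟩
  rw [← he s x (Metric.ball_subset_ball (min_le_left _ _) hx), ← he s y (Metric.ball_subset_ball (min_le_left _ _) hy)]
  exact H s x (Metric.ball_subset_ball (min_le_right _ _) hx) y (Metric.ball_subset_ball (min_le_right _ _) hy)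

/-! linearity of potentials -/
lemma FK_sub (h : BC φ M) (g : BC ψ M') (j : ℕ) (r s x : ℝ) :
    FK j (fun s x => φ s x - ψ s x) r s x = FK j φ r s x - FK j ψ r s x := by
  unfold FK WL
  rw [← mul_sub]
  refine congrArg _ (Eq.trans ?_ (integral_sub (integrable_WL (ker_hk j) (h.cx s) (h.bd s) _ _)
    (integrable_WL (ker_hk j) (g.cx s) (g.bd s) _ _)))
  congr 1; funext z; ring

lemma Duh_sub_of {F G H : ℝ → ℝ → ℝ → ℝ} {B θ B' θ' : ℝ} {I : Set ℝ} (hF : Sing F I B θ) (hG : Sing G I B' θ')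
    (he : ∀ r s x, H r s x = F r s x - G r s x) {τ x : ℝ} (hτ : 0 ≤ τ) (hx : x ∈ I) :
    Duh H τ x = Duh F τ x - Duh G τ x := by
  rcases hτ.eq_or_lt with rfl | hτ
  · simp [Duh_zero]
  unfold Duh
  rw [← intervalIntegral.integral_sub (hF.int_ρ hτ hx) (hG.int_ρ hτ hx)]
  congr 1; funext ρ; rw [he]; ring

lemma S_sub (h : BC φ M) (g : BC ψ M') {τ : ℝ} (hτ : 0 ≤ τ) (x : ℝ) :
    Duh (FK 0 (fun s x => φ s x - ψ s x)) τ x = Duh (FK 0 φ) τ x - Duh (FK 0 ψ) τ x :=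
  Duh_sub_of (sing0 h) (sing0 g) (FK_sub h g 0) hτ (mem_univ x)

lemma w1_sub (h : BC φ M) (g : BC ψ M') {τ : ℝ} (hτ : 0 ≤ τ) (x : ℝ) :
    Duh (FK 1 (fun s x => φ s x - ψ s x)) τ x = Duh (FK 1 φ) τ x - Duh (FK 1 ψ) τ x :=
  Duh_sub_of (sing1 h) (sing1 g) (FK_sub h g 1) hτ (mem_univ x)

lemma BC.sub (h : BC φ M) (g : BC ψ M') : BC (fun s x => φ s x - ψ s x) (M + M') :=
  ⟨h.cont.sub g.cont, fun s x => (abs_sub _ _).trans (add_le_add (h.bd s x) (g.bd s x))⟩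
lemma BC.add (h : BC φ M) (g : BC ψ M') : BC (fun s x => φ s x + ψ s x) (M + M') :=
  ⟨h.cont.add g.cont, fun s x => (abs_add_le _ _).trans (add_le_add (h.bd s x) (g.bd s x))⟩
lemma BC.gmul {g : ℝ → ℝ} {A : ℝ} (hg : Continuous g) (hA : ∀ x, |g x| ≤ A) (h : BC φ M) :
    BC (fun s x => g x * φ s x) (A * M) :=
  ⟨(hg.comp continuous_snd).mul h.cont, fun s x => by
    rw [abs_mul]
    exact mul_le_mul (hA x) (h.bd s x) (abs_nonneg _) ((abs_nonneg _).trans (hA x))⟩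

lemma S_bound (h : BC φ M) {τ : ℝ} (hτ : 0 ≤ τ) (x : ℝ) : |Duh (FK 0 φ) τ x| ≤ M * τ := by
  simpa using Duh_bound (sing0 h) hτ (mem_univ x)

lemma w1_bound (h : BC φ M) {τ : ℝ} (hτ : 0 ≤ τ) (x : ℝ) : |Duh (FK 1 φ) τ x| ≤ M * (2 * c1 * √τ) := by
  refine (Duh_bound (sing1 h) hτ (mem_univ x)).trans (le_of_eq ?_)
  rw [Real.sqrt_eq_rpow]; norm_num; ring

lemma S_cont (h : BC φ M) : ContinuousOn (fun z : ℝ × ℝ => Duh (FK 0 φ) z.1 z.2) (Ici 0 ×ˢ univ) :=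
  Duh_cont (sing0 h) isOpen_univ
lemma w1_cont (h : BC φ M) : ContinuousOn (fun z : ℝ × ℝ => Duh (FK 1 φ) z.1 z.2) (Ici 0 ×ˢ univ) :=
  Duh_cont (sing1 h) isOpen_univ

/-- weighted bound -/
lemma S_wbound (h : BC φ M) {A lam : ℝ} (hlam : 0 < lam) {τ : ℝ} (hτ : 0 ≤ τ)
    (hA : ∀ s ∈ Icc 0 τ, ∀ x, |φ s x| ≤ A * Real.exp (lam * s)) (x : ℝ) :
    |Duh (FK 0 φ) τ x| ≤ A / lam * Real.exp (lam * τ) := by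
  have hA0 : 0 ≤ A := by
    have := (abs_nonneg _).trans (hA 0 ⟨le_rfl, hτ⟩ 0)
    simpa using this
  rw [Duh_eq]
  have hcont : Continuous (fun s => A * Real.exp (lam * s)) := by fun_prop
  have := intervalIntegral.norm_integral_le_of_norm_le (μ := volume) hτ
    (f := fun s => FK 0 φ (τ - s) s x) (g := fun s => A * Real.exp (lam * s))
    (ae_of_all _ fun s hs => FK0_bound s (hA s ⟨hs.1.le, hs.2⟩) _ x) (hcont.intervalIntegrable _ _)
  refine this.trans ?_
  have hIntg : ∫ s in (0:ℝ)..τ, A * Real.exp (lam * s) = A / lam * Real.exp (lam * τ) - A / lam := by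
    have := intervalIntegral.integral_eq_sub_of_hasDerivAt (a := 0) (b := τ)
      (f := fun s => A / lam * Real.exp (lam * s)) (f' := fun s => A * Real.exp (lam * s)) (fun s _ => by
        have h1 : HasDerivAt (fun s : ℝ => lam * s) lam s := by simpa using (hasDerivAt_id s).const_mul lam
        refine (h1.exp.const_mul (A / lam)).congr_deriv ?_
        field_simp) (hcont.intervalIntegrable _ _)
    rw [this]; simp
  rw [hIntg]
  have : 0 ≤ A / lam := by positivity
  linarith

/-- `S(φ_x) = w_1 φ` -/
lemma S_deriv_source {φx : ℝ → ℝ → ℝ} (h : BC φ M) (g : BC φx M')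
    (hd : ∀ s x, HasDerivAt (fun y => φ s y) (φx s x) x) (τ x : ℝ) (hτ : 0 ≤ τ) :
    Duh (FK 0 φx) τ x = Duh (FK 1 φ) τ x := by
  rcases hτ.eq_or_lt with rfl | hτ
  · simp [Duh_zero]
  have key : ∀ r, 0 < r → ∀ s, FK 0 φx r s x = FK 1 φ r s x := by
    intro r hr s
    refine HasDerivAt.unique (f := fun y => FK 0 φ r s y) ?_ (FK_dx h (by norm_num) hr s x)
    unfold FK WL
    simp only [pow_zero, one_mul]
    refine (hasDerivAt_integral_of_dominated_loc_of_deriv_le (F := fun y z => φ s (y + √r * z) * hk 0 z)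
      (F' := fun y z => φx s (y + √r * z) * hk 0 z) (bound := fun z => M' * |hk 0 z|) (Metric.ball_mem_nhds x one_pos) ?_ ?_ ?_ ?_ ?_ ?_).2
    · exact Eventually.of_forall fun y => (integrable_WL (ker_hk 0) (h.cx s) (h.bd s) _ _).aestronglyMeasurable
    · exact integrable_WL (ker_hk 0) (h.cx s) (h.bd s) _ _
    · exact (integrable_WL (ker_hk 0) (g.cx s) (g.bd s) _ _).aestronglyMeasurable
    · refine ae_of_all _ fun z y _ => ?_
      rw [norm_mul]
      exact mul_le_mul_of_nonneg_right (g.bd s _) (norm_nonneg _)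
    · exact (ker_hk 0).integrable_abs.const_mul _
    · refine ae_of_all _ fun z y _ => ?_
      exact ((hd s (y + √r * z)).comp_add_const y (√r * z)).mul_const _
  unfold Duh
  refine intervalIntegral.integral_congr_ae (ae_of_all _ fun ρ hρ => ?_)
  rw [uIoc_of_le zero_le_one] at hρ
  rw [key _ (mul_pos hτ hρ.1)]

end SCP


namespace SCP
open MeasureTheory

noncomputable def clampT (T s : ℝ) : ℝ := max 0 (min s T)
lemma clampT_cont (T : ℝ) : Continuous (clampT T) := by unfold clampT; fun_prop
lemma clampT_mem {T : ℝ} (hT : 0 ≤ T) (s : ℝ) : clampT T s ∈ Icc 0 T :=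
  ⟨le_max_left _ _, max_le hT (min_le_right _ _)⟩
lemma clampT_id {T s : ℝ} (hs : s ∈ Icc 0 T) : clampT T s = s := by
  unfold clampT; rw [min_eq_left hs.2, max_eq_right hs.1]

lemma Duh_clamp_cont {φ : ℝ → ℝ → ℝ} {M T : ℝ} (h : BC φ M) (hT : 0 ≤ T) :
    Continuous (fun z : ℝ × ℝ => Duh (FK 0 φ) (clampT T z.1) z.2) :=
  (S_cont h).comp_continuous (f := fun z : ℝ × ℝ => (clampT T z.1, z.2))
    (((clampT_cont T).comp continuous_fst).prodMk continuous_snd)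
    (fun z => ⟨(clampT_mem hT z.1).1, mem_univ _⟩)

lemma Duh_clamp_cont1 {φ : ℝ → ℝ → ℝ} {M T : ℝ} (h : BC φ M) (hT : 0 ≤ T) :
    Continuous (fun z : ℝ × ℝ => Duh (FK 1 φ) (clampT T z.1) z.2) :=
  (w1_cont h).comp_continuous (f := fun z : ℝ × ℝ => (clampT T z.1, z.2))
    (((clampT_cont T).comp continuous_fst).prodMk continuous_snd)
    (fun z => ⟨(clampT_mem hT z.1).1, mem_univ _⟩)

open scoped BoundedContinuousFunction in
lemma fixed_point {f : ℝ → ℝ → ℝ} {M A T : ℝ} {V : ℝ → ℝ} (hf : BC f M) (hV : Continuous V)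
    (hA : ∀ x, |V x| ≤ A) (hT : 0 ≤ T) :
    ∃ v Mv, BC v Mv ∧ ∀ s x, v s x = Duh (FK 0 (fun s x => f s x - V x * v s x)) (clampT T s) x := by
  have hA0 : 0 ≤ A := (abs_nonneg _).trans (hA 0)
  set lam : ℝ := 2 * (A + 1) with hlam
  have hlam0 : 0 < lam := by positivity
  have hwb : ∀ (u : (ℝ × ℝ) →ᵇ ℝ), BC (fun s x => Real.exp (lam * clampT T s) * u (s, x)) (Real.exp (lam * T) * ‖u‖) := by
    intro u
    constructor
    · have := clampT_cont T
      have := u.continuous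
      fun_prop
    · intro s x
      rw [abs_mul, Real.abs_exp]
      have := (clampT_mem hT s).2
      gcongr
      exact u.norm_coe_le_norm _
  have hsrc : ∀ (u : (ℝ × ℝ) →ᵇ ℝ), BC (fun s x => f s x - V x * (Real.exp (lam * clampT T s) * u (s, x)))
      (M + A * (Real.exp (lam * T) * ‖u‖)) := fun u => hf.sub (BC.gmul hV hA (hwb u))
  have hbd : ∀ (u : (ℝ × ℝ) →ᵇ ℝ), ∃ C : ℝ, ∀ z : ℝ × ℝ, ‖Real.exp (-(lam * clampT T z.1)) *
      Duh (FK 0 (fun s x => f s x - V x * (Real.exp (lam * clampT T s) * u (s, x)))) (clampT T z.1) z.2‖ ≤ C := by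
    intro u
    refine ⟨(M + A * (Real.exp (lam * T) * ‖u‖)) * T, fun z => ?_⟩
    have hc := clampT_mem hT z.1
    have h1 := S_bound (hsrc u) hc.1 z.2
    rw [norm_mul, Real.norm_eq_abs, Real.norm_eq_abs, Real.abs_exp]
    have h2 : Real.exp (-(lam * clampT T z.1)) ≤ 1 := Real.exp_le_one_iff.2 (by nlinarith [hc.1])
    have h3 := (hsrc u).M0
    calc _ ≤ 1 * ((M + A * (Real.exp (lam * T) * ‖u‖)) * clampT T z.1) := by gcongr
      _ ≤ _ := by rw [one_mul]; gcongr; exact hc.2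
  let Φ : ((ℝ × ℝ) →ᵇ ℝ) → ((ℝ × ℝ) →ᵇ ℝ) := fun u =>
    BoundedContinuousFunction.ofNormedAddCommGroup (fun z : ℝ × ℝ => Real.exp (-(lam * clampT T z.1)) *
      Duh (FK 0 (fun s x => f s x - V x * (Real.exp (lam * clampT T s) * u (s, x)))) (clampT T z.1) z.2)
      (((by have := clampT_cont T; fun_prop : Continuous (fun z : ℝ × ℝ => Real.exp (-(lam * clampT T z.1))))).mul
        (Duh_clamp_cont (hsrc u) hT)) (hbd u).choose (hbd u).choose_spec
  have hΦ : ∀ u z, Φ u z = Real.exp (-(lam * clampT T z.1)) *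
      Duh (FK 0 (fun s x => f s x - V x * (Real.exp (lam * clampT T s) * u (s, x)))) (clampT T z.1) z.2 := fun _ _ => rfl
  have hcontr : ContractingWith (1/2) Φ := by
    refine ⟨by rw [← NNReal.coe_lt_coe]; norm_num, LipschitzWith.of_dist_le_mul fun u w => ?_⟩
    rw [BoundedContinuousFunction.dist_le (by positivity)]
    intro z
    have hc := clampT_mem hT z.1
    rw [hΦ, hΦ, Real.dist_eq, ← mul_sub, abs_mul, Real.abs_exp, ← S_sub (hsrc u) (hsrc w) hc.1]
    have hb := S_wbound ((hsrc u).sub (hsrc w)) (A := A * dist u w) hlam0 hc.1 (fun s hs x => by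
      rw [clampT_id ⟨hs.1, hs.2.trans hc.2⟩]
      have e : f s x - V x * (Real.exp (lam * s) * u (s, x)) - (f s x - V x * (Real.exp (lam * s) * w (s, x)))
        = V x * Real.exp (lam * s) * (w (s, x) - u (s, x)) := by ring
      rw [e, abs_mul, abs_mul, Real.abs_exp, mul_right_comm]
      have : |w (s, x) - u (s, x)| ≤ dist u w := by
        rw [dist_comm, ← Real.dist_eq]; exact BoundedContinuousFunction.dist_coe_le_dist _
      have := hA x
      gcongr) z.2
    calc _ ≤ Real.exp (-(lam * clampT T z.1)) * (A * dist u w / lam * Real.exp (lam * clampT T z.1)) := by gcongr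
      _ = A / lam * dist u w * (Real.exp (-(lam * clampT T z.1)) * Real.exp (lam * clampT T z.1)) := by ring
      _ = A / lam * dist u w := by rw [← Real.exp_add]; simp
      _ ≤ _ := by
        gcongr
        rw [div_le_iff₀ hlam0, hlam]; push_cast; linarith
  haveI : Nonempty ((ℝ × ℝ) →ᵇ ℝ) := ⟨0⟩
  set u := ContractingWith.fixedPoint Φ hcontr with hu
  have hfix : Φ u = u := hcontr.fixedPoint_isFixedPt
  refine ⟨fun s x => Real.exp (lam * clampT T s) * u (s, x), _, hwb u, fun s x => ?_⟩
  have : u (s, x) = Φ u (s, x) := by rw [hfix]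
  simp only
  rw [this, hΦ, ← mul_assoc, ← Real.exp_add, add_neg_cancel, Real.exp_zero, one_mul]

end SCP


namespace SCP
open MeasureTheory

lemma R1' {φ : ℝ → ℝ → ℝ} {M : ℝ} (h : BC φ M) {x0 : ℝ} (hφ : LH φ x0) (T : ℝ) :
    ∃ δ > 0, ∃ B, 0 ≤ B ∧ (∀ τ ∈ Icc 0 T, ∀ x ∈ Metric.ball x0 δ, |Duh (FK 2 φ) τ x| ≤ B ∧
      HasDerivAt (fun y => Duh (FK 1 φ) τ y) (Duh (FK 2 φ) τ x) x) ∧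
    ∀ τ, 0 < τ → ∀ x ∈ Metric.ball x0 δ,
      Dat (Duh (FK 0 φ)) (fun τ x => 2⁻¹ * Duh (FK 2 φ) τ x + φ τ x) (Duh (FK 1 φ)) (Duh (FK 2 φ)) τ x := by
  obtain ⟨δ, hδ, B, θ, h2⟩ := sing2 h hφ
  have h1' : Sing (FK 1 φ) (Metric.ball x0 δ) (M * c1) (1/2) :=
    ⟨FK_cont h 1 _, fun r hr s x _ => (sing1 h).bound r hr s x (mem_univ _), (sing1 h).B0, (sing1 h).θ0, (sing1 h).θ1⟩
  have hθ := h2.θ1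
  have hB := h2.B0
  have hdd : ∀ τ, 0 ≤ τ → ∀ x ∈ Metric.ball x0 δ, HasDerivAt (fun y => Duh (FK 1 φ) τ y) (Duh (FK 2 φ) τ x) x :=
    fun τ hτ x hx => Duh_dx h1' h2 Metric.isOpen_ball (fun r hr s x _ => FK_dx h (by norm_num) hr s x) hτ hx
  refine ⟨δ, hδ, B * (max T 0) ^ (1 - θ) / (1 - θ), div_nonneg (by positivity) (by linarith), fun τ hτ x hx => ⟨?_, hdd τ hτ.1 x hx⟩, fun τ hτ x hx => ⟨?_, S_dx h hτ.le x, hdd τ hτ.le x hx⟩⟩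
  · refine (Duh_bound h2 hτ.1 hx).trans ?_
    have h3 : τ ^ (1 - θ) ≤ (max T 0) ^ (1 - θ) := Real.rpow_le_rpow hτ.1 (hτ.2.trans (le_max_left _ _)) (by linarith)
    have : 0 < 1 - θ := by linarith
    gcongr
  · beta_reduce
    rw [← Duh_half, add_comm]
    exact Duh_dt h2.half Metric.isOpen_ball (ℓ := fun s => φ s x)
      (h.cont.comp (f := fun s : ℝ => (s, x)) (by fun_prop)) hx (fun r hr s => FK_dr0 h hr s x) (fun s => FK0_lim h s x) hτ

lemma Dat.clamp {v vt vx vxx : ℝ → ℝ → ℝ} {T τ x : ℝ} (hτ : τ ∈ Ioo 0 T) (h : Dat v vt vx vxx τ x) :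
    Dat (fun s x => v (clampT T s) x) vt (fun s x => vx (clampT T s) x) (fun s x => vxx (clampT T s) x) τ x := by
  have hid : clampT T τ = τ := clampT_id (Ioo_subset_Icc_self hτ)
  refine ⟨h.1.congr_of_eventuallyEq ?_, ?_, ?_⟩
  · filter_upwards [Ioo_mem_nhds hτ.1 hτ.2] with t ht
    rw [clampT_id (Ioo_subset_Icc_self ht)]
  · simpa only [hid] using h.2.1
  · simpa only [hid] using h.2.2

/-- potential of the gauge transformed equation -/
noncomputable def Vp (β β' : ℝ → ℝ) (x : ℝ) : ℝ := 2⁻¹ * (β x ^ 2 + β' x)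

/-- regularity data of the transformed truncated problem -/
structure TS (f : ℝ → ℝ → ℝ) (V : ℝ → ℝ) (T : ℝ) (v vx vxx : ℝ → ℝ → ℝ) : Prop where
  bv : ∃ Mv, BC v Mv
  bx : ∃ Mx, BC vx Mx
  dx : ∀ s x, HasDerivAt (fun y => v s y) (vx s x) x
  lv : ∀ x0, LH v x0
  lx : ∀ x0, LH vx x0
  v0 : ∀ x, v 0 x = 0
  vc : ∀ s x, v s x = v (clampT T s) x
  dat : ∀ τ ∈ Ioo 0 T, ∀ x, Dat v (fun t x => 2⁻¹ * vxx t x + (f t x - V x * v t x)) vx vxx τ x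

lemma trunc {f : ℝ → ℝ → ℝ} {M A T : ℝ} {V V' : ℝ → ℝ} (hf : BC f M) (hfl : ∀ x0, LH f x0) (hV : ∀ x, HasDerivAt V (V' x) x)
    (hV' : Continuous V') (hA : ∀ x, |V x| ≤ A) (hT : 0 < T) : ∃ v vx vxx, TS f V T v vx vxx := by
  have hVc : Continuous V := continuous_iff_continuousAt.2 fun x => (hV x).continuousAt
  obtain ⟨v, Mv, hv, hfix⟩ := fixed_point hf hVc hA hT.le
  set φ : ℝ → ℝ → ℝ := fun s x => f s x - V x * v s x with hφ
  have hφB := hf.sub (BC.gmul hVc hA hv)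
  rw [← hφ] at hφB
  have hcc : ∀ s, clampT T (clampT T s) = clampT T s := fun s => clampT_id (clampT_mem hT.le s)
  have hdx : ∀ s x, HasDerivAt (fun y => v s y) (Duh (FK 1 φ) (clampT T s) x) x := by
    intro s x
    have : (fun y => v s y) = fun y => Duh (FK 0 φ) (clampT T s) y := funext fun y => hfix s y
    rw [this]
    exact S_dx hφB (clampT_mem hT.le s).1 x
  have hbx : BC (fun s x => Duh (FK 1 φ) (clampT T s) x) (max 0 ((M + A * Mv) * (2 * c1 * √T))) := by
    refine ⟨Duh_clamp_cont1 hφB hT.le, fun s x => le_max_of_le_right ?_⟩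
    refine (w1_bound hφB (clampT_mem hT.le s).1 x).trans ?_
    have := c1_nonneg; have := hφB.M0; have := (clampT_mem hT.le s).2
    gcongr
  have hlv : ∀ x0, LH v x0 := fun x0 => LH.of_deriv one_pos (le_max_left _ _) (fun s x _ => hdx s x) (fun s x _ => hbx.bd s x)
  have hlφ : ∀ x0, LH φ x0 := fun x0 => (hfl x0).sub ((LH.of_g hV hV').gmul (hlv x0) hv.bd)
  have hlx : ∀ x0, LH (fun s x => Duh (FK 1 φ) (clampT T s) x) x0 := by
    intro x0
    obtain ⟨δ, hδ, B, hB, h1, -⟩ := R1' hφB (hlφ x0) T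
    exact LH.of_deriv (φx := fun s x => Duh (FK 2 φ) (clampT T s) x) hδ hB
      (fun s x hx => (h1 _ (clampT_mem hT.le s) x hx).2) (fun s x hx => (h1 _ (clampT_mem hT.le s) x hx).1)
  refine ⟨v, fun s x => Duh (FK 1 φ) (clampT T s) x, fun s x => Duh (FK 2 φ) (clampT T s) x,
    ⟨⟨_, hv⟩, ⟨_, hbx⟩, hdx, hlv, hlx, fun x => ?_, fun s x => ?_, fun τ hτ x => ?_⟩⟩
  · rw [hfix, clampT_id ⟨le_rfl, hT.le⟩, Duh_zero]
  · rw [hfix, hfix (clampT T s), hcc]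
  · obtain ⟨δ, hδ, B, hB, -, h2⟩ := R1' hφB (hlφ x) T
    have h3 := (h2 τ hτ.1 x (Metric.mem_ball_self hδ)).clamp hτ
    have e : (fun s x => Duh (FK 0 φ) (clampT T s) x) = v := by funext s x; rw [hfix]
    rw [e] at h3
    refine ⟨h3.1.congr_deriv ?_, h3.2⟩
    beta_reduce
    rw [clampT_id (Ioo_subset_Icc_self hτ)]

/-- gauge transform back: `C = e^{-g} v` -/
lemma gauge {f v vx vxx : ℝ → ℝ → ℝ} {g β β' : ℝ → ℝ} {τ x : ℝ}
    (hg : ∀ x, HasDerivAt g (β x) x) (hβ : ∀ x, HasDerivAt β (β' x) x)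
    (h : Dat v (fun t x => 2⁻¹ * vxx t x + (Real.exp (g x) * f t x - Vp β β' x * v t x)) vx vxx τ x) :
    ∃ Ct Cx Cxx : ℝ → ℝ → ℝ, 
     (Ct = fun t x => Real.exp (-g x) * (2⁻¹ * vxx t x + (Real.exp (g x) * f t x - Vp β β' x * v t x))) ∧
     (Cx = fun t x => (-β x * Real.exp (-g x)) * v t x + Real.exp (-g x) * vx t x) ∧
     (Cxx = fun t x => ((-β' x + β x ^ 2) * Real.exp (-g x)) * v t x + 2 * ((-β x * Real.exp (-g x)) * vx t x) + Real.exp (-g x) * vxx t x) ∧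
     Dat (fun t y => Real.exp (-g y) * v t y) Ct Cx Cxx τ x ∧ Ct τ x = 2⁻¹ * Cxx τ x + β x * Cx τ x + f τ x := by
  refine ⟨_, _, _, rfl, rfl, rfl, ?_, ?_⟩
  · refine h.mulg (fun x => ?_) (fun x => ?_)
    · exact ((hg x).neg.exp).congr_deriv (by simp; ring)
    · refine ((hβ x).neg.mul ((hg x).neg.exp)).congr_deriv (by simp; ring)
  · unfold Vp
    have : Real.exp (-g x) * Real.exp (g x) = 1 := by rw [← Real.exp_add]; simp
    linear_combination (f τ x) * this

end SCP


namespace SCP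
open MeasureTheory

/-- bounded solutions of the heat equation with the same source and initial value coincide -/
lemma heat_unique {T M : ℝ} (hT : 0 < T) (D Dt Dx Dxx : ℝ → ℝ → ℝ)
    (hc : ContinuousOn (fun z : ℝ × ℝ => D z.1 z.2) (Icc 0 T ×ˢ univ))
    (hd : ∀ t ∈ Ioo 0 T, ∀ x, Dat D Dt Dx Dxx t x)
    (hle : ∀ t ∈ Ioo 0 T, ∀ x, Dt t x = 2⁻¹ * Dxx t x)
    (h0 : ∀ x, D 0 x = 0) (hA : ∀ t ∈ Icc 0 T, ∀ x, |D t x| ≤ M) :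
    ∀ t ∈ Icc 0 T, ∀ x, D t x = 0 := by
  intro t ht x
  have hb : SB 0 (fun _ => 0) := fun x => by simp
  refine le_antisymm ?_ ?_
  · exact mp_line hT le_rfl hb D Dt Dx Dxx hc hd (fun t ht x => by rw [hle t ht x]; simp)
      (fun x => (h0 x).le) (fun t ht x => (le_abs_self _).trans (hA t ht x)) t ht x
  · have := mp_line hT le_rfl hb _ _ _ _ hc.neg (fun t ht x => (hd t ht x).neg) (fun t ht x => by rw [hle t ht x]; simp)
      (fun x => by rw [h0 x]; simp) (fun t ht x => (neg_le_abs _).trans (hA t ht x)) t ht x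
    linarith

lemma local_rep {f v vx vxx P : ℝ → ℝ → ℝ} {V χ χ1 χ2 : ℝ → ℝ} {T MP A : ℝ} (hT : 0 < T) (h : TS f V T v vx vxx)
    (hχ : ∀ x, HasDerivAt χ (χ1 x) x) (hχ1 : ∀ x, HasDerivAt χ1 (χ2 x) x) {χ3 : ℝ → ℝ} (hχ2 : ∀ x, HasDerivAt χ2 (χ3 x) x)
    (hχ3 : Continuous χ3)
    (hA : ∀ x, |χ x| ≤ A) (hA1 : ∀ x, |χ1 x| ≤ A) (hA2 : ∀ x, |χ2 x| ≤ A)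
    (hP : BC P MP) (hPl : ∀ x0, LH P x0)
    (hPe : ∀ s x, P s x = χ x * (f s x - V x * v s x) + 2⁻¹ * χ2 x * v s x) :
    ∀ τ ∈ Icc 0 T, ∀ x, χ x * v τ x = Duh (FK 0 P) τ x - Duh (FK 1 (fun s x => χ1 x * v s x)) τ x := by
  obtain ⟨Mv, hv⟩ := h.bv
  obtain ⟨Mx, hvx⟩ := h.bx
  have c0 : Continuous χ := continuous_iff_continuousAt.2 fun x => (hχ x).continuousAt
  have c1' : Continuous χ1 := continuous_iff_continuousAt.2 fun x => (hχ1 x).continuousAt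
  have c2 : Continuous χ2 := continuous_iff_continuousAt.2 fun x => (hχ2 x).continuousAt
  have hψ := BC.gmul c1' hA1 hv
  have hψx := (BC.gmul c2 hA2 hv).add (BC.gmul c1' hA1 hvx)
  have hψl : ∀ x0, LH (fun s x => χ2 x * v s x + χ1 x * vx s x) x0 := fun x0 =>
    ((LH.of_g hχ2 hχ3).gmul (h.lv x0) hv.bd).add ((LH.of_g hχ1 c2).gmul (h.lx x0) hvx.bd)
  set Q : ℝ → ℝ → ℝ := fun s x => P s x - (χ2 x * v s x + χ1 x * vx s x) with hQ
  have hQB : BC Q _ := hP.sub hψx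
  have hQl : ∀ x0, LH Q x0 := fun x0 => (hPl x0).sub (hψl x0)
  intro τ hτ x
  have e1 : Duh (FK 0 Q) τ x = Duh (FK 0 P) τ x - Duh (FK 1 (fun s x => χ1 x * v s x)) τ x := by
    rw [hQ, S_sub hP hψx hτ.1, S_deriv_source hψ hψx (fun s x => (hχ1 x).mul (h.dx s x)) τ x hτ.1]
  rw [← e1, ← sub_eq_zero]
  have hE := BC.gmul c0 hA hv
  refine heat_unique (M := A * Mv + (MP + (A * Mv + A * Mx)) * T) hT (fun τ x => χ x * v τ x - Duh (FK 0 Q) τ x)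
    (fun t x => χ x * (2⁻¹ * vxx t x + (f t x - V x * v t x)) - (2⁻¹ * Duh (FK 2 Q) t x + Q t x))
    (fun t x => (χ1 x * v t x + χ x * vx t x) - Duh (FK 1 Q) t x)
    (fun t x => (χ2 x * v t x + 2 * (χ1 x * vx t x) + χ x * vxx t x) - Duh (FK 2 Q) t x) ?_
    (fun t ht x => ?_) (fun t ht x => ?_) (fun x => ?_) (fun t ht x => ?_) τ hτ x
  · exact hE.cont.continuousOn.sub ((S_cont hQB).mono (prod_mono (fun t ht => ht.1) le_rfl))
  · obtain ⟨δ, hδ, B, hB, -, h2⟩ := R1' hQB (hQl x) T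
    exact ((h.dat t ht x).mulg hχ hχ1).sub (h2 t ht.1 x (Metric.mem_ball_self hδ))
  · simp only [hQ, hPe]; ring
  · simp only [h.v0, Duh_zero]; simp
  · refine (abs_sub _ _).trans (add_le_add (hE.bd t x) ((S_bound hQB ht.1 x).trans ?_))
    have := hQB.M0
    gcongr; exact ht.2

lemma C12At.congr {v u f k : ℝ → ℝ → ℝ} {J : Set ℝ} {x0 δ : ℝ} (h : C12At v f J x0) (hJ : IsOpen J) (hδ : 0 < δ)
    (hu : ∀ τ ∈ J, ∀ x ∈ Metric.ball x0 δ, u τ x = v τ x) (hk : ∀ τ ∈ J, ∀ x ∈ Metric.ball x0 δ, k τ x = f τ x) :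
    C12At u k J x0 := by
  obtain ⟨δ1, hδ1, vx, vxx, h1, h2, h3⟩ := h
  have s1 : Metric.ball x0 (min δ δ1) ⊆ Metric.ball x0 δ := Metric.ball_subset_ball (min_le_left _ _)
  have s2 : Metric.ball x0 (min δ δ1) ⊆ Metric.ball x0 δ1 := Metric.ball_subset_ball (min_le_right _ _)
  refine ⟨min δ δ1, lt_min hδ hδ1, vx, vxx, h1.mono (prod_mono le_rfl s2), h2.mono (prod_mono le_rfl s2), fun τ hτ x hx => ?_⟩
  obtain ⟨a, b, c⟩ := h3 τ hτ x (s2 hx)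
  refine ⟨?_, ?_, c⟩
  · rw [hk τ hτ x (s1 hx)]
    refine a.congr_of_eventuallyEq ?_
    filter_upwards [hJ.mem_nhds hτ] with t ht using hu t ht x (s1 hx)
  · refine b.congr_of_eventuallyEq ?_
    filter_upwards [Metric.isOpen_ball.mem_nhds (s1 hx)] with y hy using hu τ hτ y hy

lemma C12At.sub {v u f k : ℝ → ℝ → ℝ} {J : Set ℝ} {x0 : ℝ} (h : C12At v f J x0) (g : C12At u k J x0) :
    C12At (fun τ x => v τ x - u τ x) (fun τ x => f τ x - k τ x) J x0 := by
  obtain ⟨δ1, hδ1, vx, vxx, h1, h2, h3⟩ := h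
  obtain ⟨δ, hδ, ux, uxx, g1, g2, g3⟩ := g
  have s1 : Metric.ball x0 (min δ δ1) ⊆ Metric.ball x0 δ := Metric.ball_subset_ball (min_le_left _ _)
  have s2 : Metric.ball x0 (min δ δ1) ⊆ Metric.ball x0 δ1 := Metric.ball_subset_ball (min_le_right _ _)
  refine ⟨min δ δ1, lt_min hδ hδ1, fun t x => vx t x - ux t x, fun t x => vxx t x - uxx t x,
    (h1.mono (prod_mono le_rfl s2)).sub (g1.mono (prod_mono le_rfl s1)),
    (h2.mono (prod_mono le_rfl s2)).sub (g2.mono (prod_mono le_rfl s1)), fun τ hτ x hx => ?_⟩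
  obtain ⟨a, b, c⟩ := h3 τ hτ x (s2 hx)
  obtain ⟨a', b', c'⟩ := g3 τ hτ x (s1 hx)
  exact ⟨(a.sub a').congr_deriv (by ring), b.sub b', c.sub c'⟩

lemma C12At.mono {v f : ℝ → ℝ → ℝ} {J J' : Set ℝ} {x0 : ℝ} (h : C12At v f J x0) (hJ : J' ⊆ J) : C12At v f J' x0 := by
  obtain ⟨δ1, hδ1, vx, vxx, h1, h2, h3⟩ := h
  exact ⟨δ1, hδ1, vx, vxx, h1.mono (prod_mono hJ le_rfl), h2.mono (prod_mono hJ le_rfl), fun τ hτ x hx => h3 τ (hJ hτ) x hx⟩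

lemma local_reg {C R v : ℝ → ℝ → ℝ} {a e d G : ℝ → ℝ} {T M Mc A x0 : ℝ} (hT : 0 < T) (hC : BC C Mc)
    (hcl : ∀ s x, C s x = C (clampT T s) x) (hR : BC R M) (hRl : LH R x0)
    (ha : Continuous a) (he : Continuous e) (hd : Continuous d)
    (hA : ∀ x, |a x| ≤ A) (hAe : ∀ x, |e x| ≤ A) (hAd : ∀ x, |d x| ≤ A)
    (hal : LH (fun _ => a) x0) (hel : LH (fun _ => e) x0) (hGl : LH (fun _ => G) x0)
    (hd0 : ∀ x ∈ Metric.ball x0 2, d x = 0)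
    (hCv : ∀ s x, C s x = G x * v s x)
    (hrep : ∀ τ ∈ Icc 0 T, ∀ x ∈ Metric.ball x0 2, v τ x = Duh (FK 0 (fun s x => a x * R s x - e x * C s x)) τ x
      - Duh (FK 1 (fun s x => d x * C s x)) τ x) :
    C12At v (fun s x => a x * R s x - e x * C s x) (Ioo 0 T) x0 := by
  set P : ℝ → ℝ → ℝ := fun s x => a x * R s x - e x * C s x with hP
  have hPB : BC P _ := (BC.gmul ha hA hR).sub (BC.gmul he hAe hC)
  set ψ : ℝ → ℝ → ℝ := fun s x => d x * C s x with hψ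
  have hψB : BC ψ _ := BC.gmul hd hAd hC
  have hψ0 : ∀ s, ∀ y ∈ Metric.ball x0 2, ψ s y = 0 := fun s y hy => by simp only [hψ, hd0 y hy, zero_mul]
  have s12 : Metric.ball x0 (2/2) ⊆ Metric.ball x0 2 := Metric.ball_subset_ball (by norm_num)
  obtain ⟨B1, h1⟩ := singv hψB two_pos hψ0 1
  obtain ⟨B2, h2⟩ := singv hψB two_pos hψ0 2
  -- Lipschitz bound for the represented function
  set u : ℝ → ℝ → ℝ := fun s x => Duh (FK 0 P) (clampT T s) x - Duh (FK 1 ψ) (clampT T s) x with hu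
  have hul : LH u x0 := by
    have hB2 := h2.B0
    have hM0 := hPB.M0
    have hc1 := c1_nonneg
    refine LH.of_deriv (δ := 2/2) (B := (A * M + A * Mc) * (2 * c1 * √T) + B2 * T)
      (φx := fun s x => Duh (FK 1 P) (clampT T s) x - Duh (FK 2 ψ) (clampT T s) x) (by norm_num) (by positivity) (fun s x hx => ?_) (fun s x hx => ?_)
    · exact (S_dx hPB (clampT_mem hT.le s).1 x).sub (Duh_dx h1 h2 Metric.isOpen_ball
        (fun r hr s x _ => FK_dx hψB (by norm_num) hr s x) (clampT_mem hT.le s).1 hx)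
    · have hc := clampT_mem hT.le s
      refine (abs_sub _ _).trans (add_le_add ((w1_bound hPB hc.1 x).trans ?_) ((Duh_bound h2 hc.1 hx).trans ?_))
      · have := hc.2
        gcongr
      · simp only [sub_zero, Real.rpow_one, div_one]
        gcongr; exact hc.2
  have hCl : LH C x0 := by
    have hub : ∃ Mu, ∀ s x, |u s x| ≤ Mu := by
      refine ⟨(A * M + A * Mc) * T + A * Mc * (2 * c1 * √T), fun s x => ?_⟩
      have hc := clampT_mem hT.le s
      have hM0 := hPB.M0
      have hM1 := hψB.M0
      have hc1 := c1_nonneg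
      have := hc.2
      refine (abs_sub _ _).trans (add_le_add ((S_bound hPB hc.1 x).trans ?_) ((w1_bound hψB hc.1 x).trans ?_)) <;> gcongr
    obtain ⟨Mu, hMu⟩ := hub
    refine (hGl.gmul hul hMu).congr (δ := 2) two_pos (fun s x hx => ?_)
    rw [hcl, hCv, hrep _ (clampT_mem hT.le s) x hx]
  have hPl : LH P x0 := (hal.gmul hRl hR.bd).sub (hel.gmul hCl hC.bd)
  have r := ((R1 hPB hPl).sub (R2 hψB two_pos hψ0)).mono (J' := Ioo 0 T) (fun t ht => ht.1)
  exact r.congr isOpen_Ioo two_pos (fun τ hτ x hx => hrep τ (Ioo_subset_Icc_self hτ) x hx) (fun τ hτ x hx => by simp)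

end SCP


namespace SCP
open MeasureTheory
open scoped ContDiff

lemma glue {v f : ℝ → ℝ → ℝ} {J : Set ℝ} (hJ : IsOpen J) (h : ∀ x0, C12At v f J x0) :
    ∃ vx vxx : ℝ → ℝ → ℝ, ContinuousOn (fun z : ℝ × ℝ => vx z.1 z.2) (J ×ˢ univ) ∧
      ContinuousOn (fun z : ℝ × ℝ => vxx z.1 z.2) (J ×ˢ univ) ∧
      ∀ τ ∈ J, ∀ x, Dat v (fun t x => 2⁻¹ * vxx t x + f t x) vx vxx τ x := by
  set vx : ℝ → ℝ → ℝ := fun τ x => deriv (fun y => v τ y) x with hvx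
  set vxx : ℝ → ℝ → ℝ := fun τ x => deriv (fun y => vx τ y) x with hvxx
  have key : ∀ x0, ∃ δ > 0, ∃ wx wxx : ℝ → ℝ → ℝ,
    ContinuousOn (fun z : ℝ × ℝ => wx z.1 z.2) (J ×ˢ Metric.ball x0 δ) ∧
    ContinuousOn (fun z : ℝ × ℝ => wxx z.1 z.2) (J ×ˢ Metric.ball x0 δ) ∧
    ∀ τ ∈ J, ∀ x ∈ Metric.ball x0 δ, wx τ x = vx τ x ∧ wxx τ x = vxx τ x ∧
      HasDerivAt (fun t => v t x) (2⁻¹ * vxx τ x + f τ x) τ ∧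
      HasDerivAt (fun y => v τ y) (vx τ x) x ∧ HasDerivAt (fun y => vx τ y) (vxx τ x) x := by
    intro x0
    obtain ⟨δ, hδ, wx, wxx, h1, h2, h3⟩ := h x0
    refine ⟨δ, hδ, wx, wxx, h1, h2, fun τ hτ x hx => ?_⟩
    have e1 : ∀ y ∈ Metric.ball x0 δ, wx τ y = vx τ y := fun y hy => ((h3 τ hτ y hy).2.1.deriv).symm
    obtain ⟨a, b, c⟩ := h3 τ hτ x hx
    have c' : HasDerivAt (fun y => vx τ y) (wxx τ x) x := by
      refine c.congr_of_eventuallyEq ?_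
      filter_upwards [Metric.isOpen_ball.mem_nhds hx] with y hy using (e1 y hy).symm
    have e2 : wxx τ x = vxx τ x := c'.deriv.symm
    rw [e2] at a c'
    rw [e1 x hx] at b
    exact ⟨e1 x hx, e2, a, b, c'⟩
  refine ⟨vx, vxx, ?_, ?_, ?_⟩
  · rintro ⟨τ, x⟩ ⟨hτ, -⟩
    obtain ⟨δ, hδ, wx, wxx, h1, h2, h3⟩ := key x
    have hn : J ×ˢ Metric.ball x δ ∈ nhds (τ, x) := prod_mem_nhds (hJ.mem_nhds hτ) (Metric.ball_mem_nhds x hδ)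
    refine (((h1.congr (fun z hz => (h3 z.1 hz.1 z.2 hz.2).1.symm)).continuousAt hn)).continuousWithinAt
  · rintro ⟨τ, x⟩ ⟨hτ, -⟩
    obtain ⟨δ, hδ, wx, wxx, h1, h2, h3⟩ := key x
    have hn : J ×ˢ Metric.ball x δ ∈ nhds (τ, x) := prod_mem_nhds (hJ.mem_nhds hτ) (Metric.ball_mem_nhds x hδ)
    refine (((h2.congr (fun z hz => (h3 z.1 hz.1 z.2 hz.2).2.1.symm)).continuousAt hn)).continuousWithinAt
  · intro τ hτ x
    obtain ⟨δ, hδ, wx, wxx, h1, h2, h3⟩ := key x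
    exact (h3 τ hτ x (Metric.mem_ball_self hδ)).2.2

/-- antiderivative -/
noncomputable def gI (β : ℝ → ℝ) (x : ℝ) : ℝ := ∫ y in (0:ℝ)..x, β y

lemma gI_deriv {β : ℝ → ℝ} (hβ : Continuous β) (x : ℝ) : HasDerivAt (gI β) (β x) x :=
  intervalIntegral.integral_hasDerivAt_right (hβ.intervalIntegrable _ _)
    (hβ.stronglyMeasurableAtFilter _ _) hβ.continuousAt

lemma gI_bound {β : ℝ → ℝ} (hβ : Continuous β) (hs : HasCompactSupport β) : ∃ G, ∀ x, |gI β x| ≤ G := by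
  have hi : Integrable β := hβ.integrable_of_hasCompactSupport hs
  refine ⟨∫ y, ‖β y‖, fun x => ?_⟩
  refine (intervalIntegral.norm_integral_le_integral_norm_uIoc (f := β) (a := 0) (b := x) (μ := volume)).trans ?_
  exact setIntegral_le_integral hi.norm (Eventually.of_forall fun _ => norm_nonneg _)

lemma smooth_deriv {β : ℝ → ℝ} (h : ContDiff ℝ ∞ β) : ContDiff ℝ ∞ (deriv β) ∧ ∀ x, HasDerivAt β (deriv β x) x :=
  ⟨(contDiff_infty_iff_deriv.1 h).2, fun x => ((contDiff_infty_iff_deriv.1 h).1 x).hasDerivAt⟩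

lemma gI_smooth {β : ℝ → ℝ} (h : ContDiff ℝ ∞ β) : ContDiff ℝ ∞ (gI β) := by
  rw [contDiff_infty_iff_deriv]
  refine ⟨fun x => (gI_deriv h.continuous x).differentiableAt, ?_⟩
  have : deriv (gI β) = β := funext fun x => (gI_deriv h.continuous x).deriv
  rw [this]; exact h

lemma Vp_smooth {β : ℝ → ℝ} (h : ContDiff ℝ ∞ β) : ContDiff ℝ ∞ (Vp β (deriv β)) := by
  unfold Vp
  exact contDiff_const.mul ((h.pow 2).add (smooth_deriv h).1)

lemma cs_bound {β : ℝ → ℝ} (hβ : Continuous β) (hs : HasCompactSupport β) : ∃ A, ∀ x, |β x| ≤ A :=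
  hs.exists_bound_of_continuous hβ

lemma LH.of_smooth {β : ℝ → ℝ} (h : ContDiff ℝ ∞ β) {x0 : ℝ} : LH (fun _ => β) x0 :=
  LH.of_g (smooth_deriv h).2 (smooth_deriv h).1.continuous

lemma approx {β : ℝ → ℝ} {R : ℝ → ℝ → ℝ} {M K T : ℝ} (hβ : ContDiff ℝ ∞ β) (hs : HasCompactSupport β) (hK : 0 ≤ K)
    (hSB : SB K β) (hR : BC R M) (hRl : ∀ x0, LH R x0) (hT : 0 < T) :
    ∃ v vx vxx, TS (fun s x => Real.exp (gI β x) * R s x) (Vp β (deriv β)) T v vx vxx ∧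
      BC (fun s x => Real.exp (-gI β x) * v s x) (M * T) := by
  obtain ⟨G, hG⟩ := gI_bound hβ.continuous hs
  have hgc := (gI_smooth hβ).continuous
  have hexp : ContDiff ℝ ∞ (fun x => Real.exp (gI β x)) := (gI_smooth hβ).exp
  have hexpb : ∀ x, |Real.exp (gI β x)| ≤ Real.exp G := fun x => by
    rw [Real.abs_exp]; exact Real.exp_le_exp.2 ((le_abs_self _).trans (hG x))
  have hexpb' : ∀ x, |Real.exp (-gI β x)| ≤ Real.exp G := fun x => by
    rw [Real.abs_exp]; exact Real.exp_le_exp.2 ((neg_le_abs _).trans (hG x))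
  obtain ⟨A1, hA1⟩ := cs_bound hβ.continuous hs
  obtain ⟨A2, hA2⟩ := cs_bound (smooth_deriv hβ).1.continuous hs.deriv
  have hVs := Vp_smooth hβ
  have hVb : ∀ x, |Vp β (deriv β) x| ≤ A1^2 + A2 := by
    intro x
    unfold Vp
    have h1 : β x ^ 2 ≤ A1 ^ 2 := by rw [← sq_abs]; gcongr; exact hA1 x
    have h2 := abs_le.1 (hA2 x)
    rw [abs_le]; constructor <;> nlinarith [sq_nonneg (β x)]
  obtain ⟨v, vx, vxx, h⟩ := trunc (BC.gmul hexp.continuous hexpb hR)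
    (fun x0 => (LH.of_smooth hexp).gmul (hRl x0) hR.bd) (smooth_deriv hVs).2 (smooth_deriv hVs).1.continuous hVb hT
  refine ⟨v, vx, vxx, h, ?_, ?_⟩
  · obtain ⟨Mv, hv⟩ := h.bv
    exact (BC.gmul (φ := v) (by fun_prop) hexpb' hv).cont
  · obtain ⟨Mv, hv⟩ := h.bv
    have hCb := BC.gmul (φ := v) (by fun_prop) hexpb' hv
    have hgd := gI_deriv hβ.continuous
    have hdat := fun τ (hτ : τ ∈ Ioo 0 T) x => gauge hgd (smooth_deriv hβ).2 (h.dat τ hτ x)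
    have hCc : ContinuousOn (fun z : ℝ × ℝ => Real.exp (-gI β z.2) * v z.1 z.2) (Icc 0 T ×ˢ univ) := hCb.cont.continuousOn
    have hM0 := hR.M0
    have lin : ∀ τ x, Dat (fun t _ => M * t) (fun _ _ => M) (fun _ _ => 0) (fun _ _ => 0) τ x := by
      intro τ x
      exact ⟨by simpa using (hasDerivAt_id τ).const_mul M, hasDerivAt_const _ _, hasDerivAt_const _ _⟩
    have up : ∀ t ∈ Icc 0 T, ∀ x, Real.exp (-gI β x) * v t x - M * t ≤ 0 := by
      refine mp_line hT hK hSB (M := Real.exp G * Mv) (fun t x => Real.exp (-gI β x) * v t x - M * t)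
        (fun t x => (Real.exp (-gI β x) * (2⁻¹ * vxx t x + (Real.exp (gI β x) * R t x - Vp β (deriv β) x * v t x))) - M)
        (fun t x => ((-β x * Real.exp (-gI β x)) * v t x + Real.exp (-gI β x) * vx t x) - 0)
        (fun t x => (((-(deriv β) x + β x ^ 2) * Real.exp (-gI β x)) * v t x + 2 * ((-β x * Real.exp (-gI β x)) * vx t x) + Real.exp (-gI β x) * vxx t x) - 0)
        (hCc.sub (by fun_prop)) (fun t ht x => ?_) (fun t ht x => ?_) (fun x => ?_) (fun t ht x => ?_)
      · obtain ⟨Ct, Cx, Cxx, rfl, rfl, rfl, hh, he⟩ := hdat t ht x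
        exact hh.sub (lin t x)
      · obtain ⟨Ct, Cx, Cxx, rfl, rfl, rfl, hh, he⟩ := hdat t ht x
        beta_reduce at he ⊢
        have := (abs_le.1 (hR.bd t x)).2
        linarith
      · rw [h.v0]; simp
      · have := (abs_le.1 (hCb.bd t x)).2
        have := mul_nonneg hM0 ht.1
        linarith
    have dn : ∀ t ∈ Icc 0 T, ∀ x, -(Real.exp (-gI β x) * v t x) - M * t ≤ 0 := by
      refine mp_line hT hK hSB (M := Real.exp G * Mv) (fun t x => -(Real.exp (-gI β x) * v t x) - M * t)
        (fun t x => -(Real.exp (-gI β x) * (2⁻¹ * vxx t x + (Real.exp (gI β x) * R t x - Vp β (deriv β) x * v t x))) - M)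
        (fun t x => -((-β x * Real.exp (-gI β x)) * v t x + Real.exp (-gI β x) * vx t x) - 0)
        (fun t x => -(((-(deriv β) x + β x ^ 2) * Real.exp (-gI β x)) * v t x + 2 * ((-β x * Real.exp (-gI β x)) * vx t x) + Real.exp (-gI β x) * vxx t x) - 0)
        (hCc.neg.sub (by fun_prop)) (fun t ht x => ?_) (fun t ht x => ?_) (fun x => ?_) (fun t ht x => ?_)
      · obtain ⟨Ct, Cx, Cxx, rfl, rfl, rfl, hh, he⟩ := hdat t ht x
        exact hh.neg.sub (lin t x)
      · obtain ⟨Ct, Cx, Cxx, rfl, rfl, rfl, hh, he⟩ := hdat t ht x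
        beta_reduce at he ⊢
        have := (abs_le.1 (hR.bd t x)).1
        linarith
      · rw [h.v0]; simp
      · have := (abs_le.1 (hCb.bd t x)).1
        have := mul_nonneg hM0 ht.1
        linarith
    intro s x
    rw [h.vc]
    have hc := clampT_mem hT.le s
    have h1 := up _ hc x
    have h2 := dn _ hc x
    have h3 : M * clampT T s ≤ M * T := by gcongr; exact hc.2
    rw [abs_le]; constructor <;> linarith

end SCP


namespace SCP
open MeasureTheory
open scoped ContDiff

/-- bounded solution package of the Cauchy problem with drift `β` -/
structure AP (β : ℝ → ℝ) (R : ℝ → ℝ → ℝ) (T L : ℝ) (C : ℝ → ℝ → ℝ) : Prop where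
  bc : BC C L
  c0 : ∀ x, C 0 x = 0
  cl : ∀ s x, C s x = C (clampT T s) x
  dat : ∃ Ct Cx Cxx : ℝ → ℝ → ℝ, ∀ τ ∈ Ioo 0 T, ∀ x, Dat C Ct Cx Cxx τ x ∧
    Ct τ x = 2⁻¹ * Cxx τ x + β x * Cx τ x + R τ x

lemma AP.of_TS {β : ℝ → ℝ} {R v vx vxx : ℝ → ℝ → ℝ} {T L : ℝ} (hβ : ContDiff ℝ ∞ β)
    (h : TS (fun s x => Real.exp (gI β x) * R s x) (Vp β (deriv β)) T v vx vxx)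
    (hb : BC (fun s x => Real.exp (-gI β x) * v s x) L) :
    AP β R T L (fun s x => Real.exp (-gI β x) * v s x) := by
  refine ⟨hb, fun x => by simp [h.v0], fun s x => by rw [h.vc s x], ?_⟩
  refine ⟨fun t x => Real.exp (-gI β x) * (2⁻¹ * vxx t x + (Real.exp (gI β x) * R t x - Vp β (deriv β) x * v t x)),
    fun t x => (-β x * Real.exp (-gI β x)) * v t x + Real.exp (-gI β x) * vx t x,
    fun t x => ((-(deriv β) x + β x ^ 2) * Real.exp (-gI β x)) * v t x + 2 * ((-β x * Real.exp (-gI β x)) * vx t x) + Real.exp (-gI β x) * vxx t x,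
    fun τ hτ x => ?_⟩
  obtain ⟨Ct, Cx, Cxx, rfl, rfl, rfl, hh, he⟩ := gauge (gI_deriv hβ.continuous) (smooth_deriv hβ).2 (h.dat τ hτ x)
  exact ⟨hh, he⟩

lemma AP.cmp1 {β1 β2 b : ℝ → ℝ} {R C1 C2 : ℝ → ℝ → ℝ} {T K L N : ℝ} (hT : 0 < T) (hK : 0 ≤ K) (hb : SB K b)
    (hN : 0 < N) (h1 : AP β1 R T L C1) (h2 : AP β2 R T L C2)
    (e1 : ∀ x, |x| ≤ N → β1 x = b x) (e2 : ∀ x, |x| ≤ N → β2 x = b x) (s x : ℝ) :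
    C1 s x - C2 s x ≤ (2 * L + 1) / N * (lw x + (K + 2) * T) := by
  have hL := h1.bc.M0
  have htriv : ∀ s x, C1 s x - C2 s x ≤ 2 * L + 1 := fun s x => by
    have := (abs_le.1 (h1.bc.bd s x)).2
    have := (abs_le.1 (h2.bc.bd s x)).1
    linarith
  by_cases hx : |x| ≤ N
  · rw [h1.cl, h2.cl]
    have hc := clampT_mem hT.le s
    obtain ⟨Ct, Cx, Cxx, hd⟩ := h1.dat
    obtain ⟨Dt, Dx, Dxx, gd⟩ := h2.dat
    have := mp_box hT hK hb hN (M := 2 * L + 1) (by linarith) (fun s x => C1 s x - C2 s x)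
      (fun s x => Ct s x - Dt s x) (fun s x => Cx s x - Dx s x) (fun s x => Cxx s x - Dxx s x)
      (h1.bc.cont.sub h2.bc.cont).continuousOn
      (fun t ht x _ => (hd t ht x).1.sub (gd t ht x).1)
      (fun t ht x hx => by
        have hx' : |x| ≤ N := abs_le.2 ⟨hx.1.le, hx.2.le⟩
        have q1 := (hd t ht x).2
        have q2 := (gd t ht x).2
        rw [e1 x hx'] at q1
        rw [e2 x hx'] at q2
        rw [q1, q2]; apply le_of_eq; ring)
      (fun x _ => by rw [h1.c0, h2.c0]; simp) (fun t _ x _ => htriv t x) _ hc x (abs_le.1 hx)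
    refine this.trans ?_
    have : (K + 2) * clampT T s ≤ (K + 2) * T := by gcongr; exact hc.2
    gcongr
  · refine (htriv s x).trans ?_
    have h3 := lw_ge_abs x
    push Not at hx
    rw [div_mul_eq_mul_div, le_div_iff₀ hN]
    have : 0 ≤ (K + 2) * T := by positivity
    gcongr
    linarith

lemma AP.cmp {β1 β2 b : ℝ → ℝ} {R C1 C2 : ℝ → ℝ → ℝ} {T K L N : ℝ} (hT : 0 < T) (hK : 0 ≤ K) (hb : SB K b)
    (hN : 0 < N) (h1 : AP β1 R T L C1) (h2 : AP β2 R T L C2)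
    (e1 : ∀ x, |x| ≤ N → β1 x = b x) (e2 : ∀ x, |x| ≤ N → β2 x = b x) (s x : ℝ) :
    |C1 s x - C2 s x| ≤ (2 * L + 1) / N * (lw x + (K + 2) * T) := by
  have a1 := AP.cmp1 hT hK hb hN h1 h2 e1 e2 s x
  have a2 := AP.cmp1 hT hK hb hN h2 h1 e2 e1 s x
  rw [abs_le]; constructor <;> linarith

lemma cutoff {b : ℝ → ℝ} {K : ℝ} (hb : ContDiff ℝ ∞ b) (hK : 0 ≤ K) (hSB : SB K b) (n : ℕ) :
    ∃ β : ℝ → ℝ, ContDiff ℝ ∞ β ∧ HasCompactSupport β ∧ SB K β ∧ ∀ x, |x| ≤ (n : ℝ) + 1 → β x = b x := by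
  let χ : ContDiffBump (0:ℝ) := ⟨(n:ℝ) + 1, n + 2, by positivity, by linarith⟩
  refine ⟨fun x => χ x * b x, χ.contDiff.mul hb, χ.hasCompactSupport.mul_right, fun x => ?_, fun x hx => ?_⟩
  · have h0 : 0 ≤ χ x := χ.nonneg
    have h1 : χ x ≤ 1 := χ.le_one
    have : 0 ≤ K * |x| := by positivity
    have := hSB x
    calc χ x * b x * x = χ x * (b x * x) := by ring
      _ ≤ χ x * (K * |x|) := by gcongr
      _ ≤ 1 * (K * |x|) := by gcongr
      _ = _ := one_mul _
  · beta_reduce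
    rw [χ.one_of_mem_closedBall, one_mul]
    simpa using hx

lemma gI_eq {β b : ℝ → ℝ} {N : ℝ} (e : ∀ x, |x| ≤ N → β x = b x) {x : ℝ} (hx : |x| ≤ N) : gI β x = gI b x := by
  unfold gI
  refine intervalIntegral.integral_congr (fun y hy => e y ?_)
  have h := abs_sub_left_of_mem_uIcc hy
  simp at h
  exact h.trans hx

lemma deriv_eq {β b : ℝ → ℝ} {N : ℝ} (e : ∀ x, |x| ≤ N → β x = b x) {x : ℝ} (hx : |x| < N) : deriv β x = deriv b x := by
  refine EventuallyEq.deriv_eq ?_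
  filter_upwards [(isOpen_lt continuous_abs continuous_const).mem_nhds hx] with y hy using e y (le_of_lt hy)

/-- convergence of the approximations -/
lemma limit_exists {F : ℕ → ℝ → ℝ → ℝ} {L A B : ℝ} (hA : 0 ≤ A) (hF : ∀ n, BC (F n) L)
    (h : ∀ N n m : ℕ, N ≤ n → N ≤ m → ∀ s x, |F n s x - F m s x| ≤ A / ((N:ℝ) + 1) * (lw x + B)) :
    ∃ C, BC C L ∧ (∀ s x, Tendsto (fun n => F n s x) atTop (nhds (C s x))) ∧
      ∀ (n : ℕ) s x, |F n s x - C s x| ≤ A / ((n:ℝ) + 1) * (lw x + B) := by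
  have t0 : ∀ c : ℝ, Tendsto (fun N : ℕ => A / ((N:ℝ) + 1) * c) atTop (nhds 0) := by
    intro c
    have : Tendsto (fun N : ℕ => A * c * (1 / ((N:ℝ) + 1))) atTop (nhds (A * c * 0)) :=
      tendsto_one_div_add_atTop_nhds_zero_nat.const_mul _
    rw [mul_zero] at this
    refine this.congr (fun N => by ring)
  have hc : ∀ s x, CauchySeq (fun n => F n s x) := by
    intro s x
    refine cauchySeq_of_le_tendsto_0 (fun N : ℕ => A / ((N:ℝ) + 1) * (lw x + B)) (fun n m N hn hm => ?_) (t0 _)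
    rw [Real.dist_eq]; exact h N n m hn hm s x
  choose C hC using fun s x => cauchySeq_tendsto_of_complete (hc s x)
  have rate : ∀ (n : ℕ) s x, |F n s x - C s x| ≤ A / ((n:ℝ) + 1) * (lw x + B) := by
    intro n s x
    refine le_of_tendsto ((tendsto_const_nhds.sub (hC s x)).abs) ?_
    filter_upwards [eventually_ge_atTop n] with m hm using h n n m le_rfl hm s x
  refine ⟨C, ⟨?_, fun s x => ?_⟩, hC, rate⟩
  · have hu : TendstoLocallyUniformly (fun n (z : ℝ × ℝ) => F n z.1 z.2) (fun z => C z.1 z.2) atTop := by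
      rw [Metric.tendstoLocallyUniformly_iff]
      intro ε hε z
      refine ⟨Metric.ball z 1, Metric.ball_mem_nhds _ one_pos, ?_⟩
      filter_upwards [(t0 (|z.2| + 2 + B)).eventually (gt_mem_nhds hε)] with n hn y hy
      rw [Real.dist_eq, abs_sub_comm]
      refine (rate n y.1 y.2).trans_lt (lt_of_le_of_lt ?_ hn)
      have h1 : |y.2| ≤ |z.2| + 1 := by
        have : dist y.2 z.2 < 1 := lt_of_le_of_lt (le_max_right _ _) hy
        rw [Real.dist_eq] at this
        have := abs_sub_abs_le_abs_sub y.2 z.2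
        linarith
      have := lw_le y.2
      gcongr
      linarith
    exact hu.continuous (Frequently.of_forall fun n => (hF n).cont)
  · exact le_of_tendsto (hC s x).abs (Eventually.of_forall fun n => (hF n).bd s x)

end SCP


namespace SCP
open MeasureTheory
open scoped ContDiff

lemma lim_S {φn : ℕ → ℝ → ℝ → ℝ} {φ : ℝ → ℝ → ℝ} {M : ℝ} {Mn ε : ℕ → ℝ} (hn : ∀ n, BC (φn n) (Mn n)) (h : BC φ M)
    (hd : ∀ n, BC (fun s x => φn n s x - φ s x) (ε n)) (hε : Tendsto ε atTop (nhds 0)) {τ : ℝ} (hτ : 0 ≤ τ) (x : ℝ) :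
    Tendsto (fun n => Duh (FK 0 (φn n)) τ x) atTop (nhds (Duh (FK 0 φ) τ x)) := by
  rw [tendsto_iff_norm_sub_tendsto_zero]
  refine squeeze_zero (fun n => norm_nonneg _) (g := fun n => ε n * τ) (fun n => ?_) (by simpa using hε.mul_const τ)
  rw [← S_sub (hn n) h hτ x]
  exact S_bound (hd n) hτ x

lemma lim_w1 {φn : ℕ → ℝ → ℝ → ℝ} {φ : ℝ → ℝ → ℝ} {M : ℝ} {Mn ε : ℕ → ℝ} (hn : ∀ n, BC (φn n) (Mn n)) (h : BC φ M)
    (hd : ∀ n, BC (fun s x => φn n s x - φ s x) (ε n)) (hε : Tendsto ε atTop (nhds 0)) {τ : ℝ} (hτ : 0 ≤ τ) (x : ℝ) :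
    Tendsto (fun n => Duh (FK 1 (φn n)) τ x) atTop (nhds (Duh (FK 1 φ) τ x)) := by
  rw [tendsto_iff_norm_sub_tendsto_zero]
  refine squeeze_zero (fun n => norm_nonneg _) (g := fun n => ε n * (2 * c1 * √τ)) (fun n => ?_)
    (by simpa using hε.mul_const (2 * c1 * √τ))
  rw [← w1_sub (hn n) h hτ x]
  exact w1_bound (hd n) hτ x

lemma loc_bd {e : ℝ → ℝ} {F C : ℝ → ℝ → ℝ} {A L Q B x0 : ℝ} (hQ : 0 ≤ Q) (hec : Continuous e) (hA : ∀ x, |e x| ≤ A)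
    (he0 : ∀ x, 3 < |x - x0| → e x = 0) (hF : BC F L) (hC : BC C L) (hB : 0 ≤ B)
    (hr : ∀ s x, |F s x - C s x| ≤ Q * (lw x + B)) :
    BC (fun s x => e x * (F s x - C s x)) (Q * (A * (|x0| + 4 + B))) := by
  have hA0 : 0 ≤ A := (abs_nonneg _).trans (hA 0)
  refine ⟨(BC.gmul hec hA (hF.sub hC)).cont, fun s x => ?_⟩
  by_cases hx : 3 < |x - x0|
  · rw [he0 x hx, zero_mul, abs_zero]; positivity
  · push Not at hx
    rw [abs_mul]
    have h1 := lw_le x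
    have h2 := abs_sub_abs_le_abs_sub x x0
    calc |e x| * |F s x - C s x| ≤ A * (Q * (lw x + B)) := by
          gcongr
          · exact hA x
          · exact hr s x
      _ ≤ A * (Q * (|x0| + 4 + B)) := by gcongr; linarith
      _ = _ := by ring

/-- local cut-off -/
lemma bump (x0 : ℝ) : ∃ χ : ℝ → ℝ, ContDiff ℝ ∞ χ ∧ HasCompactSupport χ ∧
    (∀ x ∈ Metric.ball x0 2, χ x = 1 ∧ deriv χ x = 0 ∧ deriv (deriv χ) x = 0) ∧
    (∀ x, 3 < |x - x0| → χ x = 0 ∧ deriv χ x = 0 ∧ deriv (deriv χ) x = 0) := by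
  let χ : ContDiffBump x0 := ⟨2, 3, by norm_num, by norm_num⟩
  have op : ∀ (f : ℝ → ℝ) (U : Set ℝ) (c : ℝ), IsOpen U → (∀ x ∈ U, f x = c) → ∀ x ∈ U, deriv f x = 0 := by
    intro f U c hU h x hx
    have : f =ᶠ[nhds x] fun _ => c := by
      filter_upwards [hU.mem_nhds hx] with y hy using h y hy
    rw [this.deriv_eq]; simp
  refine ⟨χ, χ.contDiff, χ.hasCompactSupport, fun x hx => ?_, fun x hx => ?_⟩
  · have h1 : ∀ x ∈ Metric.ball x0 2, χ x = 1 := fun x hx => χ.one_of_mem_closedBall (Metric.ball_subset_closedBall hx)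
    have h2 := op _ _ _ Metric.isOpen_ball h1
    exact ⟨h1 x hx, h2 x hx, op _ _ _ Metric.isOpen_ball h2 x hx⟩
  · have hU : IsOpen {x : ℝ | 3 < |x - x0|} := isOpen_lt continuous_const (by fun_prop)
    have h1 : ∀ x ∈ {x : ℝ | 3 < |x - x0|}, χ x = 0 := fun x hx => χ.zero_of_le_dist (by
      rw [Real.dist_eq]; exact le_of_lt hx)
    have h2 := op _ _ _ hU h1
    exact ⟨h1 x hx, h2 x hx, op _ _ _ hU h2 x hx⟩

lemma six_bound {f1 f2 f3 f4 f5 f6 : ℝ → ℝ} (h1 : ∃ A, ∀ x, |f1 x| ≤ A) (h2 : ∃ A, ∀ x, |f2 x| ≤ A)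
    (h3 : ∃ A, ∀ x, |f3 x| ≤ A) (h4 : ∃ A, ∀ x, |f4 x| ≤ A) (h5 : ∃ A, ∀ x, |f5 x| ≤ A) (h6 : ∃ A, ∀ x, |f6 x| ≤ A) :
    ∃ A, (∀ x, |f1 x| ≤ A) ∧ (∀ x, |f2 x| ≤ A) ∧ (∀ x, |f3 x| ≤ A) ∧ (∀ x, |f4 x| ≤ A) ∧ (∀ x, |f5 x| ≤ A) ∧
      (∀ x, |f6 x| ≤ A) := by
  obtain ⟨A1, h1⟩ := h1
  obtain ⟨A2, h2⟩ := h2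
  obtain ⟨A3, h3⟩ := h3
  obtain ⟨A4, h4⟩ := h4
  obtain ⟨A5, h5⟩ := h5
  obtain ⟨A6, h6⟩ := h6
  have p1 := (abs_nonneg _).trans (h1 0)
  have p2 := (abs_nonneg _).trans (h2 0)
  have p3 := (abs_nonneg _).trans (h3 0)
  have p4 := (abs_nonneg _).trans (h4 0)
  have p5 := (abs_nonneg _).trans (h5 0)
  have p6 := (abs_nonneg _).trans (h6 0)
  refine ⟨A1 + A2 + A3 + A4 + A5 + A6, fun x => (h1 x).trans ?_, fun x => (h2 x).trans ?_, fun x => (h3 x).trans ?_,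
    fun x => (h4 x).trans ?_, fun x => (h5 x).trans ?_, fun x => (h6 x).trans ?_⟩ <;> linarith

theorem line_exists {b : ℝ → ℝ} {R : ℝ → ℝ → ℝ} {M K T : ℝ} (hb : ContDiff ℝ ∞ b) (hK : 0 ≤ K)
    (hSB : SB K b) (hR : BC R M) (hRl : ∀ x0, LH R x0) (hT : 0 < T) :
    ∃ C Cx Cxx : ℝ → ℝ → ℝ, BC C (M * T) ∧ (∀ x, C 0 x = 0) ∧
      ContinuousOn (fun z : ℝ × ℝ => Cx z.1 z.2) (Ioo 0 T ×ˢ univ) ∧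
      ContinuousOn (fun z : ℝ × ℝ => Cxx z.1 z.2) (Ioo 0 T ×ˢ univ) ∧
      ∀ τ ∈ Ioo 0 T, ∀ x, Dat C (fun t x => 2⁻¹ * Cxx t x + b x * Cx t x + R t x) Cx Cxx τ x := by
  choose β hβ hβs hβB hβe using cutoff hb hK hSB
  choose v vx vxx hTS hBC using fun n => approx (hβ n) (hβs n) hK (hβB n) hR hRl hT
  set F : ℕ → ℝ → ℝ → ℝ := fun n s x => Real.exp (-gI (β n) x) * v n s x with hFdef
  have hAP : ∀ n, AP (β n) R T (M * T) (F n) := fun n => AP.of_TS (hβ n) (hTS n) (hBC n)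
  have hMT := (hAP 0).bc.M0
  have hA0 : 0 ≤ 2 * (M * T) + 1 := by linarith
  have hB0 : 0 ≤ (K + 2) * T := by positivity
  obtain ⟨C, hC, hlim, hrate⟩ := limit_exists (F := F) hA0 (fun n => (hAP n).bc) (B := (K + 2) * T)
    (fun N n m hn hm s x => AP.cmp hT hK hSB (by positivity) (hAP n) (hAP m)
      (fun x hx => hβe n x (hx.trans (by gcongr))) (fun x hx => hβe m x (hx.trans (by gcongr))) s x)
  have hcl : ∀ s x, C s x = C (clampT T s) x := fun s x =>
    tendsto_nhds_unique (hlim s x) ((hlim (clampT T s) x).congr fun n => ((hAP n).cl s x).symm)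
  have hC0 : ∀ x, C 0 x = 0 := fun x =>
    tendsto_nhds_unique (hlim 0 x) (tendsto_const_nhds.congr fun n => ((hAP n).c0 x).symm)
  set g := gI b with hg
  set V := Vp b (deriv b) with hV
  have hgs : ContDiff ℝ ∞ g := gI_smooth hb
  have hVs : ContDiff ℝ ∞ V := Vp_smooth hb
  have heg : ContDiff ℝ ∞ (fun x => Real.exp (g x)) := hgs.exp
  have hee : ∀ x, Real.exp (-g x) * Real.exp (g x) = 1 := fun x => by rw [← Real.exp_add]; simp
  have key : ∀ x0, C12At (fun s x => Real.exp (g x) * C s x)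
      (fun s x => Real.exp (g x) * R s x - V x * (Real.exp (g x) * C s x)) (Ioo 0 T) x0 := by
    intro x0
    obtain ⟨χ, hχ, hχs, hin, hout⟩ := bump x0
    have hχ1 := (smooth_deriv hχ).1
    have hχ2 := (smooth_deriv hχ1).1
    have hχ3 := (smooth_deriv hχ2).1
    set a : ℝ → ℝ := fun x => χ x * Real.exp (g x) with ha
    set e : ℝ → ℝ := fun x => (χ x * V x - 2⁻¹ * deriv (deriv χ) x) * Real.exp (g x) with he
    set d : ℝ → ℝ := fun x => deriv χ x * Real.exp (g x) with hd
    have has : ContDiff ℝ ∞ a := hχ.mul heg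
    have hes : ContDiff ℝ ∞ e := ((hχ.mul hVs).sub (contDiff_const.mul hχ2)).mul heg
    have hds : ContDiff ℝ ∞ d := hχ1.mul heg
    have e0 : ∀ x, 3 < |x - x0| → e x = 0 := fun x hx => by
      obtain ⟨q1, q2, q3⟩ := hout x hx
      simp only [he, q1, q3]; ring
    have d0 : ∀ x, 3 < |x - x0| → d x = 0 := fun x hx => by
      obtain ⟨q1, q2, q3⟩ := hout x hx
      simp only [hd, q2]; ring
    have ecs : HasCompactSupport e := by
      refine HasCompactSupport.intro (isCompact_closedBall x0 3) (fun x hx => e0 x ?_)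
      rw [Metric.mem_closedBall, Real.dist_eq] at hx
      exact not_le.1 hx
    obtain ⟨A, hAa, hAe, hAd, hAχ, hAχ1, hAχ2⟩ := six_bound
      (cs_bound has.continuous hχs.mul_right) (cs_bound hes.continuous ecs)
      (cs_bound hds.continuous hχs.deriv.mul_right) (cs_bound hχ.continuous hχs)
      (cs_bound hχ1.continuous hχs.deriv) (cs_bound hχ2.continuous hχs.deriv.deriv)
    obtain ⟨n0, hn0⟩ := exists_nat_ge (|x0| + 4)
    -- representation for large n
    have hrepn : ∀ n, n0 ≤ n → ∀ τ ∈ Icc 0 T, ∀ x ∈ Metric.ball x0 2, Real.exp (g x) * F n τ x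
        = Duh (FK 0 (fun s x => a x * R s x - e x * F n s x)) τ x - Duh (FK 1 (fun s x => d x * F n s x)) τ x := by
      intro n hn τ hτ x hx
      have hnr : (n0:ℝ) ≤ n := by exact_mod_cast hn
      have hsm : ∀ x, |x - x0| ≤ 3 → |x| < (n:ℝ) + 1 := fun x hx => by
        have h2 := abs_sub_abs_le_abs_sub x x0
        linarith
      have ge : ∀ x, |x - x0| ≤ 3 → gI (β n) x = g x := fun x hx => gI_eq (hβe n) (hsm x hx).le
      have Ve : ∀ x, |x - x0| ≤ 3 → Vp (β n) (deriv (β n)) x = V x := fun x hx => by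
        simp only [hV, Vp]
        rw [hβe n x (hsm x hx).le, deriv_eq (hβe n) (hsm x hx)]
      have Fe : ∀ s x, |x - x0| ≤ 3 → v n s x = Real.exp (g x) * F n s x := fun s x hx => by
        simp only [hFdef]
        rw [ge x hx, ← mul_assoc, mul_comm (Real.exp (g x)), hee, one_mul]
      have hP := (BC.gmul has.continuous hAa hR).sub (BC.gmul hes.continuous hAe (hAP n).bc)
      have hFl : ∀ y0, LH (F n) y0 := fun y0 => by
        obtain ⟨Mv, hMv⟩ := (hTS n).bv
        exact LH.gmul (LH.of_smooth (gI_smooth (hβ n)).neg.exp) ((hTS n).lv y0) hMv.bd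
      have hPl : ∀ y0, LH (fun s x => a x * R s x - e x * F n s x) y0 := fun y0 =>
        (LH.gmul (LH.of_smooth has) (hRl y0) hR.bd).sub (LH.gmul (LH.of_smooth hes) (hFl y0) (hAP n).bc.bd)
      have := local_rep hT (hTS n) (smooth_deriv hχ).2 (smooth_deriv hχ1).2 (smooth_deriv hχ2).2 hχ3.continuous
        hAχ hAχ1 hAχ2 hP hPl (fun s x => by
          by_cases hx : |x - x0| ≤ 3
          · rw [ge x hx, Ve x hx, Fe s x hx]; simp only [ha, he]; ring
          · push Not at hx
            obtain ⟨q1, q2, q3⟩ := hout x hx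
            simp only [ha, he, q1, q3]; ring) τ hτ x
      have hx3 : |x - x0| ≤ 3 := by
        rw [Metric.mem_ball, Real.dist_eq] at hx; linarith
      rw [(hin x hx).1, one_mul, Fe τ x hx3] at this
      rw [this]
      have hdd : (fun s x => deriv χ x * v n s x) = fun s x => d x * F n s x := by
        funext s x
        by_cases hx : |x - x0| ≤ 3
        · rw [Fe s x hx]; simp only [hd]; ring
        · push Not at hx
          rw [d0 x hx, (hout x hx).2.1]; ring
      rw [hdd]
    have hε : Tendsto (fun n : ℕ => (2 * (M * T) + 1) / ((n:ℝ) + 1) * (A * (|x0| + 4 + (K + 2) * T))) atTop (nhds 0) := by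
      have : Tendsto (fun N : ℕ => (2 * (M * T) + 1) * (A * (|x0| + 4 + (K + 2) * T)) * (1 / ((N:ℝ) + 1))) atTop
          (nhds ((2 * (M * T) + 1) * (A * (|x0| + 4 + (K + 2) * T)) * 0)) :=
        tendsto_one_div_add_atTop_nhds_zero_nat.const_mul _
      rw [mul_zero] at this
      refine this.congr (fun N => by ring)
    have hrep : ∀ τ ∈ Icc 0 T, ∀ x ∈ Metric.ball x0 2, Real.exp (g x) * C τ x
        = Duh (FK 0 (fun s x => a x * R s x - e x * C s x)) τ x - Duh (FK 1 (fun s x => d x * C s x)) τ x := by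
      intro τ hτ x hx
      have hPC := (BC.gmul has.continuous hAa hR).sub (BC.gmul hes.continuous hAe hC)
      have hPn := fun n => (BC.gmul has.continuous hAa hR).sub (BC.gmul hes.continuous hAe (hAP n).bc)
      have L1 := lim_S hPn hPC (ε := fun n : ℕ => (2 * (M * T) + 1) / ((n:ℝ) + 1) * (A * (|x0| + 4 + (K + 2) * T)))
        (fun n => by
          have h := loc_bd (Q := (2 * (M * T) + 1) / ((n:ℝ) + 1)) (by positivity) hes.continuous hAe e0 (hAP n).bc hC hB0 (hrate n)
          refine ⟨(hPn n).cont.sub hPC.cont, fun s x => ?_⟩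
          have := h.bd s x
          rw [← abs_neg] at this
          convert this using 2
          ring) hε hτ.1 x
      have L2 := lim_w1 (fun n => BC.gmul hds.continuous hAd (hAP n).bc) (BC.gmul hds.continuous hAd hC)
        (ε := fun n : ℕ => (2 * (M * T) + 1) / ((n:ℝ) + 1) * (A * (|x0| + 4 + (K + 2) * T)))
        (fun n => by
          have h := loc_bd (Q := (2 * (M * T) + 1) / ((n:ℝ) + 1)) (by positivity) hds.continuous hAd d0 (hAP n).bc hC hB0 (hrate n)
          simpa only [mul_sub] using h) hε hτ.1 x
      refine tendsto_nhds_unique ((hlim τ x).const_mul (Real.exp (g x))) ((L1.sub L2).congr' ?_)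
      filter_upwards [eventually_ge_atTop n0] with n hn using (hrepn n hn τ hτ x hx).symm
    have := local_reg (v := fun s x => Real.exp (g x) * C s x) (G := fun x => Real.exp (-g x)) hT hC hcl hR (hRl x0)
      has.continuous hes.continuous hds.continuous hAa hAe hAd (LH.of_smooth has) (LH.of_smooth hes)
      (LH.of_smooth hgs.neg.exp) (fun x hx => by simp only [hd, (hin x hx).2.1, zero_mul])
      (fun s x => by rw [← mul_assoc, hee, one_mul]) hrep
    refine this.congr isOpen_Ioo two_pos (fun _ _ _ _ => rfl) (fun τ _ x hx => ?_)
    simp only [ha, he, (hin x hx).1, (hin x hx).2.2]; ring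
  obtain ⟨wx, wxx, hwx, hwxx, hw⟩ := glue isOpen_Ioo key
  have hbc := hb.continuous
  have hb'c := (smooth_deriv hb).1.continuous
  have hgc := hgs.continuous
  have hCc := hC.cont
  refine ⟨C, fun t x => (-b x * Real.exp (-g x)) * (Real.exp (g x) * C t x) + Real.exp (-g x) * wx t x,
    fun t x => ((-(deriv b) x + b x ^ 2) * Real.exp (-g x)) * (Real.exp (g x) * C t x) + 2 * ((-b x * Real.exp (-g x)) * wx t x) + Real.exp (-g x) * wxx t x,
    hC, hC0, ?_, ?_, fun τ hτ x => ?_⟩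
  · refine ContinuousOn.add (Continuous.continuousOn (by fun_prop)) (ContinuousOn.mul (Continuous.continuousOn (by fun_prop)) hwx)
  · refine ContinuousOn.add (ContinuousOn.add (Continuous.continuousOn (by fun_prop)) (continuousOn_const.mul (ContinuousOn.mul (Continuous.continuousOn (by fun_prop)) hwx)))
      (ContinuousOn.mul (Continuous.continuousOn (by fun_prop)) hwxx)
  · obtain ⟨Ct, Cx, Cxx, hct, hcx, hcxx, hh, he⟩ := gauge (f := R) (gI_deriv hbc) (smooth_deriv hb).2 (hw τ hτ x)
    have e1 : (fun t y => Real.exp (-gI b y) * (Real.exp (g y) * C t y)) = C := by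
      funext t y; rw [← mul_assoc, hee, one_mul]
    rw [e1] at hh
    refine ⟨?_, ?_, ?_⟩
    · have := hh.1
      rw [he, hcx, hcxx] at this
      exact this
    · have := hh.2.1
      rw [hcx] at this
      exact this
    · have := hh.2.2
      rw [hcx, hcxx] at this
      exact this

end SCP


namespace SCP
open MeasureTheory
open scoped ContDiff

lemma uniq_le {T k q1 q2 M : ℝ} (hq1 : 0 ≤ q1) (hq2 : 0 ≤ q2)
    (D Dt Dp Dpp : ℝ → ℝ → ℝ)
    (hd : ∀ t ∈ Ico 0 T, ∀ p ∈ Ioo (0:ℝ) 1, HasDerivWithinAt (fun s => D s p) (Dt t p) (Ico 0 T) t ∧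
      HasDerivAt (fun q => D t q) (Dp t p) p ∧ HasDerivAt (fun q => Dp t q) (Dpp t p) p)
    (hc : ContinuousOn (fun z : ℝ × ℝ => D z.1 z.2) (Icc 0 T ×ˢ Ioo 0 1))
    (hpde : ∀ t ∈ Ico 0 T, ∀ p ∈ Ioo (0:ℝ) 1, Dt t p + (-(q1 + q2) * p + q2) * Dp t p + (k * (p * (1 - p))) ^ 2 / 2 * Dpp t p = 0)
    (hT : ∀ p ∈ Ioo (0:ℝ) 1, D T p = 0)
    (hM : ∀ t ∈ Icc 0 T, ∀ p ∈ Ioo (0:ℝ) 1, D t p ≤ M) (hM0 : 0 ≤ M) :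
    ∀ t ∈ Icc 0 T, ∀ p ∈ Ioo (0:ℝ) 1, D t p ≤ 0 := by
  intro t ht p hp
  set K : ℝ := k ^ 2 / 2 + q1 + 2 * q2 with hK
  have hK0 : 0 ≤ K := by positivity
  set w : ℝ → ℝ := fun p => -Real.log p - Real.log (1 - p) with hw
  have key : ∀ ε, 0 < ε → ε < 1/2 → ε < p → ε < 1 - p →
      D t p ≤ (M + 1) / (-Real.log ε) * (w p + (K + 1) * (T - t)) := by
    intro ε h0 h1 h2 h3
    have hsub : Icc ε (1 - ε) ⊆ Ioo 0 1 := fun x hx => ⟨h0.trans_le hx.1, by linarith [hx.2]⟩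
    have hsub' : Ioo ε (1 - ε) ⊆ Ioo 0 1 := fun x hx => hsub ⟨hx.1.le, hx.2.le⟩
    have hl : 0 < -Real.log ε := by have := Real.log_neg h0 (by linarith); linarith
    have dw : ∀ x ∈ Ioo (0:ℝ) 1, HasDerivAt w (-x⁻¹ + (1 - x)⁻¹) x := fun x hx => by
      have a1 := (Real.hasDerivAt_log hx.1.ne').neg
      have a2 := (Real.hasDerivAt_log (x := 1 - x) (by linarith [hx.2])).comp x ((hasDerivAt_id x).const_sub 1)
      exact (a1.sub a2).congr_deriv (by ring)
    have lneg : ∀ x ∈ Ioo (0:ℝ) 1, 0 ≤ -Real.log x := fun x hx => by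
      have := Real.log_neg hx.1 hx.2; linarith
    have mem1 : ∀ x ∈ Ioo (0:ℝ) 1, 1 - x ∈ Ioo (0:ℝ) 1 := fun x hx => ⟨by linarith [hx.2], by linarith [hx.1]⟩
    have hε : ε ∈ Ioo (0:ℝ) 1 := ⟨h0, by linarith⟩
    have := max_principle_lyap (T := T) (A := ε) (B := 1 - ε) (fun p => (k * (p * (1 - p))) ^ 2 / 2)
      (fun p => -(q1 + q2) * p + q2) (fun _ _ => by positivity) w (fun x => -x⁻¹ + (1 - x)⁻¹)
      (fun x => (x ^ 2)⁻¹ + ((1 - x) ^ 2)⁻¹) K (-Real.log ε) (M + 1) hl (by linarith) hK0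
      (fun x hx => (dw x (hsub hx)).continuousAt.continuousWithinAt)
      (fun x hx => dw x (hsub' hx))
      (fun x hx => by
        have hx' := hsub' hx
        have hx1 : (1:ℝ) - x ≠ 0 := by linarith [hx'.2]
        have a1 := (hasDerivAt_inv hx'.1.ne').neg
        have a2 := ((hasDerivAt_id x).const_sub 1).inv hx1
        exact (a1.add a2).congr_deriv (by simp))
      (fun x hx => by
        have hx' := hsub' hx
        have x0 := hx'.1
        have x1 : 0 < 1 - x := by linarith [hx'.2]
        have e1 : (k * (x * (1 - x))) ^ 2 / 2 * ((x ^ 2)⁻¹ + ((1 - x) ^ 2)⁻¹) = k ^ 2 / 2 * ((1 - x) ^ 2 + x ^ 2) := by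
          field_simp
        have e2 : (-(q1 + q2) * x + q2) * (-x⁻¹ + (1 - x)⁻¹) = q1 + 2 * q2 - q2 / x - q1 * x / (1 - x) := by
          field_simp; ring
        have i1 : k ^ 2 / 2 * ((1 - x) ^ 2 + x ^ 2) ≤ k ^ 2 / 2 * 1 := by
          gcongr; nlinarith
        have i2 : 0 ≤ q2 / x := by positivity
        have i3 : 0 ≤ q1 * x / (1 - x) := by positivity
        simp only [hK]
        rw [e1, e2]; linarith)
      (fun x hx => by
        have := lneg x (hsub hx)
        have := lneg _ (mem1 x (hsub hx))
        simp only [hw]; linarith)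
      (by have := lneg _ (mem1 ε hε); simp only [hw]; linarith)
      (by have := lneg _ (mem1 ε hε); simp only [hw, sub_sub_cancel]; linarith)
      (fun s x => D (T - s) x) (fun s x => - Dt (T - s) x) (fun s x => Dp (T - s) x) (fun s x => Dpp (T - s) x)
      (hc.comp (f := fun z : ℝ × ℝ => (T - z.1, z.2)) (by fun_prop)
        (fun z hz => ⟨⟨by linarith [hz.1.2], by linarith [hz.1.1]⟩, hsub hz.2⟩))
      (fun s hs x hx => by
        have a := (hd (T - s) ⟨by linarith [hs.2], by linarith [hs.1]⟩ x (hsub' hx)).1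
        have := a.scomp (t' := Ico 0 T) s (h := fun s => T - s) (s := Ioc 0 T) (h' := -1)
          (((hasDerivAt_id s).const_sub T).hasDerivWithinAt) (fun y hy => ⟨by linarith [hy.2], by linarith [hy.1]⟩)
        exact this.congr_deriv (by simp))
      (fun s hs x hx => (hd (T - s) ⟨by linarith [hs.2], by linarith [hs.1]⟩ x (hsub' hx)).2.1)
      (fun s hs x hx => (hd (T - s) ⟨by linarith [hs.2], by linarith [hs.1]⟩ x (hsub' hx)).2.2)
      (fun s hs x hx => by
        have := hpde (T - s) ⟨by linarith [hs.2], by linarith [hs.1]⟩ x (hsub' hx)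
        linarith)
      (fun x hx => by rw [sub_zero, hT x (hsub hx)])
      (fun s hs => by
        have := hM (T - s) ⟨by linarith [hs.2], by linarith [hs.1]⟩ ε hε
        linarith)
      (fun s hs => by
        have := hM (T - s) ⟨by linarith [hs.2], by linarith [hs.1]⟩ _ (mem1 ε hε)
        linarith)
      (T - t) ⟨by linarith [ht.2], by linarith [ht.1]⟩ p ⟨h2.le, by linarith⟩
    rwa [sub_sub_cancel] at this
  have lim : Tendsto (fun ε => (M + 1) / (-Real.log ε) * (w p + (K + 1) * (T - t))) (nhdsWithin 0 (Ioi 0)) (nhds 0) := by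
    have := (tendsto_neg_atBot_atTop.comp Real.tendsto_log_nhdsGT_zero).const_div_atTop (M + 1)
    simpa using this.mul_const (w p + (K + 1) * (T - t))
  refine ge_of_tendsto lim ?_
  have ev : ∀ c : ℝ, 0 < c → ∀ᶠ ε in nhdsWithin (0:ℝ) (Ioi 0), ε < c := fun c hc =>
    mem_nhdsWithin_of_mem_nhds (Iio_mem_nhds hc)
  filter_upwards [self_mem_nhdsWithin, ev (1/2) (by norm_num), ev p hp.1, ev (1 - p) (by linarith [hp.2])] with ε a b c d
  exact key ε a b c d

end SCP


namespace SCP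
open MeasureTheory
open scoped ContDiff

lemma holder_unif {T p0 : ℝ} {R : ℝ → ℝ → ℝ} (hp0 : p0 ∈ Ioo (0:ℝ) 1)
    (hR : ∀ z ∈ Icc (0:ℝ) T ×ˢ Ioo (0:ℝ) 1, ∃ s ∈ nhdsWithin z (Icc (0:ℝ) T ×ˢ Ioo (0:ℝ) 1), ∃ K α : NNReal,
      0 < α ∧ HolderOnWith K α (fun w : ℝ × ℝ => R w.1 w.2) s) :
    ∃ δ K α : ℝ, 0 < δ ∧ 0 ≤ K ∧ 0 < α ∧ α ≤ 1 ∧ ∀ t ∈ Icc 0 T, ∀ p ∈ Metric.ball p0 δ ∩ Ioo 0 1,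
      ∀ q ∈ Metric.ball p0 δ ∩ Ioo 0 1, |R t p - R t q| ≤ K * |p - q| ^ α := by
  have small : ∀ p ∈ Ioo (0:ℝ) 1, ∀ q ∈ Ioo (0:ℝ) 1, |p - q| ≤ 1 := fun p hp q hq =>
    abs_le.2 ⟨by linarith [hp.1, hq.2], by linarith [hp.2, hq.1]⟩
  have pw : ∀ p ∈ Ioo (0:ℝ) 1, ∀ q ∈ Ioo (0:ℝ) 1, ∀ α β : ℝ, 0 < α → α ≤ β → |p - q| ^ β ≤ |p - q| ^ α :=
    fun p hp q hq α β hα h => Real.rpow_le_rpow_of_exponent_ge' (abs_nonneg _) (small p hp q hq) hα.le h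
  have := isCompact_Icc.induction_on (s := Icc 0 T) (p := fun S => ∃ δ K α : ℝ, 0 < δ ∧ 0 ≤ K ∧ 0 < α ∧ α ≤ 1 ∧
    ∀ t ∈ S ∩ Icc 0 T, ∀ p ∈ Metric.ball p0 δ ∩ Ioo 0 1,
      ∀ q ∈ Metric.ball p0 δ ∩ Ioo 0 1, |R t p - R t q| ≤ K * |p - q| ^ α)
    ⟨1, 0, 1, one_pos, le_rfl, one_pos, le_rfl, fun t ht => absurd ht.1 (notMem_empty _)⟩
    (fun S S' hS => fun ⟨δ, K, α, h1, h2, h3, h4, h5⟩ => ⟨δ, K, α, h1, h2, h3, h4, fun t ht => h5 t ⟨hS ht.1, ht.2⟩⟩)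
    (fun S S' => fun ⟨δ, K, α, h1, h2, h3, h4, h5⟩ ⟨δ', K', α', h1', h2', h3', h4', h5'⟩ => by
      refine ⟨min δ δ', max K K', min α α', lt_min h1 h1', h2.trans (le_max_left _ _), lt_min h3 h3',
        (min_le_left _ _).trans h4, fun t ht p hp q hq => ?_⟩
      have b1 : Metric.ball p0 (min δ δ') ⊆ Metric.ball p0 δ := Metric.ball_subset_ball (min_le_left _ _)
      have b2 : Metric.ball p0 (min δ δ') ⊆ Metric.ball p0 δ' := Metric.ball_subset_ball (min_le_right _ _)
      have hn : 0 ≤ |p - q| ^ (min α α') := Real.rpow_nonneg (abs_nonneg _) _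
      rcases ht.1 with h | h
      · refine (h5 t ⟨h, ht.2⟩ p ⟨b1 hp.1, hp.2⟩ q ⟨b1 hq.1, hq.2⟩).trans ?_
        exact mul_le_mul (le_max_left _ _) (pw p hp.2 q hq.2 _ _ (lt_min h3 h3') (min_le_left _ _))
          (Real.rpow_nonneg (abs_nonneg _) _) (h2.trans (le_max_left _ _))
      · refine (h5' t ⟨h, ht.2⟩ p ⟨b2 hp.1, hp.2⟩ q ⟨b2 hq.1, hq.2⟩).trans ?_
        exact mul_le_mul (le_max_right _ _) (pw p hp.2 q hq.2 _ _ (lt_min h3 h3') (min_le_right _ _))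
          (Real.rpow_nonneg (abs_nonneg _) _) (h2.trans (le_max_left _ _)))
    (fun t ht => by
      obtain ⟨s, hs, K, α, hα, hH⟩ := hR (t, p0) ⟨ht, hp0⟩
      rw [Metric.mem_nhdsWithin_iff] at hs
      obtain ⟨δ, hδ, hs⟩ := hs
      refine ⟨Metric.ball t δ, mem_nhdsWithin_of_mem_nhds (Metric.ball_mem_nhds t hδ), δ, K, min α 1, hδ, K.2,
        lt_min (by exact_mod_cast hα) one_pos, min_le_right _ _, fun r hr p hp q hq => ?_⟩
      have m : ∀ y ∈ Metric.ball p0 δ ∩ Ioo 0 1, (r, y) ∈ s := fun y hy =>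
        hs ⟨by rw [← ball_prod_same]; exact ⟨hr.1, hy.1⟩, ⟨hr.2, hy.2⟩⟩
      have h := hH.dist_le (m p hp) (m q hq)
      have e : dist (r, p) (r, q) = |p - q| := by
        rw [Prod.dist_eq]; simp [Real.dist_eq]
      rw [e, Real.dist_eq] at h
      refine h.trans ?_
      exact mul_le_mul_of_nonneg_left (pw p hp.2 q hq.2 _ _ (lt_min (by exact_mod_cast hα) one_pos) (min_le_left _ _)) K.2)
  obtain ⟨δ, K, α, h1, h2, h3, h4, h5⟩ := this
  exact ⟨δ, K, α, h1, h2, h3, h4, fun t ht => h5 t ⟨ht, ht⟩⟩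

/-- logistic map -/
noncomputable def sg (k x : ℝ) : ℝ := (1 + Real.exp (-(k * x)))⁻¹

lemma sg_mem (k x : ℝ) : sg k x ∈ Ioo (0:ℝ) 1 := by
  unfold sg
  have := Real.exp_pos (-(k * x))
  exact ⟨by positivity, inv_lt_one_of_one_lt₀ (by linarith)⟩

lemma sg_smooth (k : ℝ) : ContDiff ℝ ∞ (sg k) := by
  unfold sg
  refine ContDiff.inv (by fun_prop) (fun x => ?_)
  have := Real.exp_pos (-(k * x))
  positivity

lemma sg_deriv (k x : ℝ) : HasDerivAt (sg k) (k * (sg k x * (1 - sg k x))) x := by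
  have hp := Real.exp_pos (-(k * x))
  have h1 : HasDerivAt (fun x => 1 + Real.exp (-(k * x))) (Real.exp (-(k * x)) * (-(k * 1))) x :=
    (((hasDerivAt_id x).const_mul k).neg.exp).const_add 1
  refine (h1.inv (by positivity)).congr_deriv ?_
  unfold sg
  field_simp
  ring

lemma sg_lip {k : ℝ} (hk : 0 < k) (x y : ℝ) : |sg k x - sg k y| ≤ k * |x - y| := by
  refine Convex.norm_image_sub_le_of_norm_hasDerivWithin_le (s := univ) (fun z _ => (sg_deriv k z).hasDerivWithinAt)
    (fun z _ => ?_) convex_univ (mem_univ y) (mem_univ x)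
  have h := sg_mem k z
  rw [Real.norm_eq_abs, abs_le]
  have h1 := h.1
  have h2 : 0 < 1 - sg k z := by linarith [h.2]
  constructor
  · have : 0 ≤ k * (sg k z * (1 - sg k z)) := by positivity
    linarith
  · have : sg k z * (1 - sg k z) ≤ 1 := by nlinarith
    nlinarith

lemma trans_BC {T M k : ℝ} {R : ℝ → ℝ → ℝ} (hT : 0 ≤ T) (hM : ∀ t ∈ Icc (0:ℝ) T, ∀ p ∈ Ioo (0:ℝ) 1, |R t p| ≤ M)
    (hR : ∀ z ∈ Icc (0:ℝ) T ×ˢ Ioo (0:ℝ) 1, ∃ s ∈ nhdsWithin z (Icc (0:ℝ) T ×ˢ Ioo (0:ℝ) 1), ∃ K α : NNReal,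
      0 < α ∧ HolderOnWith K α (fun w : ℝ × ℝ => R w.1 w.2) s) :
    BC (fun s x => R (T - clampT T s) (sg k x)) M := by
  have hm : ∀ s, T - clampT T s ∈ Icc 0 T := fun s => by
    have := clampT_mem hT s
    exact ⟨by linarith [this.2], by linarith [this.1]⟩
  refine ⟨?_, fun s x => hM _ (hm s) _ (sg_mem k x)⟩
  have hc : ContinuousOn (fun w : ℝ × ℝ => R w.1 w.2) (Icc (0:ℝ) T ×ˢ Ioo (0:ℝ) 1) := by
    intro z hz
    obtain ⟨s, hs, K, α, hα, hH⟩ := hR z hz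
    exact (hH.continuousOn hα z (mem_of_mem_nhdsWithin hz hs)).mono_of_mem_nhdsWithin hs
  exact hc.comp_continuous (f := fun z : ℝ × ℝ => (T - clampT T z.1, sg k z.2))
    ((continuous_const.sub ((clampT_cont T).comp continuous_fst)).prodMk ((sg_smooth k).continuous.comp continuous_snd))
    (fun z => ⟨hm z.1, sg_mem k z.2⟩)

lemma trans_LH {T k : ℝ} {R : ℝ → ℝ → ℝ} (hT : 0 ≤ T) (hk : 0 < k)
    (hR : ∀ z ∈ Icc (0:ℝ) T ×ˢ Ioo (0:ℝ) 1, ∃ s ∈ nhdsWithin z (Icc (0:ℝ) T ×ˢ Ioo (0:ℝ) 1), ∃ K α : NNReal,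
      0 < α ∧ HolderOnWith K α (fun w : ℝ × ℝ => R w.1 w.2) s) (x0 : ℝ) :
    LH (fun s x => R (T - clampT T s) (sg k x)) x0 := by
  obtain ⟨δ, K, α, h1, h2, h3, h4, h5⟩ := holder_unif (sg_mem k x0) hR
  have hm : ∀ s, T - clampT T s ∈ Icc 0 T := fun s => by
    have := clampT_mem hT s
    exact ⟨by linarith [this.2], by linarith [this.1]⟩
  have hb : ∀ x ∈ Metric.ball x0 (δ / k), sg k x ∈ Metric.ball (sg k x0) δ ∩ Ioo 0 1 := fun x hx => by
    refine ⟨?_, sg_mem k x⟩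
    rw [Metric.mem_ball, Real.dist_eq] at hx ⊢
    rw [lt_div_iff₀ hk] at hx
    refine (sg_lip hk x x0).trans_lt (by linarith)
  refine ⟨δ / k, K * k ^ α, α, by positivity, by positivity, h3, h4, fun s x hx y hy => ?_⟩
  refine (h5 _ (hm s) _ (hb x hx) _ (hb y hy)).trans ?_
  rw [mul_assoc, ← Real.mul_rpow hk.le (abs_nonneg _)]
  gcongr
  exact sg_lip hk x y

/-- transformed drift -/
noncomputable def bd (k q1 q2 x : ℝ) : ℝ :=
  (q2 * (1 + Real.exp (-(k * x))) - q1 * (1 + Real.exp (k * x))) / k + k / 2 * (2 * sg k x - 1)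

lemma bd_smooth (k q1 q2 : ℝ) : ContDiff ℝ ∞ (bd k q1 q2) := by
  unfold bd
  have := sg_smooth k
  refine ContDiff.add (ContDiff.div_const (by fun_prop) _) (contDiff_const.mul ((contDiff_const.mul this).sub contDiff_const))

lemma bd_SB {k q1 q2 : ℝ} (hk : 0 < k) (h1 : 0 ≤ q1) (h2 : 0 ≤ q2) : SB (2 * (q1 + q2) / k + k / 2) (bd k q1 q2) := by
  intro x
  have hs := sg_mem k x
  have hp := Real.exp_pos (-(k * x))
  have hp' := Real.exp_pos (k * x)
  rcases le_total 0 x with hx | hx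
  · rw [abs_of_nonneg hx]
    refine mul_le_mul_of_nonneg_right ?_ hx
    have he : Real.exp (-(k * x)) ≤ 1 := Real.exp_le_one_iff.2 (by have := mul_nonneg hk.le hx; linarith)
    unfold bd
    have i1 : q2 * (1 + Real.exp (-(k * x))) - q1 * (1 + Real.exp (k * x)) ≤ 2 * (q1 + q2) := by
      have : q2 * (1 + Real.exp (-(k * x))) ≤ q2 * 2 := by gcongr; linarith
      have : 0 ≤ q1 * (1 + Real.exp (k * x)) := by positivity
      linarith
    have i2 : k / 2 * (2 * sg k x - 1) ≤ k / 2 * 1 := by gcongr; linarith [hs.2]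
    have i3 := div_le_div_of_nonneg_right i1 hk.le
    linarith
  · rw [abs_of_nonpos hx, mul_neg, ← neg_mul]
    refine mul_le_mul_of_nonpos_right ?_ hx
    have he : Real.exp (k * x) ≤ 1 := Real.exp_le_one_iff.2 (mul_nonpos_of_nonneg_of_nonpos hk.le hx)
    unfold bd
    have i1 : -(2 * (q1 + q2)) ≤ q2 * (1 + Real.exp (-(k * x))) - q1 * (1 + Real.exp (k * x)) := by
      have : q1 * (1 + Real.exp (k * x)) ≤ q1 * 2 := by gcongr; linarith
      have : 0 ≤ q2 * (1 + Real.exp (-(k * x))) := by positivity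
      linarith
    have i2 : k / 2 * (-1) ≤ k / 2 * (2 * sg k x - 1) := by gcongr; linarith [hs.1]
    have i3 := div_le_div_of_nonneg_right i1 hk.le
    rw [neg_div] at i3
    linarith

/-- inverse of the logistic map -/
noncomputable def lgt (k p : ℝ) : ℝ := (Real.log p - Real.log (1 - p)) / k

lemma exp_lgt {k p : ℝ} (hk : 0 < k) (hp : p ∈ Ioo (0:ℝ) 1) : Real.exp (k * lgt k p) = p / (1 - p) := by
  unfold lgt
  rw [mul_div_cancel₀ _ hk.ne', Real.exp_sub, Real.exp_log hp.1, Real.exp_log (by linarith [hp.2])]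

lemma sg_lgt {k p : ℝ} (hk : 0 < k) (hp : p ∈ Ioo (0:ℝ) 1) : sg k (lgt k p) = p := by
  unfold sg
  have h0 := hp.1
  have h1 : 0 < 1 - p := by linarith [hp.2]
  rw [Real.exp_neg, exp_lgt hk hp]
  field_simp
  ring

lemma bd_lgt {k p q1 q2 : ℝ} (hk : 0 < k) (hp : p ∈ Ioo (0:ℝ) 1) :
    bd k q1 q2 (lgt k p) = (-(q1 + q2) * p + q2) / (k * (p * (1 - p))) + k / 2 * (2 * p - 1) := by
  unfold bd
  have h0 := hp.1
  have h1 : 0 < 1 - p := by linarith [hp.2]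
  rw [Real.exp_neg, exp_lgt hk hp, sg_lgt hk hp]
  congr 1
  field_simp
  ring

lemma lgt_deriv {k p : ℝ} (hk : 0 < k) (hp : p ∈ Ioo (0:ℝ) 1) : HasDerivAt (lgt k) (1 / (k * (p * (1 - p)))) p := by
  have h0 := hp.1
  have h1 : 0 < 1 - p := by linarith [hp.2]
  have a1 := Real.hasDerivAt_log hp.1.ne'
  have a2 := (Real.hasDerivAt_log (x := 1 - p) h1.ne').comp p ((hasDerivAt_id p).const_sub 1)
  refine ((a1.sub a2).div_const k).congr_deriv ?_
  field_simp
  ring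

lemma lgt_deriv2 {k p : ℝ} (hk : 0 < k) (hp : p ∈ Ioo (0:ℝ) 1) :
    HasDerivAt (fun p => 1 / (k * (p * (1 - p)))) ((2 * p - 1) / (k * (p * (1 - p)) ^ 2)) p := by
  have h0 := hp.1
  have h1 : 0 < 1 - p := by linarith [hp.2]
  have a : HasDerivAt (fun p : ℝ => k * (p * (1 - p))) (k * (1 * (1 - p) + p * (-1))) p :=
    ((hasDerivAt_id p).mul ((hasDerivAt_id p).const_sub 1)).const_mul k
  refine ((hasDerivAt_const p (1:ℝ)).div a (by positivity)).congr_deriv ?_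
  field_simp
  ring

end SCP

namespace SCP
open MeasureTheory
open scoped ContDiff

lemma sol_le {T σ μ₁ μ₂ q1 q2 M1 M2 : ℝ} {η : ℝ → ℝ} {R C D : ℝ → ℝ → ℝ} (hq1 : 0 ≤ q1) (hq2 : 0 ≤ q2)
    (hη : ∀ p, η p = -(q1 + q2) * p + q2) (hC : SolvesSecondCauchy T σ μ₁ μ₂ η R C)
    (hD : SolvesSecondCauchy T σ μ₁ μ₂ η R D)
    (h1 : ∀ t ∈ Icc (0 : ℝ) T, ∀ p ∈ Ioo (0 : ℝ) 1, |C t p| ≤ M1)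
    (h2 : ∀ t ∈ Icc (0 : ℝ) T, ∀ p ∈ Ioo (0 : ℝ) 1, |D t p| ≤ M2) :
    ∀ t ∈ Icc (0 : ℝ) T, ∀ p ∈ Ioo (0 : ℝ) 1, C t p ≤ D t p := by
  intro t ht p hp
  obtain ⟨Ct, Cp, Cpp, c1, -, -, -, c2, c3, c4⟩ := hC
  obtain ⟨Dt, Dp, Dpp, d1, -, -, -, d2, d3, d4⟩ := hD
  have m1 := (abs_nonneg _).trans (h1 t ht p hp)
  have m2 := (abs_nonneg _).trans (h2 t ht p hp)
  have := uniq_le (T := T) (k := (μ₁ - μ₂) / σ) (M := M1 + M2) hq1 hq2 (fun t p => C t p - D t p)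
    (fun t p => Ct t p - Dt t p) (fun t p => Cp t p - Dp t p) (fun t p => Cpp t p - Dpp t p)
    (fun t ht p hp => ⟨(c1 t ht p hp).1.sub (d1 t ht p hp).1, (c1 t ht p hp).2.1.sub (d1 t ht p hp).2.1,
      (c1 t ht p hp).2.2.sub (d1 t ht p hp).2.2⟩)
    (c2.sub d2)
    (fun t ht p hp => by
      have a1 := c3 t ht p hp
      have a2 := d3 t ht p hp
      rw [hη] at a1 a2
      unfold filterBeta at a1 a2
      linear_combination a1 - a2)
    (fun p hp => by rw [c4 p hp, d4 p hp, sub_zero])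
    (fun t ht p hp => by
      have a1 := (abs_le.1 (h1 t ht p hp)).2
      have a2 := (abs_le.1 (h2 t ht p hp)).1
      linarith) (by positivity) t ht p hp
  linarith

lemma exists_sol {T σ μ₁ μ₂ q1 q2 M : ℝ} {η : ℝ → ℝ} {R : ℝ → ℝ → ℝ} (hT : 0 < T) (hσ : 0 < σ) (hμ : μ₂ < μ₁)
    (hq1 : 0 ≤ q1) (hq2 : 0 ≤ q2) (hη : ∀ p, η p = -(q1 + q2) * p + q2)
    (hM : ∀ t ∈ Icc (0 : ℝ) T, ∀ p ∈ Ioo (0 : ℝ) 1, |R t p| ≤ M)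
    (hR : ∀ z ∈ Icc (0 : ℝ) T ×ˢ Ioo (0 : ℝ) 1,
      ∃ s ∈ nhdsWithin z (Icc (0 : ℝ) T ×ˢ Ioo (0 : ℝ) 1), ∃ K α : NNReal, 0 < α ∧
        HolderOnWith K α (fun w : ℝ × ℝ => R w.1 w.2) s) :
    ∃ C, SolvesSecondCauchy T σ μ₁ μ₂ η R C ∧ ∃ M', ∀ t ∈ Icc (0 : ℝ) T, ∀ p ∈ Ioo (0 : ℝ) 1, |C t p| ≤ M' := by
  set k : ℝ := (μ₁ - μ₂) / σ with hkdef
  have hk : 0 < k := div_pos (by linarith) hσ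
  have hRB : BC (fun s x => R (T - clampT T s) (sg k x)) M := trans_BC hT.le hM hR
  obtain ⟨C, Cx, Cxx, hC, hC0, hCx, hCxx, hdat⟩ := line_exists (bd_smooth k q1 q2) (K := 2 * (q1 + q2) / k + k / 2)
    (by positivity) (bd_SB hk hq1 hq2) hRB (trans_LH hT.le hk hR) (T := T + 1) (by linarith)
  have hmem : ∀ t ∈ Ico 0 T, T - t ∈ Ioo 0 (T + 1) := fun t ht => ⟨by linarith [ht.2], by linarith [ht.1]⟩
  have hlc : ContinuousOn (lgt k) (Ioo 0 1) := fun p hp => (lgt_deriv hk hp).continuousAt.continuousWithinAt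
  have hlc1 : ContinuousOn (fun p : ℝ => 1 / (k * (p * (1 - p)))) (Ioo 0 1) := fun p hp =>
    (lgt_deriv2 hk hp).continuousAt.continuousWithinAt
  have hlc2 : ContinuousOn (fun p : ℝ => (2 * p - 1) / (k * (p * (1 - p)) ^ 2)) (Ioo 0 1) := by
    refine ContinuousOn.div (by fun_prop) (by fun_prop) (fun p hp => ?_)
    have h0 := hp.1
    have h1 : 0 < 1 - p := by linarith [hp.2]
    positivity
  have snd : MapsTo Prod.snd (Ico (0:ℝ) T ×ˢ Ioo (0:ℝ) 1) (Ioo (0:ℝ) 1) := fun z hz => hz.2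
  have hφ : ContinuousOn (fun z : ℝ × ℝ => (T - z.1, lgt k z.2)) (Ico 0 T ×ˢ Ioo 0 1) :=
    ContinuousOn.prodMk (by fun_prop) (hlc.comp continuousOn_snd snd)
  have hφm : MapsTo (fun z : ℝ × ℝ => (T - z.1, lgt k z.2)) (Ico 0 T ×ˢ Ioo 0 1) (Ioo 0 (T + 1) ×ˢ univ) :=
    fun z hz => ⟨hmem z.1 hz.1, mem_univ _⟩
  have kx := hCx.comp hφ hφm
  have kxx := hCxx.comp hφ hφm
  have kR := hRB.cont.comp_continuousOn hφ
  have kb := ((bd_smooth k q1 q2).continuous.comp continuous_snd).comp_continuousOn hφ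
  have l1 := hlc1.comp continuousOn_snd snd
  have l2 := hlc2.comp continuousOn_snd snd
  refine ⟨fun t p => C (T - t) (lgt k p), ⟨
    fun t p => -(2⁻¹ * Cxx (T - t) (lgt k p) + bd k q1 q2 (lgt k p) * Cx (T - t) (lgt k p)
      + R (T - clampT T (T - t)) (sg k (lgt k p))),
    fun t p => Cx (T - t) (lgt k p) * (1 / (k * (p * (1 - p)))),
    fun t p => Cxx (T - t) (lgt k p) * (1 / (k * (p * (1 - p)))) * (1 / (k * (p * (1 - p))))
      + Cx (T - t) (lgt k p) * ((2 * p - 1) / (k * (p * (1 - p)) ^ 2)), fun t ht p hp => ⟨?_, ?_, ?_⟩, ?_, ?_, ?_, ?_, ?_, ?_⟩,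
    M * (T + 1), fun t _ p _ => hC.bd _ _⟩
  · exact (HasDerivAt.comp_const_sub T t (hdat _ (hmem t ht) (lgt k p)).1).hasDerivWithinAt
  · exact (hdat _ (hmem t ht) (lgt k p)).2.1.comp p (lgt_deriv hk hp)
  · exact ((hdat _ (hmem t ht) (lgt k p)).2.2.comp p (lgt_deriv hk hp)).mul (lgt_deriv2 hk hp)
  · exact (((continuousOn_const.mul kxx).add (kb.mul kx)).add kR).neg
  · exact kx.mul l1
  · exact ((kxx.mul l1).mul l1).add (kx.mul l2)
  · exact hC.cont.comp_continuousOn (f := fun z : ℝ × ℝ => (T - z.1, lgt k z.2))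
      (ContinuousOn.prodMk (by fun_prop) (hlc.comp continuousOn_snd (fun z hz => hz.2)))
  · intro t ht p hp
    have h0 := hp.1
    have h1 : 0 < 1 - p := by linarith [hp.2]
    have hcl : T - clampT T (T - t) = t := by
      rw [clampT_id ⟨by linarith [ht.2], by linarith [ht.1]⟩]; ring
    beta_reduce
    rw [hcl, sg_lgt hk hp, bd_lgt hk hp, hη]
    unfold filterBeta
    rw [← hkdef]
    field_simp
    ring
  · intro p hp
    simp only [sub_self]
    exact hC0 _

end SCP

/-- Existence, boundedness, and uniqueness (in the class of bounded solutions) for the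
second degenerate Cauchy problem, for any bounded and locally Hölder continuous source
term `R` on `[0,T] × (0,1)`. -/
theorem second_cauchy_problem_wellposed (T σ μ₁ μ₂ : ℝ) (η : ℝ → ℝ) (R : ℝ → ℝ → ℝ)
    (hT : 0 < T) (hσ : 0 < σ) (hμ : μ₂ < μ₁)
    (hη : AdmissibleFilterDrift η)
    (hRbdd : ∃ M : ℝ, ∀ t ∈ Icc (0 : ℝ) T, ∀ p ∈ Ioo (0 : ℝ) 1, |R t p| ≤ M)
    (hRholder : ∀ z ∈ Icc (0 : ℝ) T ×ˢ Ioo (0 : ℝ) 1,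
      ∃ s ∈ nhdsWithin z (Icc (0 : ℝ) T ×ˢ Ioo (0 : ℝ) 1), ∃ K α : NNReal, 0 < α ∧
        HolderOnWith K α (fun w : ℝ × ℝ => R w.1 w.2) s) :
    ∃ C : ℝ → ℝ → ℝ, SolvesSecondCauchy T σ μ₁ μ₂ η R C ∧
      (∃ M : ℝ, ∀ t ∈ Icc (0 : ℝ) T, ∀ p ∈ Ioo (0 : ℝ) 1, |C t p| ≤ M) ∧
      (∀ C' : ℝ → ℝ → ℝ, SolvesSecondCauchy T σ μ₁ μ₂ η R C' →
        (∃ M : ℝ, ∀ t ∈ Icc (0 : ℝ) T, ∀ p ∈ Ioo (0 : ℝ) 1, |C' t p| ≤ M) →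
        ∀ t ∈ Icc (0 : ℝ) T, ∀ p ∈ Ioo (0 : ℝ) 1, C' t p = C t p) := by
  obtain ⟨M, hM⟩ := hRbdd
  obtain ⟨q1, q2, hq1, hq2, hηe⟩ : ∃ q1 q2 : ℝ, 0 ≤ q1 ∧ 0 ≤ q2 ∧ ∀ p, η p = -(q1 + q2) * p + q2 := by
    rcases hη with h | ⟨q1, q2, h1, h2, h⟩
    · exact ⟨0, 0, le_rfl, le_rfl, fun p => by rw [h p]; ring⟩
    · exact ⟨q1, q2, h1.le, h2.le, h⟩
  obtain ⟨C, hC, M', hM'⟩ := SCP.exists_sol hT hσ hμ hq1 hq2 hηe hM hRholder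
  refine ⟨C, hC, ⟨M', hM'⟩, fun C' hC' ⟨M'', hM''⟩ t ht p hp => ?_⟩
  exact le_antisymm (SCP.sol_le hq1 hq2 hηe hC' hC hM'' hM' t ht p hp)
    (SCP.sol_le hq1 hq2 hηe hC hC' hM' hM'' t ht p hp)
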